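/- Let k be a field, let X and Y be separated finite-type k-schemes, and let f : Y → X be a morphism of k-schemes. Then there exist proper k-schemes X̄ and Ȳ, open immersions X → X̄ and Y → Ȳ with dense image, and a morphism f̄ : Ȳ → X̄ such that the square with vertical maps f and f̄ and horizontal maps the open immersions commutes. Moreover, X̄, Ȳ, and f̄ can be chosen such that if f is proper, then Y equals the preimage f̄^{-1}(X), i.e. the commuting square is Cartesian. -/

import Mathlib

open AlgebraicGeometry CategoryTheory

universe u

section

namespace Nag
open Limits TopologicalSpace Scheme.IdealSheafData

lemma comap_ideal_top {T X : Scheme.{u}} [IsAffine T] [IsAffine X] (b : T ⟶ X)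
    (K : X.IdealSheafData) :
    (K.comap b).ideal ⟨⊤, isAffineOpen_top T⟩ =
      (K.ideal ⟨⊤, isAffineOpen_top X⟩).map b.appTop.hom := by
  apply le_antisymm
  · have h : K.comap b ≤ Scheme.IdealSheafData.ofIdealTop
      ((K.ideal ⟨⊤, isAffineOpen_top X⟩).map b.appTop.hom) := by
      rw [← le_map_iff_comap_le]
      apply le_of_isAffine
      rw [ideal_map_of_isAffineHom]
      rw [← Ideal.map_le_iff_le_comap]
      refine le_of_eq ?_
      erw [Scheme.IdealSheafData.ofIdealTop_ideal]
      erw [CategoryTheory.Functor.map_id]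
      exact (Ideal.map_id _).symm
    refine (h _).trans ?_
    refine le_of_eq ?_
    erw [Scheme.IdealSheafData.ofIdealTop_ideal]
    erw [CategoryTheory.Functor.map_id]
    exact (Ideal.map_id _)
  · rw [Ideal.map_le_iff_le_comap]
    have := le_map_comap (J := K) (f := b)
    have h2 := this ⟨⊤, isAffineOpen_top X⟩
    rw [ideal_map_of_isAffineHom] at h2
    exact h2

lemma comap_ideal_openImm {T X : Scheme.{u}} (i : T ⟶ X) [IsOpenImmersion i]
    (K : X.IdealSheafData) (U : T.affineOpens) :
    (K.comap i).ideal U = (K.ideal ⟨i ''ᵁ U, U.2.image_of_isOpenImmersion i⟩).map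
      (i.appIso U).hom.hom := by
  rw [ideal_comap_of_isOpenImmersion]
  let e := (i.appIso U).commRingCatIsoToRingEquiv
  exact (Ideal.map_comap_of_equiv (I := K.ideal ⟨i ''ᵁ U, U.2.image_of_isOpenImmersion i⟩) e).symm

lemma comap_ι_ideal_top {X : Scheme.{u}} (U : X.affineOpens) (K : X.IdealSheafData)
    (h : IsAffineOpen (⊤ : U.1.toScheme.Opens)) :
    (K.comap U.1.ι).ideal ⟨⊤, h⟩ = (K.ideal U).map U.1.topIso.inv.hom := by
  rw [comap_ideal_openImm, Scheme.Opens.ι_appIso]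
  refine (Ideal.map_id _).trans ?_
  exact (K.map_ideal' (V := U) (U := ⟨U.1.ι ''ᵁ ⊤, h.image_of_isOpenImmersion U.1.ι⟩)
    (eqToHom (by simp)).op).symm

lemma comap_ideal {T X : Scheme.{u}} (b : T ⟶ X) (K : X.IdealSheafData)
    (V : X.affineOpens) (O : T.affineOpens) (h : O.1 ≤ b ⁻¹ᵁ V.1) :
    (K.comap b).ideal O = (K.ideal V).map (b.appLE V.1 O.1 h).hom := by
  have : IsAffine O.1 := O.2
  have : IsAffine V.1 := V.2
  have key : (K.comap b).comap O.1.ι = (K.comap V.1.ι).comap (b.resLE V.1 O.1 h) := by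
    rw [← comap_comp, ← comap_comp, Scheme.Hom.resLE_comp_ι]
  have k3 := congrArg (fun J => J.ideal ⟨⊤, isAffineOpen_top _⟩) key
  dsimp only at k3
  rw [comap_ideal_top (b.resLE V.1 O.1 h), comap_ι_ideal_top O, comap_ι_ideal_top V] at k3
  have k4 := congrArg (Ideal.map O.1.topIso.hom.hom) k3
  rw [Ideal.map_map, Ideal.map_map, Ideal.map_map, ← CommRingCat.hom_comp, ← CommRingCat.hom_comp,
    ← CommRingCat.hom_comp] at k4
  rw [Iso.inv_hom_id] at k4
  refine (Ideal.map_id _).symm.trans (k4.trans ?_)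
  congr 2
  rw [Scheme.Hom.appTop, Scheme.Hom.resLE_app_top]
  rw [Category.assoc, Category.assoc, Iso.inv_hom_id_assoc, Iso.inv_hom_id, Category.comp_id]

/-- affine neighbourhoods -/
lemma exists_affine {T : Scheme.{u}} (U : T.Opens) (t : T) (ht : t ∈ U) :
    ∃ O : T.affineOpens, t ∈ O.1 ∧ O.1 ≤ U := by
  obtain ⟨_, ⟨V, hV, rfl⟩, h1, h2⟩ :=
    T.isBasis_affineOpens.exists_subset_of_mem_open ht U.2
  exact ⟨⟨V, hV⟩, h1, h2⟩

lemma ext_local {T : Scheme.{u}} {I J : T.IdealSheafData}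
    (H : ∀ t : T, ∃ O : T.affineOpens, t ∈ O.1 ∧ I.ideal O = J.ideal O) : I = J := by
  choose O h1 h2 using H
  refine Scheme.IdealSheafData.ext_of_iSup_eq_top O ?_ h2
  exact top_le_iff.mp fun t _ => TopologicalSpace.Opens.mem_iSup.mpr ⟨t, h1 t⟩

lemma exists_affine_pair {T X : Scheme.{u}} (b : T ⟶ X) (U : T.Opens) (t : T) (ht : t ∈ U) :
    ∃ (V : X.affineOpens) (O : T.affineOpens), t ∈ O.1 ∧ O.1 ≤ U ∧ O.1 ≤ b ⁻¹ᵁ V.1 := by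
  obtain ⟨V, hV, -⟩ := exists_affine (⊤ : X.Opens) (b t) trivial
  obtain ⟨O, hO, hO2⟩ := exists_affine (U ⊓ b ⁻¹ᵁ V.1) t ⟨ht, hV⟩
  exact ⟨V, O, hO, hO2.trans inf_le_left, hO2.trans inf_le_right⟩

lemma comap_mul {T X : Scheme.{u}} (b : T ⟶ X) (I J : X.IdealSheafData) :
    (I * J).comap b = I.comap b * J.comap b := by
  refine ext_local fun t => ?_
  obtain ⟨V, O, h1, -, h2⟩ := exists_affine_pair b ⊤ t trivial
  refine ⟨O, h1, ?_⟩
  rw [comap_ideal b _ V O h2, Scheme.IdealSheafData.ideal_mul, Pi.mul_apply,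
    Scheme.IdealSheafData.ideal_mul, Pi.mul_apply,
    comap_ideal b _ V O h2, comap_ideal b _ V O h2, Ideal.map_mul]

/-- Invertible ideal sheaves. -/
def Inv {T : Scheme.{u}} (J : T.IdealSheafData) : Prop :=
  ∀ t : T, ∃ O : T.affineOpens, t ∈ O.1 ∧ ∃ g ∈ nonZeroDivisors Γ(T, O.1),
    J.ideal O = Ideal.span {g}

lemma inv_top {T : Scheme.{u}} : Inv (⊤ : T.IdealSheafData) := fun t => by
  obtain ⟨V, hV, -⟩ := exists_affine (⊤ : T.Opens) t trivial
  exact ⟨V, hV, 1, one_mem _, by simp⟩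

lemma nzd_basicOpen {T : Scheme.{u}} (O : T.affineOpens) (f : Γ(T, O.1)) (O' : T.affineOpens)
    (h : O'.1 ≤ O.1) (e : O'.1 = T.basicOpen f)
    (g : Γ(T, O.1)) (hg : g ∈ nonZeroDivisors Γ(T, O.1)) :
    (T.presheaf.map (homOfLE h).op).hom g ∈ nonZeroDivisors Γ(T, O'.1) := by
  obtain ⟨O', hO'⟩ := O'
  dsimp only at e h ⊢
  subst e
  have := O.2.isLocalization_basicOpen f
  exact IsLocalization.map_nonZeroDivisors_le (Submonoid.powers f) Γ(T, T.basicOpen f)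
    (Submonoid.mem_map_of_mem _ hg)

lemma exists_basicOpen_le' {T : Scheme.{u}} (O : T.affineOpens) (U : T.Opens) (t : T)
    (h1 : t ∈ O.1) (h2 : t ∈ U) : ∃ f : Γ(T, O.1), t ∈ T.basicOpen f ∧ T.basicOpen f ≤ U := by
  obtain ⟨f, h3, h4⟩ := O.2.exists_basicOpen_le ⟨t, h2⟩ h1
  exact ⟨f, h4, h3⟩

lemma Inv.small {T : Scheme.{u}} {J : T.IdealSheafData} (hJ : Inv J) (U : T.Opens) (t : T)
    (ht : t ∈ U) : ∃ O : T.affineOpens, t ∈ O.1 ∧ O.1 ≤ U ∧ ∃ g ∈ nonZeroDivisors Γ(T, O.1),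
    J.ideal O = Ideal.span {g} := by
  obtain ⟨O, h1, g, hg, e⟩ := hJ t
  obtain ⟨f, h3, h4⟩ := exists_basicOpen_le' O U t h1 ht
  have hle := T.basicOpen_le f
  refine ⟨T.affineBasicOpen f, h3, h4, _, nzd_basicOpen O f (T.affineBasicOpen f) hle rfl g hg, ?_⟩
  rw [← map_ideal J (V := O) (U := T.affineBasicOpen f) hle, e, Ideal.map_span, Set.image_singleton]
  rfl

lemma alg_refine {C : Type*} [CommRing C] (p : Ideal C) (hp : p ≠ ⊤) (g : C)
    (hg : g ∈ nonZeroDivisors C) (S : Set C) (h : Ideal.span S = Ideal.span {g}) :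
    ∃ s ∈ S, ∃ d, d ∉ p ∧ s = g * d := by
  by_contra! H
  apply hp
  have h1 : Ideal.span S ≤ Ideal.span {g} * p := by
    rw [Ideal.span_le]
    intro s hs
    have : s ∈ Ideal.span {g} := h ▸ Ideal.subset_span hs
    obtain ⟨d, rfl⟩ := Ideal.mem_span_singleton'.mp this
    have hd : d ∈ p := by
      by_contra hd
      exact H _ hs d hd (mul_comm _ _)
    rw [mul_comm d g]
    exact Ideal.mul_mem_mul (Ideal.mem_span_singleton_self g) hd
  rw [h] at h1
  have h2 := h1 (Ideal.mem_span_singleton_self g)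
  obtain ⟨x, hx, e⟩ := Ideal.mem_span_singleton_mul.mp h2
  have : x = 1 := by
    have := mul_left_mem_nonZeroDivisors_eq_zero_iff hg |>.mp (show g * (x - 1) = 0 by
      rw [mul_sub, e, mul_one, sub_self])
    exact sub_eq_zero.mp this
  rw [Ideal.eq_top_iff_one, ← this]; exact hx

/-- geometric version of `alg_refine` -/
lemma geom_refine {T : Scheme.{u}} (O : T.affineOpens) (t : T) (ht : t ∈ O.1) (g : Γ(T, O.1))
    (hg : g ∈ nonZeroDivisors Γ(T, O.1)) (S : Set Γ(T, O.1))
    (h : Ideal.span S = Ideal.span {g}) :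
    ∃ s ∈ S, ∃ d, t ∈ T.basicOpen d ∧ s = g * d := by
  let p := ((O.2.primeIdealOf ⟨t, ht⟩)).asIdeal
  obtain ⟨s, hs, d, hd, e⟩ := alg_refine p (O.2.primeIdealOf ⟨t, ht⟩).2.ne_top g hg S h
  refine ⟨s, hs, d, ?_, e⟩
  have h1 : O.2.primeIdealOf ⟨t, ht⟩ ∈ PrimeSpectrum.basicOpen d := hd
  rw [← O.2.fromSpec_preimage_basicOpen] at h1
  have h2 : O.2.fromSpec (O.2.primeIdealOf ⟨t, ht⟩) ∈ T.basicOpen d := h1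
  rwa [O.2.fromSpec_primeIdealOf] at h2

lemma isUnit_res_basicOpen {T : Scheme.{u}} {O : T.Opens} (d : Γ(T, O)) (O' : T.Opens)
    (h : O' ≤ O) (h' : O' ≤ T.basicOpen d) : IsUnit ((T.presheaf.map (homOfLE h).op).hom d) := by
  have h1 := RingedSpace.isUnit_res_basicOpen T.toRingedSpace d
  have h2 := h1.map (T.presheaf.map (homOfLE h').op).hom
  convert h2 using 1
  have : (homOfLE h).op = (homOfLE (T.basicOpen_le d)).op ≫ (homOfLE h').op := rfl
  rw [this, Functor.map_comp]; rfl

/-- shrinking so that a local generator can be taken in any generating set -/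
lemma Inv.refine_gen {T : Scheme.{u}} {J : T.IdealSheafData} (hJ : Inv J) (U : T.affineOpens)
    (S : Set Γ(T, U.1)) (hS : J.ideal U = Ideal.span S) (U' : T.Opens) (t : T)
    (h1 : t ∈ U.1) (h2 : t ∈ U') :
    ∃ (O : T.affineOpens) (hO : O.1 ≤ U.1), t ∈ O.1 ∧ O.1 ≤ U' ∧ ∃ s ∈ S,
      (T.presheaf.map (homOfLE hO).op).hom s ∈ nonZeroDivisors Γ(T, O.1) ∧
      J.ideal O = Ideal.span {(T.presheaf.map (homOfLE hO).op).hom s} := by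
  obtain ⟨O, h3, h4, g, hg, e⟩ := hJ.small (U.1 ⊓ U') t ⟨h1, h2⟩
  have h5 : O.1 ≤ U.1 := h4.trans inf_le_left
  have e' := e
  rw [← map_ideal J (V := U) (U := O) h5, hS, Ideal.map_span] at e'
  obtain ⟨_, ⟨s, hs, rfl⟩, d, hd, e2⟩ := geom_refine O t h3 g hg _ e'
  have hle := T.basicOpen_le d
  have h6 : (T.affineBasicOpen d).1 ≤ U.1 := hle.trans h5
  have hu := isUnit_res_basicOpen d (T.affineBasicOpen d).1 hle le_rfl
  have e3 : (T.presheaf.map (homOfLE h6).op).hom s =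
    (T.presheaf.map (homOfLE hle).op).hom g * (T.presheaf.map (homOfLE hle).op).hom d := by
    rw [← map_mul, ← e2, ← RingHom.comp_apply, ← CommRingCat.hom_comp, ← Functor.map_comp]; rfl
  refine ⟨T.affineBasicOpen d, h6, hd, hle.trans (h4.trans inf_le_right), s, hs, ?_, ?_⟩
  · rw [e3]
    exact mul_mem (nzd_basicOpen O d _ hle rfl g hg) hu.mem_nonZeroDivisors
  · rw [← map_ideal J (V := O) (U := T.affineBasicOpen d) hle, e, Ideal.map_span,
      Set.image_singleton, e3]
    exact (Ideal.span_singleton_mul_right_unit hu _).symm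

/-- a local generator may be taken from the base. -/
lemma Inv.refine_base {T X : Scheme.{u}} {b : T ⟶ X} {K : X.IdealSheafData}
    (hJ : Inv (K.comap b)) (V : X.affineOpens) (U : T.Opens) (t : T) (h1 : b t ∈ V.1)
    (h2 : t ∈ U) :
    ∃ (O : T.affineOpens) (hO : O.1 ≤ b ⁻¹ᵁ V.1), t ∈ O.1 ∧ O.1 ≤ U ∧ ∃ s ∈ K.ideal V,
      (b.appLE V.1 O.1 hO).hom s ∈ nonZeroDivisors Γ(T, O.1) ∧
      (K.comap b).ideal O = Ideal.span {(b.appLE V.1 O.1 hO).hom s} := by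
  obtain ⟨W, h3, h4⟩ := exists_affine (b ⁻¹ᵁ V.1) t h1
  obtain ⟨O, hO, h5, h6, _, ⟨s, hs, rfl⟩, hn, e⟩ := hJ.refine_gen W _ (comap_ideal b K V W h4) U t h3 h2
  have : (T.presheaf.map (homOfLE hO).op).hom ((b.appLE V.1 W.1 h4).hom s) =
      (b.appLE V.1 O.1 (hO.trans h4)).hom s := by
    rw [← RingHom.comp_apply, ← CommRingCat.hom_comp, Scheme.Hom.appLE_map]
  rw [this] at hn e
  exact ⟨O, hO.trans h4, h5, h6, s, hs, hn, e⟩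

end Nag
end

section

namespace Nag
open Limits TopologicalSpace Scheme.IdealSheafData

lemma iso_nzd {A B : CommRingCat.{u}} (e : A ≅ B) {g : A} (hg : g ∈ nonZeroDivisors A) :
    e.hom.hom g ∈ nonZeroDivisors B := by
  rw [mem_nonZeroDivisors_iff_right]
  intro x hx
  have h1 : e.inv.hom (x * e.hom.hom g) = 0 := by rw [hx, map_zero]
  rw [map_mul] at h1
  have h2 : e.inv.hom (e.hom.hom g) = g := by
    rw [← RingHom.comp_apply, ← CommRingCat.hom_comp, e.hom_inv_id]; rfl
  rw [h2] at h1
  have h3 := (mem_nonZeroDivisors_iff_right.mp hg) _ h1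
  have h4 : e.hom.hom (e.inv.hom x) = x := by
    rw [← RingHom.comp_apply, ← CommRingCat.hom_comp, e.inv_hom_id]; rfl
  rw [← h4, h3, map_zero]

lemma Inv.comap {S T : Scheme.{u}} {J : T.IdealSheafData} (hJ : Inv J) (i : S ⟶ T)
    [IsOpenImmersion i] : Inv (J.comap i) := by
  intro s
  obtain ⟨O, h1, h2, g, hg, e⟩ := hJ.small i.opensRange (i s) ⟨s, rfl⟩
  have ha : IsAffineOpen (i ⁻¹ᵁ O.1) := O.2.preimage_of_isOpenImmersion i h2
  have : IsIso (i.app O.1) := i.isIso_app O.1 h2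
  refine ⟨⟨_, ha⟩, h1, _, iso_nzd (asIso (i.app O.1)) hg, ?_⟩
  rw [comap_ideal i J O ⟨_, ha⟩ le_rfl, e, Ideal.map_span, Set.image_singleton]
  simp [Scheme.Hom.appLE_eq_app]

lemma Inv.of_local {T : Scheme.{u}} {J : T.IdealSheafData}
    (H : ∀ t : T, ∃ (S : Scheme.{u}) (i : S ⟶ T) (_ : IsOpenImmersion i) (s : S),
      i s = t ∧ Inv (J.comap i)) : Inv J := by
  intro t
  obtain ⟨S, i, _, s, rfl, h⟩ := H t
  obtain ⟨O, h1, g, hg, e⟩ := h s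
  refine ⟨⟨i ''ᵁ O.1, O.2.image_of_isOpenImmersion i⟩, ⟨s, h1, rfl⟩, _,
    iso_nzd (i.appIso O.1).symm hg, ?_⟩
  rw [comap_ideal_openImm] at e
  have := congrArg (Ideal.map (i.appIso O.1).inv.hom) e
  rw [Ideal.map_map, ← CommRingCat.hom_comp, Iso.hom_inv_id, Ideal.map_span,
    Set.image_singleton] at this
  exact (Ideal.map_id _).symm.trans this

lemma alg_mul {C : Type*} [CommRing C] (g a b d : C) (hg : g ∈ nonZeroDivisors C) (hd : IsUnit d)
    (I J : Ideal C) (h : I * J = Ideal.span {g}) (ha : a ∈ I) (hb : b ∈ J) (e : a * b = g * d) :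
    a ∈ nonZeroDivisors C ∧ I = Ideal.span {a} := by
  have hgd : a * b ∈ nonZeroDivisors C := e ▸ mul_mem hg hd.mem_nonZeroDivisors
  have ⟨h1, h2⟩ := mul_mem_nonZeroDivisors.mp hgd
  refine ⟨h1, le_antisymm ?_ ((Ideal.span_singleton_le_iff_mem _).mpr ha)⟩
  intro x hx
  have h3 : x * b ∈ Ideal.span {g * d} := by
    rw [Ideal.span_singleton_mul_right_unit hd, ← h]; exact Ideal.mul_mem_mul hx hb
  rw [← e] at h3
  obtain ⟨y, hy⟩ := Ideal.mem_span_singleton'.mp h3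
  rw [Ideal.mem_span_singleton']
  refine ⟨y, ?_⟩
  have : (y * a - x) * b = 0 := by rw [sub_mul, mul_assoc, hy, sub_self]
  exact sub_eq_zero.mp ((mem_nonZeroDivisors_iff_right.mp h2) _ this)

lemma Inv.of_mul {T : Scheme.{u}} {I J : T.IdealSheafData} (h : Inv (I * J)) : Inv I := by
  intro t
  obtain ⟨O, h1, g, hg, e⟩ := h t
  have hS : (I * J).ideal O = Ideal.span {r | ∃ a ∈ I.ideal O, ∃ b ∈ J.ideal O, r = a * b} := by
    rw [Scheme.IdealSheafData.ideal_mul, Pi.mul_apply]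
    apply le_antisymm
    · rw [Ideal.mul_le]; intro a ha b hb; exact Ideal.subset_span ⟨a, ha, b, hb, rfl⟩
    · rw [Ideal.span_le]; rintro _ ⟨a, ha, b, hb, rfl⟩; exact Ideal.mul_mem_mul ha hb
  obtain ⟨O', hO, h3, -, _, ⟨a, ha, b, hb, rfl⟩, hn, e2⟩ := h.refine_gen O _ hS ⊤ t h1 trivial
  refine ⟨O', h3, (T.presheaf.map (homOfLE hO).op).hom a, ?_⟩
  have ha' : (T.presheaf.map (homOfLE hO).op).hom a ∈ I.ideal O' := by
    rw [← map_ideal I (V := O) (U := O') hO]; exact Ideal.mem_map_of_mem _ ha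
  have hb' : (T.presheaf.map (homOfLE hO).op).hom b ∈ J.ideal O' := by
    rw [← map_ideal J (V := O) (U := O') hO]; exact Ideal.mem_map_of_mem _ hb
  rw [Scheme.IdealSheafData.ideal_mul, Pi.mul_apply] at e2
  exact alg_mul _ _ _ 1 hn isUnit_one _ _ e2 ha' hb' (by simp)

lemma Inv.mul {T : Scheme.{u}} {I J : T.IdealSheafData} (h : Inv I) (h' : Inv J) : Inv (I * J) := by
  intro t
  obtain ⟨O, h1, g, hg, e⟩ := h t
  have hS : J.ideal O = Ideal.span (J.ideal O) := by simp
  obtain ⟨O', hO', -, g', hg', e'⟩ := h'.small O.1 t h1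
  obtain ⟨f, h5, h6⟩ := exists_basicOpen_le' O O'.1 t h1 hO'
  obtain ⟨f2, f3, h7, h8⟩ := exists_basicOpen_le_affine_inter O.2 O'.2 t ⟨h1, hO'⟩
  have hle := T.basicOpen_le f2
  have hle' : T.basicOpen f2 ≤ O'.1 := h7.trans_le (T.basicOpen_le f3)
  refine ⟨T.affineBasicOpen f2, h8, _,
    mul_mem (nzd_basicOpen O f2 (T.affineBasicOpen f2) hle rfl g hg)
      (nzd_basicOpen O' f3 (T.affineBasicOpen f2) hle' h7 g' hg'), ?_⟩
  rw [Scheme.IdealSheafData.ideal_mul, Pi.mul_apply,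
    ← map_ideal I (V := O) (U := T.affineBasicOpen f2) hle,
    ← map_ideal J (V := O') (U := T.affineBasicOpen f2) hle', e, e',
    Ideal.map_span, Set.image_singleton, Ideal.map_span, Set.image_singleton,
    Ideal.span_singleton_mul_span_singleton]
  rfl

/-- the complement of an effective Cartier divisor is scheme theoretically dense -/
lemma Inv.dominant {T S : Scheme.{u}} {J : T.IdealSheafData} (hJ : Inv J) (i : S ⟶ T)
    [IsOpenImmersion i] (h : ((J.support : Set T))ᶜ ⊆ Set.range i) :
    IsSchemeTheoreticallyDominant i := by
  constructor
  refine ext_local fun t => ?_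
  obtain ⟨O, h1, g, hg, e⟩ := hJ t
  refine ⟨O, h1, ?_⟩
  refine le_antisymm ?_ (by simp)
  refine (i.ideal_ker_le O).trans ?_
  intro x hx
  have hx : (i.app O.1).hom x = 0 := hx
  have hD : T.basicOpen g ≤ i.opensRange := by
    intro y hy
    apply h
    intro hy2
    have hyO : y ∈ O.1 := T.basicOpen_le g hy
    have := (mem_support_iff_of_mem (I := J) (U := O) hyO).mp hy2
    rw [e] at this
    rw [Scheme.mem_zeroLocus_iff] at this
    exact this g (Ideal.mem_span_singleton_self g) hy
  have h3 : (T.presheaf.map (homOfLE (T.basicOpen_le g)).op).hom x = 0 := by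
    have : IsIso (i.app (T.basicOpen g)) := i.isIso_app _ hD
    have hinj := (ConcreteCategory.bijective_of_isIso (i.app (T.basicOpen g))).1
    apply hinj
    rw [map_zero]
    have nat := i.naturality (homOfLE (T.basicOpen_le g)).op
    have := congrArg (fun f => f.hom x) nat
    refine this.trans ?_
    simp only [CommRingCat.hom_comp, RingHom.comp_apply, hx, map_zero]
  have := O.2.isLocalization_basicOpen g
  obtain ⟨⟨_, n, rfl⟩, hn⟩ := (IsLocalization.map_eq_zero_iff (Submonoid.powers g)
    Γ(T, T.basicOpen g) x).mp h3
  exact (mem_nonZeroDivisors_iff.mp (pow_mem hg n)).1 x hn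

/-- uniqueness of extension. -/
lemma ext_of_dominant {W X Y Z : Scheme.{u}} {f g : X ⟶ Y}
    (s : Y ⟶ Z) [IsSeparated s] (h : f ≫ s = g ≫ s)
    (ι : W ⟶ X) [IsSchemeTheoreticallyDominant ι] (hU : ι ≫ f = ι ≫ g) : f = g := by
  let d := pullback.lift f g h
  let e := pullback.snd (pullback.diagonal s) d
  have hcl : IsClosedImmersion e := inferInstance
  have h1 : ι ≫ d = (ι ≫ f) ≫ pullback.diagonal s := by
    apply pullback.hom_ext
    · rw [Category.assoc, Category.assoc, pullback.diagonal_fst, Category.comp_id,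
        pullback.lift_fst]
    · rw [Category.assoc, Category.assoc, pullback.diagonal_snd, Category.comp_id,
        pullback.lift_snd, hU]
  let l : W ⟶ pullback (pullback.diagonal s) d := pullback.lift (ι ≫ f) ι h1.symm
  have hl : l ≫ e = ι := pullback.lift_snd _ _ _
  have hker : e.ker = ⊥ := by
    rw [eq_bot_iff, ← ι.ker_eq_bot, ← hl]
    exact Scheme.Hom.le_ker_comp l e
  have hiso : IsIso e := by
    have : IsSchemeTheoreticallyDominant e := ⟨hker⟩
    have : IsDominant e := inferInstance
    exact (IsClosedImmersion.isIso_iff_ker_eq_bot).mpr hker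
  rw [← cancel_epi e]
  have c := pullback.condition (f := pullback.diagonal s) (g := d)
  have c1 := congrArg (fun z => z ≫ pullback.fst s s) c
  have c2 := congrArg (fun z => z ≫ pullback.snd s s) c
  simp only [Category.assoc, pullback.diagonal_fst, pullback.diagonal_snd, d,
    pullback.lift_fst, pullback.lift_snd] at c1 c2
  exact c1.symm.trans c2

end Nag
end

section

namespace Nag
open Polynomial HomogeneousLocalization

section Rees
variable {R A : Type u} [CommRing R] [CommRing A] [Algebra R A] (F : Submodule R A)

/-- The graded algebra `⨁ Fⁿ tⁿ`. -/
def ReesG : Subalgebra R A[X] where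
  carrier := {p | ∀ n, p.coeff n ∈ F ^ n}
  mul_mem' := by
    intro p q hp hq n
    rw [coeff_mul]
    refine sum_mem fun x hx => ?_
    rw [← Finset.HasAntidiagonal.mem_antidiagonal.mp hx, pow_add]
    exact Submodule.mul_mem_mul (hp _) (hq _)
  add_mem' := by
    intro p q hp hq n
    rw [coeff_add]
    exact add_mem (hp n) (hq n)
  algebraMap_mem' := by
    intro r n
    rw [Polynomial.algebraMap_apply, coeff_C]
    split_ifs with h
    · subst h
      rw [pow_zero]
      exact Submodule.algebraMap_mem r
    · exact zero_mem _

lemma mem_ReesG {p : A[X]} : p ∈ ReesG F ↔ ∀ n, p.coeff n ∈ F ^ n := Iff.rfl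

/-- graded pieces -/
def gr (n : ℕ) : Submodule R (ReesG F) where
  carrier := {p | ∀ m, m ≠ n → p.1.coeff m = 0}
  add_mem' := by
    intro p q hp hq m hm
    change (p.1 + q.1).coeff m = 0
    rw [coeff_add, hp m hm, hq m hm, add_zero]
  zero_mem' := by intro m _; exact coeff_zero m
  smul_mem' := by
    intro r p hp m hm
    change (r • p.1).coeff m = 0
    rw [coeff_smul, hp m hm, smul_zero]

/-- homogeneous elements -/
noncomputable def mono (n : ℕ) (a : A) (ha : a ∈ F ^ n) : ReesG F :=
  ⟨monomial n a, fun m => by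
    rw [coeff_monomial]; split_ifs with h
    · rw [← h]; exact ha
    · exact zero_mem _⟩

lemma mono_mem (n : ℕ) (a : A) (ha : a ∈ F ^ n) : mono F n a ha ∈ gr F n := by
  intro m hm
  change (monomial n a).coeff m = 0
  rw [coeff_monomial, if_neg hm.symm]

lemma eq_mono {n : ℕ} {p : ReesG F} (hp : p ∈ gr F n) : p = mono F n (p.1.coeff n) (p.2 n) := by
  apply Subtype.ext
  ext m
  change _ = (monomial n _).coeff m
  rw [coeff_monomial]
  split_ifs with h
  · rw [h]
  · exact hp m (Ne.symm h)

lemma sum_mono (p : ReesG F) : p = ∑ i ∈ p.1.support, mono F i (p.1.coeff i) (p.2 i) := by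
  apply Subtype.ext
  rw [AddSubmonoidClass.coe_finsetSum]
  exact p.1.as_sum_support

instance : SetLike.GradedMonoid (gr F) where
  one_mem := by
    intro m hm
    change (1 : A[X]).coeff m = 0
    rw [coeff_one, if_neg hm]
  mul_mem := by
    intro i j p q hp hq m hm
    change (p.1 * q.1).coeff m = 0
    rw [coeff_mul]
    refine Finset.sum_eq_zero fun x hx => ?_
    have hx := Finset.HasAntidiagonal.mem_antidiagonal.mp hx
    by_cases h : x.1 = i
    · have : x.2 ≠ j := by rintro rfl; subst h; exact hm hx.symm
      rw [hq _ this, mul_zero]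
    · rw [hp _ h, zero_mul]

lemma coeff_sum (x : DirectSum ℕ (fun i => gr F i)) (i : ℕ) :
    (DirectSum.coeAddMonoidHom (gr F) x).1.coeff i = (x i).1.1.coeff i := by
  induction x using DirectSum.induction_on with
  | zero => simp
  | of j y =>
    rw [DirectSum.coeAddMonoidHom_of]
    by_cases h : j = i
    · subst h; rw [DirectSum.of_eq_same]
    · rw [DirectSum.of_eq_of_ne _ _ _ (Ne.symm h)]
      rw [y.2 i (Ne.symm h)]; simp
  | add a b ha hb =>
    rw [map_add]
    change (_ + _ : A[X]).coeff i = _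
    rw [coeff_add, ha, hb]; simp

lemma isInternal : DirectSum.IsInternal (gr F) := by
  constructor
  · intro x y hxy
    refine DFinsupp.ext fun i => Subtype.ext (Subtype.ext ?_)
    ext n
    by_cases h : n = i
    · subst h
      rw [← coeff_sum, ← coeff_sum, hxy]
    · rw [(x i).2 n h, (y i).2 n h]
  · intro p
    rw [← AddMonoidHom.mem_mrange]
    rw [sum_mono F p]
    refine sum_mem fun i _ => ?_
    exact ⟨DirectSum.of _ i ⟨_, mono_mem F i _ (p.2 i)⟩, DirectSum.coeAddMonoidHom_of _ _ _⟩

noncomputable instance : DirectSum.Decomposition (gr F) := (isInternal F).chooseDecomposition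

noncomputable instance : GradedAlgebra (gr F) where

/-- degree one elements. -/
noncomputable def tt (f : A) (hf : f ∈ F) : ReesG F := mono F 1 f (by rwa [pow_one])

lemma tt_mem (f : A) (hf : f ∈ F) : tt F f hf ∈ gr F 1 := mono_mem F 1 f _

lemma mono_mul (i j : ℕ) (a b : A) (ha : a ∈ F ^ i) (hb : b ∈ F ^ j) :
    mono F i a ha * mono F j b hb = mono F (i + j) (a * b)
      (by rw [pow_add]; exact Submodule.mul_mem_mul ha hb) := by
  apply Subtype.ext
  exact monomial_mul_monomial _ _ _ _

lemma mono_congr {i j : ℕ} {a b : A} (ha : a ∈ F ^ i) (hb : b ∈ F ^ j) (h1 : i = j) (h2 : a = b) :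
    mono F i a ha = mono F j b hb := by subst h1; subst h2; rfl

lemma tt_pow (f : A) (hf : f ∈ F) (n : ℕ) : tt F f hf ^ n = mono F n (f ^ n)
    (Submodule.pow_mem_pow F hf n) := by
  induction n with
  | zero => apply Subtype.ext; simp [mono]
  | succ n ih =>
    rw [pow_succ, ih, tt, mono_mul]
    exact mono_congr F _ _ rfl (pow_succ f n).symm

lemma irr_le {ι : Type*} (f : ι → A) (hf : ∀ i, f i ∈ F) (hs : F ≤ Submodule.span R (Set.range f)) :
    (HomogeneousIdeal.irrelevant (gr F)).toIdeal ≤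
      Ideal.span (Set.range fun i => tt F (f i) (hf i)) := by
  let I := Ideal.span (Set.range fun i => tt F (f i) (hf i))
  let I' : Submodule R A[X] := (I.restrictScalars R).map (ReesG F).val.toLinearMap
  have key : ∀ n, F ^ (n + 1) ≤ I'.comap ((monomial (n + 1)).restrictScalars R) := by
    intro n
    rw [pow_succ']
    rw [Submodule.mul_le]
    intro x hx y hy
    have hx' := hs hx
    revert hx'
    generalize x = z
    intro hz
    have h1 : Submodule.span R (Set.range f) ≤ (I'.comap ((monomial (n + 1)).restrictScalars R)).comap
      (LinearMap.mulRight R y) := by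
      rw [Submodule.span_le]
      rintro _ ⟨i, rfl⟩
      refine ⟨mono F n y hy * tt F (f i) (hf i), ?_, ?_⟩
      · exact I.mul_mem_left _ (Ideal.subset_span ⟨i, rfl⟩)
      · rw [tt, mono_mul]
        exact congrArg (monomial (n + 1)) (mul_comm y (f i))
    exact h1 hz
  have h2 := HomogeneousIdeal.irrelevant_eq_iSup (gr F)
  change ∀ x, x ∈ _ → x ∈ I
  change (HomogeneousIdeal.irrelevant (gr F)).toAddSubmonoid ≤ I.toAddSubmonoid
  rw [h2]
  refine iSup₂_le fun i hi => ?_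
  intro p hp
  obtain ⟨j, rfl⟩ : ∃ j, i = j + 1 := ⟨i - 1, by omega⟩
  have hp : p ∈ gr F (j + 1) := hp
  obtain ⟨q, hq, e⟩ := key j (p.2 (j + 1))
  have : q = p := by
    rw [eq_mono F hp]; exact Subtype.ext e
  rw [← this]; exact hq

lemma rees_fg (hF : F.FG) : Algebra.FiniteType R (ReesG F) := by
  rw [← Subalgebra.fg_iff_finiteType]
  obtain ⟨S, hS⟩ := hF
  classical
  refine ⟨S.image (monomial 1), le_antisymm ?_ ?_⟩
  · rw [Algebra.adjoin_le_iff]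
    intro x hx
    rw [Finset.coe_image] at hx
    obtain ⟨f, hf, rfl⟩ := hx
    exact (tt F f (hS ▸ Submodule.subset_span hf)).2
  · set B := Algebra.adjoin R (((S.image (monomial 1) : Finset A[X])) : Set A[X]) with hB
    have key : ∀ n, F ^ n ≤ (Subalgebra.toSubmodule B).comap ((monomial n).restrictScalars R) := by
      intro n
      induction n with
      | zero =>
        rw [pow_zero, Submodule.one_le]
        exact one_mem B
      | succ n ih =>
        rw [pow_succ', Submodule.mul_le]
        intro x hx y hy
        have h1 : F ≤ (Subalgebra.toSubmodule B).comap ((monomial 1).restrictScalars R) := by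
          rw [← hS, Submodule.span_le]
          intro f hf
          exact Algebra.subset_adjoin (by rw [Finset.coe_image]; exact ⟨f, hf, rfl⟩)
        have := mul_mem (S := Subalgebra R A[X]) (s := B) (h1 hx) (ih hy)
        change monomial (n + 1) (x * y) ∈ B
        convert this using 1
        change _ = monomial 1 x * monomial n y
        rw [monomial_mul_monomial, add_comm]
    intro p hp
    rw [p.as_sum_support]
    exact sum_mem fun i _ => key i (hp i)

lemma gr_fg (hF : F.FG) : Algebra.FiniteType (gr F 0) (ReesG F) := by
  have := rees_fg F hF
  have : @IsScalarTower R (gr F 0) (ReesG F) Algebra.toSMul Algebra.toSMul Algebra.toSMul :=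
    IsScalarTower.of_algebraMap_eq fun _ => rfl
  exact Algebra.FiniteType.of_restrictScalars_finiteType R (gr F 0) (ReesG F)

lemma zero_surj : Function.Surjective (algebraMap R (gr F 0)) := by
  intro p
  have h : p.1.1.coeff 0 ∈ F ^ 0 := p.1.2 0
  rw [pow_zero, Submodule.mem_one] at h
  obtain ⟨r, hr⟩ := h
  refine ⟨r, Subtype.ext (Subtype.ext ?_)⟩
  have := congrArg Subtype.val (eq_mono F p.2)
  rw [this]
  change algebraMap R A[X] r = monomial 0 _
  rw [← hr]; rfl

end Rees
end Nag
end

section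

namespace Nag
open Polynomial HomogeneousLocalization

section Chart
variable {R A : Type u} [CommRing R] [CommRing A] [Algebra R A] (F : Submodule R A)
variable (h : A) (hh : h ∈ F)

abbrev Ch : Type u := Away (gr F) (tt F h hh)

/-- the element `a tⁿ / (h t)ⁿ`. -/
noncomputable def cmk (n : ℕ) (a : A) (ha : a ∈ F ^ n) : Ch F h hh :=
  Away.mk (gr F) (tt_mem F h hh) n (mono F n a ha) (by
    rw [smul_eq_mul, mul_one]; exact mono_mem F n a ha)

lemma cmk_surj (x : Ch F h hh) : ∃ n a ha, x = cmk F h hh n a ha := by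
  obtain ⟨n, p, hp, rfl⟩ := Away.mk_surjective (gr F) (tt_mem F h hh) x
  have hp' := hp
  rw [smul_eq_mul, mul_one] at hp'
  refine ⟨n, p.1.coeff n, p.2 n, ?_⟩
  apply val_injective
  rw [cmk, Away.val_mk, Away.val_mk]
  congr 1
  exact eq_mono F hp'

lemma cmk_val (n : ℕ) (a : A) (ha : a ∈ F ^ n) : (cmk F h hh n a ha).val =
    Localization.mk (mono F n a ha) (⟨tt F h hh ^ n, ⟨n, rfl⟩⟩ : Submonoid.powers (tt F h hh)) := rfl

noncomputable def crho : R →+* Ch F h hh :=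
  (fromZeroRingHom (gr F) _).comp (algebraMap R (gr F 0))

lemma crho_val (r : R) : (crho F h hh r).val = algebraMap (ReesG F) _ (algebraMap R (ReesG F) r) := by
  rw [← Localization.mk_one_eq_algebraMap]
  rfl

lemma chart_hom {C : Type u} [CommRing C] (ψ : A →+* C) (hu : IsUnit (ψ h)) :
    ∃ Φ : Ch F h hh →+* C, ∀ n a ha, Φ (cmk F h hh n a ha) * ψ h ^ n = ψ a := by
  obtain ⟨v, hv⟩ := hu
  let φ : ReesG F →+* C := (eval₂RingHom ψ (↑v⁻¹ : C)).comp (ReesG F).val.toRingHom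
  have hφ : ∀ n a ha, φ (mono F n a ha) = ψ a * (↑v⁻¹ : C) ^ n := by
    intro n a ha
    exact eval₂_monomial _ _
  have h1 : φ (tt F h hh) = 1 := by
    rw [tt, hφ, ← hv]; simp
  let Φ : Ch F h hh →+* C := (IsLocalization.Away.lift (S := Localization.Away (tt F h hh)) (tt F h hh)
    (g := φ) (by rw [h1]; exact isUnit_one)).comp (algebraMap _ _)
  refine ⟨Φ, fun n a ha => ?_⟩
  have : Φ (cmk F h hh n a ha) = φ (mono F n a ha) := by
    change IsLocalization.Away.lift (S := Localization.Away (tt F h hh)) (tt F h hh)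
      (g := φ) (by rw [h1]; exact isUnit_one) (cmk F h hh n a ha).val = _
    rw [cmk_val, Localization.mk_eq_mk', IsLocalization.Away.lift, IsLocalization.lift_mk'_spec]
    simp [h1]
  rw [this, hφ, ← hv, mul_assoc, ← mul_pow]
  simp

lemma affine_chart (h1 : (1 : A) ∈ F) (hF : ∀ a, ∃ n, a ∈ F ^ n) :
    ∃ Φ : Ch F 1 h1 →+* A, Function.Bijective Φ ∧ Φ.comp (crho F 1 h1) = algebraMap R A := by
  obtain ⟨Φ, hΦ⟩ := chart_hom F 1 h1 (RingHom.id A) (by simp)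
  simp only [RingHom.id_apply, one_pow, mul_one] at hΦ
  refine ⟨Φ, ⟨?_, ?_⟩, ?_⟩
  · rw [injective_iff_map_eq_zero]
    intro x hx
    obtain ⟨n, a, ha, rfl⟩ := cmk_surj F 1 h1 x
    rw [hΦ] at hx
    subst hx
    apply val_injective
    rw [cmk_val]
    have : mono F n 0 ha = 0 := Subtype.ext (monomial n).map_zero
    rw [this, Localization.mk_zero]; simp
  · intro a
    obtain ⟨n, hn⟩ := hF a
    exact ⟨_, hΦ n a hn⟩
  · ext r
    have h0 : algebraMap R A r ∈ F ^ 0 := by rw [pow_zero]; exact Submodule.algebraMap_mem r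
    have : crho F 1 h1 r = cmk F 1 h1 0 (algebraMap R A r) h0 := by
      apply val_injective
      rw [crho_val, cmk_val, ← Localization.mk_one_eq_algebraMap]
      congr 1
    rw [RingHom.comp_apply, this, hΦ]

end Chart

section Blow
variable {R : Type u} [CommRing R] (F : Submodule R R)
variable (h : R) (hh : h ∈ F)

lemma alg_mono (n : ℕ) (a : R) (ha) (r : R) : algebraMap R (ReesG F) r * mono F n a ha =
    mono F n (r * a) ((F ^ n).smul_mem r ha) := by
  apply Subtype.ext
  change C r * monomial n a = monomial n (r * a)
  rw [C_mul_monomial]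

lemma rho_pow_mul (n : ℕ) (a : R) (ha) : crho F h hh (h ^ n) * cmk F h hh n a ha = crho F h hh a := by
  apply val_injective
  rw [val_mul, crho_val, crho_val, cmk_val,
    ← Localization.mk_one_eq_algebraMap, ← Localization.mk_one_eq_algebraMap, Localization.mk_mul,
    Localization.mk_eq_mk_iff, Localization.r_iff_exists]
  refine ⟨1, ?_⟩
  simp only [OneMemClass.coe_one, one_mul, mul_one]
  rw [tt_pow, alg_mono, mul_comm (mono F n _ _), alg_mono]
  exact mono_congr F _ _ rfl (mul_comm _ _)

lemma rho_nzd : crho F h hh h ∈ nonZeroDivisors (Ch F h hh) := by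
  refine (mem_nonZeroDivisors_iff_right (M₀ := Ch F h hh)).mpr fun x hx => ?_
  obtain ⟨n, a, ha, rfl⟩ := cmk_surj F h hh x
  have hx := congrArg HomogeneousLocalization.val hx
  apply val_injective
  rw [val_mul, crho_val, cmk_val, ← Localization.mk_one_eq_algebraMap, Localization.mk_mul, mul_comm,
    alg_mono, val_zero, ← Localization.mk_zero 1, Localization.mk_eq_mk_iff,
    Localization.r_iff_exists] at hx
  obtain ⟨⟨_, m, rfl⟩, hc⟩ := hx
  rw [cmk_val, val_zero, ← Localization.mk_zero 1, Localization.mk_eq_mk_iff,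
    Localization.r_iff_exists]
  refine ⟨⟨_, m + 1, rfl⟩, ?_⟩
  simp only [OneMemClass.coe_one, one_mul, mul_one, mul_zero] at hc ⊢
  rw [tt_pow, mono_mul] at hc ⊢
  have hc' := congrArg (fun p => p.1.coeff (m + n)) hc
  change (monomial (m + n) (h ^ m * (h * a))).coeff (m + n) = (0 : R[X]).coeff _ at hc'
  rw [coeff_monomial_same, coeff_zero] at hc'
  apply Subtype.ext
  change monomial _ _ = 0
  rw [pow_succ, mul_assoc, hc', map_zero]

lemma blow_hom {C : Type u} [CommRing C] (ψ : R →+* C) (hn : ψ h ∈ nonZeroDivisors C)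
    (hK : ∀ f ∈ F, ψ f ∈ Ideal.span {ψ h}) :
    ∃ Φ : Ch F h hh →+* C, Φ.comp (crho F h hh) = ψ := by
  let L := Localization.Away (ψ h)
  have hinj : Function.Injective (algebraMap C L) :=
    IsLocalization.injective (M := Submonoid.powers (ψ h)) L
      (by rw [Submonoid.powers_le]; exact hn)
  have hu : IsUnit (algebraMap C L (ψ h)) := IsLocalization.Away.algebraMap_isUnit (ψ h)
  obtain ⟨Φ, hΦ⟩ := chart_hom F h hh ((algebraMap C L).comp ψ) hu
  have hK' : ∀ n, ∀ a ∈ F ^ n, ψ a ∈ (Ideal.span {ψ h ^ n} : Ideal C) := by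
    intro n
    have : F ^ n ≤ (Ideal.comap ψ (Ideal.span {ψ h ^ n} : Ideal C) : Ideal R) := by
      induction n with
      | zero => simp
      | succ n ih =>
        rw [pow_succ, Submodule.mul_le]
        intro x hx y hy
        change ψ (x * y) ∈ (Ideal.span {ψ h ^ (n+1)} : Ideal C)
        rw [map_mul, pow_succ, ← Ideal.span_singleton_mul_span_singleton]
        exact Ideal.mul_mem_mul (ih hx) (hK y hy)
    exact this
  have hr : ∀ x, Φ x ∈ (algebraMap C L).range := by
    intro x
    obtain ⟨n, a, ha, rfl⟩ := cmk_surj F h hh x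
    obtain ⟨c, hc⟩ := Ideal.mem_span_singleton'.mp (hK' n a ha)
    refine ⟨c, ?_⟩
    apply (hu.pow n).mul_right_cancel
    have := hΦ n a ha
    simp only [RingHom.comp_apply] at this
    rw [this, ← hc]; simp
  let e : C ≃+* (algebraMap C L).range := RingEquiv.ofBijective (algebraMap C L).rangeRestrict
    ⟨fun x y hxy => hinj (congrArg Subtype.val hxy), RingHom.rangeRestrict_surjective _⟩
  refine ⟨e.symm.toRingHom.comp (Φ.codRestrict _ hr), ?_⟩
  ext r
  change e.symm _ = _
  rw [RingEquiv.symm_apply_eq]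
  apply Subtype.ext
  change Φ (crho F h hh r) = algebraMap C L (ψ r)
  have h0 : r ∈ F ^ 0 := by rw [pow_zero]; exact Submodule.algebraMap_mem r
  have := hΦ 0 r h0
  have e2 := rho_pow_mul F h hh 0 r h0
  have e3 := congrArg Φ e2
  rw [map_mul, pow_zero, map_one, map_one, one_mul] at e3
  rw [← e3]
  simpa using this

lemma blow_hom_uniq {C : Type u} [CommRing C] (Φ Φ' : Ch F h hh →+* C)
    (hn : Φ (crho F h hh h) ∈ nonZeroDivisors C)
    (hK : Φ.comp (crho F h hh) = Φ'.comp (crho F h hh)) : Φ = Φ' := by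
  ext x
  obtain ⟨n, a, ha, rfl⟩ := cmk_surj F h hh x
  have e : ∀ r, Φ (crho F h hh r) = Φ' (crho F h hh r) := fun r => RingHom.congr_fun hK r
  have e2 := rho_pow_mul F h hh n a ha
  have e3 := congrArg Φ e2
  have e4 := congrArg Φ' e2
  rw [← e, ← e3] at e4
  rw [map_mul, map_mul, ← e, map_pow, map_pow] at e4
  exact ((mul_cancel_left_mem_nonZeroDivisors (pow_mem hn n)).mp e4).symm

end Blow
end Nag
end

section
open Limits

namespace Nag

lemma exists_cover {S : Scheme.{u}} (P : ∀ S' : Scheme.{u}, (S' ⟶ S) → Prop)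
    (H : ∀ t : S, ∃ (S' : Scheme.{u}) (i : S' ⟶ S) (_ : IsOpenImmersion i), t ∈ Set.range i ∧ P S' i) :
    ∃ 𝒰 : Scheme.OpenCover.{u} S, ∀ j, P (𝒰.X j) (𝒰.f j) := by
  choose S' i hi ht hP using H
  exact ⟨Scheme.Cover.mkOfCovers S S' i (fun x => ⟨x, ht x⟩) hi, hP⟩

lemma hom_ext_local {S T : Scheme.{u}} (l l' : S ⟶ T)
    (H : ∀ t : S, ∃ (S' : Scheme.{u}) (i : S' ⟶ S) (_ : IsOpenImmersion i), t ∈ Set.range i ∧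
      i ≫ l = i ≫ l') : l = l' := by
  obtain ⟨𝒰, h⟩ := exists_cover _ H
  exact 𝒰.hom_ext _ _ h

lemma glue_local {S T X : Scheme.{u}} (s : S ⟶ X) (b : T ⟶ X)
    (H : ∀ t : S, ∃ (S' : Scheme.{u}) (i : S' ⟶ S) (_ : IsOpenImmersion i), t ∈ Set.range i ∧
      ∃ l : S' ⟶ T, l ≫ b = i ≫ s)
    (hu : ∀ (S' : Scheme.{u}) (i : S' ⟶ S) [IsOpenImmersion i] (l l' : S' ⟶ T),
      l ≫ b = i ≫ s → l' ≫ b = i ≫ s → l = l') : ∃ l, l ≫ b = s := by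
  obtain ⟨𝒰, h⟩ := exists_cover _ H
  choose l hl using h
  refine ⟨𝒰.glueMorphisms l fun x y => ?_, ?_⟩
  · refine hu _ (pullback.fst (𝒰.f x) (𝒰.f y) ≫ 𝒰.f x) _ _ ?_ ?_
    · rw [Category.assoc, hl, Category.assoc]
    · rw [Category.assoc, hl, ← pullback.condition_assoc, Category.assoc]
  · refine 𝒰.hom_ext _ _ fun j => ?_
    rw [𝒰.ι_glueMorphisms_assoc, hl]


noncomputable def idS (R : CommRingCat.{u}) (I : Ideal R) : (Spec R).IdealSheafData :=
  Scheme.IdealSheafData.ofIdealTop (I.map (Scheme.ΓSpecIso R).inv.hom)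

lemma idS_top (R : CommRingCat.{u}) (I : Ideal R) : (idS R I).ideal ⟨⊤, isAffineOpen_top _⟩ =
    I.map (Scheme.ΓSpecIso R).inv.hom := by
  rw [idS, Scheme.IdealSheafData.ofIdealTop_ideal]
  convert Ideal.map_id _
  ext x
  simp

lemma idS_surj (R : CommRingCat.{u}) (J : (Spec R).IdealSheafData) :
    J = idS R ((J.ideal ⟨⊤, isAffineOpen_top _⟩).comap (Scheme.ΓSpecIso R).inv.hom) := by
  apply Scheme.IdealSheafData.ext_of_isAffine
  rw [idS_top, Ideal.map_comap_of_surjective]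
  exact (Scheme.ΓSpecIso R).symm.commRingCatIsoToRingEquiv.surjective

lemma idS_inj (R : CommRingCat.{u}) {I J : Ideal R} (h : idS R I = idS R J) : I = J := by
  have := congrArg (fun K => K.ideal ⟨⊤, isAffineOpen_top _⟩) h
  simp only [idS_top] at this
  have := congrArg (Ideal.map (Scheme.ΓSpecIso R).hom.hom) this
  rw [Ideal.map_map, Ideal.map_map, ← CommRingCat.hom_comp, Iso.inv_hom_id, CommRingCat.hom_id,
    Ideal.map_id, Ideal.map_id] at this
  exact this

lemma idS_comap {R C : CommRingCat.{u}} (φ : R ⟶ C) (I : Ideal R) :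
    (idS R I).comap (Spec.map φ) = idS C (I.map φ.hom) := by
  apply Scheme.IdealSheafData.ext_of_isAffine
  rw [idS_top, comap_ideal_top, idS_top, Ideal.map_map, Ideal.map_map, ← CommRingCat.hom_comp,
    ← CommRingCat.hom_comp, Scheme.ΓSpecIso_inv_naturality]

lemma inv_idS (C : CommRingCat.{u}) (h : C) (hh : h ∈ nonZeroDivisors C) :
    Inv (idS C (Ideal.span {h})) := fun t =>
  ⟨⟨⊤, isAffineOpen_top _⟩, trivial, (Scheme.ΓSpecIso C).inv.hom h,
    by
      have := iso_nzd (Scheme.ΓSpecIso C).symm hh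
      exact this, by
      rw [idS_top, Ideal.map_span, Set.image_singleton]⟩

lemma spec_chart {R : CommRingCat.{u}} {S : Scheme.{u}} (F : Ideal R) (s : S ⟶ Spec R)
    (hJ : Inv ((idS R F).comap s)) (U : S.Opens) (t : S) (ht : t ∈ U) :
    ∃ (C : CommRingCat.{u}) (φ : R ⟶ C) (i : Spec C ⟶ S) (_ : IsOpenImmersion i),
      t ∈ Set.range i ∧ Set.range i ⊆ U ∧ i ≫ s = Spec.map φ ∧ ∃ h ∈ F,
      φ.hom h ∈ nonZeroDivisors C ∧ F.map φ.hom = Ideal.span {φ.hom h} := by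
  obtain ⟨O, hO, h1, h2, f, hf, h3, h4⟩ := hJ.refine_base ⟨⊤, isAffineOpen_top _⟩ U t trivial ht
  have hOa : IsAffineOpen O.1 := O.2
  have e : hOa.fromSpec ≫ s = Spec.map ((Scheme.ΓSpecIso R).inv ≫ s.appLE ⊤ O.1 hO) := by
    rw [← IsAffineOpen.SpecMap_appLE_fromSpec s (isAffineOpen_top _) hOa hO, Spec.map_comp,
      IsAffineOpen.fromSpec_top, Scheme.isoSpec_Spec_inv]
  rw [idS_top] at hf
  obtain ⟨h, hh, rfl⟩ := (Ideal.mem_map_iff_of_surjective _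
    (Scheme.ΓSpecIso R).symm.commRingCatIsoToRingEquiv.surjective).mp hf
  refine ⟨_, (Scheme.ΓSpecIso R).inv ≫ s.appLE ⊤ O.1 hO, hOa.fromSpec, inferInstance, ?_, ?_, e, h,
    hh, h3, ?_⟩
  · rw [IsAffineOpen.range_fromSpec]; exact h1
  · rw [IsAffineOpen.range_fromSpec]; exact h2
  · rw [comap_ideal _ _ _ _ hO, idS_top, Ideal.map_map] at h4
    exact h4

end Nag
end

section
open Limits

namespace Nag

structure IsBlowup {T X : Scheme.{u}} (b : T ⟶ X) (K : X.IdealSheafData) : Prop where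
  inv : Inv (K.comap b)
  uniq : ∀ (S : Scheme.{u}) (l l' : S ⟶ T), Inv (K.comap (l ≫ b)) → l ≫ b = l' ≫ b → l = l'
  lift : ∀ (S : Scheme.{u}) (s : S ⟶ X), Inv (K.comap s) → ∃ l, l ≫ b = s

lemma IsBlowup.mk' {T X : Scheme.{u}} {b : T ⟶ X} {K : X.IdealSheafData}
    (inv : Inv (K.comap b))
    (uniq : ∀ (S : Scheme.{u}) (l l' : S ⟶ T), Inv (K.comap (l ≫ b)) → l ≫ b = l' ≫ b → l = l')
    (lift : ∀ (S : Scheme.{u}) (s : S ⟶ X), Inv (K.comap s) → ∀ t : S,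
      ∃ (S' : Scheme.{u}) (i : S' ⟶ S) (_ : IsOpenImmersion i), t ∈ Set.range i ∧
      ∃ l : S' ⟶ T, l ≫ b = i ≫ s) : IsBlowup b K := by
  refine ⟨inv, uniq, fun S s hs => glue_local s b (lift S s hs) fun S' i _ l l' h1 h2 => ?_⟩
  refine uniq S' l l' ?_ (h1.trans h2.symm)
  rw [h1, Scheme.IdealSheafData.comap_comp]
  exact hs.comap i

section Proj
variable {R : CommRingCat.{u}} (F : Ideal R)

abbrev FS : Submodule R R := F

noncomputable def zmap : R ⟶ CommRingCat.of (gr (FS F) 0) :=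
  CommRingCat.ofHom (algebraMap R (gr (FS F) 0))

noncomputable def projB : Proj (gr (FS F)) ⟶ Spec R :=
  Proj.toSpecZero (gr (FS F)) ≫ Spec.map (zmap F)

noncomputable def ch (h : R) (hh : h ∈ F) : Spec (.of (Ch (FS F) h hh)) ⟶ Proj (gr (FS F)) :=
  Proj.awayι (gr (FS F)) (tt (FS F) h hh) (tt_mem (FS F) h hh) one_pos

instance (h : R) (hh : h ∈ F) : IsOpenImmersion (ch F h hh) := by unfold ch; infer_instance

lemma ch_projB (h : R) (hh : h ∈ F) :
    ch F h hh ≫ projB F = Spec.map (CommRingCat.ofHom (crho (FS F) h hh)) := by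
  rw [ch, projB, Proj.awayι_toSpecZero_assoc, ← Spec.map_comp]
  rfl

lemma ch_range (h : R) (hh : h ∈ F) :
    Set.range (ch F h hh) = Proj.basicOpen (gr (FS F)) (tt (FS F) h hh) := by
  rw [← Proj.opensRange_awayι (gr (FS F)) _ (tt_mem (FS F) h hh) one_pos]
  rfl

lemma ch_cover (t : Proj (gr (FS F))) : ∃ h hh, t ∈ Set.range (ch F h hh) := by
  have := Proj.iSup_basicOpen_eq_top (gr (FS F)) (fun i : F => tt (FS F) i.1 i.2)
    (irr_le (FS F) (fun i : F => i.1) (fun i => i.2) (by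
      intro x hx; exact Submodule.subset_span ⟨⟨x, hx⟩, rfl⟩))
  have ht : t ∈ (⊤ : (Proj (gr (FS F))).Opens) := trivial
  rw [← this, TopologicalSpace.Opens.mem_iSup] at ht
  obtain ⟨i, hi⟩ := ht
  refine ⟨i.1, i.2, ?_⟩
  rw [ch_range]; exact hi

lemma projB_proper (hF : F.FG) : IsProper (projB F) := by
  have := gr_fg (FS F) hF
  have : IsClosedImmersion (Spec.map (zmap F)) :=
    IsClosedImmersion.spec_of_surjective (zmap F) (zero_surj (FS F))
  unfold projB
  infer_instance

lemma ch_map {h : R} (hh : h ∈ F) : F.map (crho (FS F) h hh) = Ideal.span {crho (FS F) h hh h} := by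
  apply le_antisymm
  · rw [Ideal.map_le_iff_le_comap]
    intro g hg
    rw [Ideal.mem_comap]
    have := rho_pow_mul (FS F) h hh 1 g (by rw [pow_one]; exact hg)
    rw [pow_one] at this
    rw [← this]
    exact Ideal.mul_mem_right _ _ (Ideal.mem_span_singleton_self _)
  · rw [Ideal.span_singleton_le_iff_mem]
    exact Ideal.mem_map_of_mem _ hh

lemma projB_inv : Inv ((idS R F).comap (projB F)) := by
  refine Inv.of_local fun t => ?_
  obtain ⟨h, hh, s, hs⟩ := ch_cover F t
  refine ⟨_, ch F h hh, inferInstance, s, hs, ?_⟩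
  rw [← Scheme.IdealSheafData.comap_comp, ch_projB, idS_comap, CommRingCat.hom_ofHom, ch_map]
  exact inv_idS (.of (Ch (FS F) h hh)) _ (rho_nzd (FS F) h hh)

lemma range_le {C : CommRingCat.{u}} (φ : R ⟶ C) (l : Spec C ⟶ Proj (gr (FS F)))
    (hl : l ≫ projB F = Spec.map φ) (h : R) (hh : h ∈ F) (hn : φ.hom h ∈ nonZeroDivisors C)
    (hK : F.map φ.hom = Ideal.span {φ.hom h}) : Set.range l ⊆ Set.range (ch F h hh) := by
  rintro _ ⟨p, rfl⟩
  obtain ⟨g, hg, hp⟩ := ch_cover F (l p)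
  rw [ch_range] at hp
  have hp' : p ∈ l ⁻¹ᵁ (Proj.basicOpen (gr (FS F)) (tt (FS F) g hg)) := hp
  obtain ⟨_, ⟨c', rfl⟩, h1, h2⟩ := PrimeSpectrum.isTopologicalBasis_basic_opens.exists_subset_of_mem_open
    hp' (l ⁻¹ᵁ (Proj.basicOpen (gr (FS F)) (tt (FS F) g hg))).2
  let C' : CommRingCat.{u} := .of (Localization.Away c')
  let α : C ⟶ C' := CommRingCat.ofHom (algebraMap C (Localization.Away c'))
  have hj : IsOpenImmersion (Spec.map α) := inferInstance
  have hr : Set.range (Spec.map α) = (PrimeSpectrum.basicOpen c' : Set (PrimeSpectrum C)) :=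
    PrimeSpectrum.localization_away_comap_range (Localization.Away c') c'
  have hsub : Set.range (Spec.map α ≫ l) ⊆ Set.range (ch F g hg) := by
    rintro _ ⟨q, rfl⟩
    rw [ch_range]
    exact h2 (hr ▸ ⟨q, rfl⟩ : Spec.map α q ∈ (PrimeSpectrum.basicOpen c' : Set (PrimeSpectrum C)))
  obtain ⟨θ, hθ⟩ := Spec.map_surjective (IsOpenImmersion.lift (ch F g hg) (Spec.map α ≫ l) hsub)
  have e1 : Spec.map θ ≫ ch F g hg = Spec.map α ≫ l := by
    rw [hθ, IsOpenImmersion.lift_fac]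
  have e2 : CommRingCat.ofHom (crho (FS F) g hg) ≫ θ = φ ≫ α := by
    apply Spec.map_injective
    rw [Spec.map_comp, Spec.map_comp, ← ch_projB, ← hl, reassoc_of% e1]
  have e3 : ∀ r, θ.hom (crho (FS F) g hg r) = α.hom (φ.hom r) := fun r =>
    RingHom.congr_fun (congrArg CommRingCat.Hom.hom e2) r
  have hu := rho_pow_mul (FS F) g hg 1 h (by rw [pow_one]; exact hh)
  rw [pow_one] at hu
  set u := cmk (FS F) g hg 1 h (by rw [pow_one]; exact hh) with hudef
  have hu' := congrArg θ.hom hu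
  rw [map_mul, e3, e3] at hu'
  obtain ⟨c, hc⟩ := Ideal.mem_span_singleton'.mp (hK ▸ Ideal.mem_map_of_mem φ.hom hg)
  have hn' : α.hom (φ.hom h) ∈ nonZeroDivisors C' :=
    IsLocalization.map_nonZeroDivisors_le (Submonoid.powers c') (Localization.Away c') ⟨_, hn, rfl⟩
  have hunit : α.hom c * θ.hom u = 1 := by
    rw [← hc, map_mul] at hu'
    refine (mul_cancel_left_mem_nonZeroDivisors hn').mp ?_
    rw [mul_one]
    refine Eq.trans ?_ hu'
    ring
  obtain ⟨q, hq⟩ : p ∈ Set.range (Spec.map α) := hr ▸ h1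
  have hlp : l p = ch F g hg (Spec.map θ q) := by
    rw [← hq, ← Scheme.Hom.comp_apply, ← Scheme.Hom.comp_apply, e1]
  rw [hlp, ch_range]
  have := Proj.awayι_preimage_basicOpen (gr (FS F)) (tt_mem (FS F) g hg) one_pos
    (tt_mem (FS F) h hh) one_pos
  have hmem : Spec.map θ q ∈ PrimeSpectrum.basicOpen (HomogeneousLocalization.Away.isLocalizationElem
    (tt_mem (FS F) g hg) (tt_mem (FS F) h hh)) := by
    have e : HomogeneousLocalization.Away.isLocalizationElem
      (tt_mem (FS F) g hg) (tt_mem (FS F) h hh) = u := by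
      apply HomogeneousLocalization.val_injective
      rw [HomogeneousLocalization.Away.val_mk, hudef, cmk_val, pow_one]
      rfl
    rw [e]
    intro hmem
    have hmem : θ.hom u ∈ q.asIdeal := hmem
    refine q.2.ne_top ((Ideal.eq_top_iff_one _).mpr ?_)
    rw [← hunit]
    exact Ideal.mul_mem_left _ _ hmem
  rw [← this] at hmem
  exact hmem

lemma projB_uniq (S : Scheme.{u}) (l l' : S ⟶ Proj (gr (FS F)))
    (hJ : Inv ((idS R F).comap (l ≫ projB F))) (hl : l ≫ projB F = l' ≫ projB F) : l = l' := by
  refine hom_ext_local _ _ fun t => ?_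
  obtain ⟨C, φ, i, hi, h1, -, h2, h, hh, h3, h4⟩ := spec_chart F _ hJ ⊤ t trivial
  refine ⟨_, i, hi, h1, ?_⟩
  rw [← Category.assoc] at h2
  have h2' := h2
  rw [Category.assoc, hl, ← Category.assoc] at h2'
  have r1 := range_le F φ (i ≫ l) h2 h hh h3 h4
  have r2 := range_le F φ (i ≫ l') h2' h hh h3 h4
  obtain ⟨θ, hθ⟩ := Spec.map_surjective (IsOpenImmersion.lift (ch F h hh) (i ≫ l) r1)
  obtain ⟨θ', hθ'⟩ := Spec.map_surjective (IsOpenImmersion.lift (ch F h hh) (i ≫ l') r2)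
  have e1 : Spec.map θ ≫ ch F h hh = i ≫ l := by rw [hθ, IsOpenImmersion.lift_fac]
  have e1' : Spec.map θ' ≫ ch F h hh = i ≫ l' := by rw [hθ', IsOpenImmersion.lift_fac]
  have e2 : CommRingCat.ofHom (crho (FS F) h hh) ≫ θ = φ := by
    apply Spec.map_injective
    rw [Spec.map_comp, ← ch_projB, ← h2, reassoc_of% e1, Category.assoc]
  have e2' : CommRingCat.ofHom (crho (FS F) h hh) ≫ θ' = φ := by
    apply Spec.map_injective
    rw [Spec.map_comp, ← ch_projB, ← h2', reassoc_of% e1', Category.assoc]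
  have : θ = θ' := by
    apply CommRingCat.hom_ext
    refine blow_hom_uniq (FS F) h hh θ.hom θ'.hom ?_ ?_
    · rw [← e2] at h3
      exact h3
    · exact congrArg CommRingCat.Hom.hom (e2.trans e2'.symm)
  rw [← e1, ← e1', this]

lemma projB_isBlowup : IsBlowup (projB F) (idS R F) := by
  refine IsBlowup.mk' (projB_inv F) (projB_uniq F) fun S s hJ t => ?_
  obtain ⟨C, φ, i, hi, h1, -, h2, h, hh, h3, h4⟩ := spec_chart F _ hJ ⊤ t trivial
  obtain ⟨Φ, hΦ⟩ := blow_hom (FS F) h hh φ.hom h3 fun f hf => h4 ▸ Ideal.mem_map_of_mem _ hf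
  refine ⟨_, i, hi, h1, Spec.map (CommRingCat.ofHom Φ) ≫ ch F h hh, ?_⟩
  rw [Category.assoc, ch_projB, h2, ← Spec.map_comp, ← CommRingCat.ofHom_comp, hΦ]
  rfl

end Proj

end Nag
end

section
open Limits

namespace Nag

lemma affine_comp {R A : Type u} [CommRing R] [CommRing A] [Algebra R A] [Algebra.FiniteType R A] :
    ∃ (P : Scheme.{u}) (s : P ⟶ Spec (.of R)) (i : Spec (.of A) ⟶ P), IsProper s ∧
      IsOpenImmersion i ∧ i ≫ s = Spec.map (CommRingCat.ofHom (algebraMap R A)) := by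
  classical
  obtain ⟨S, hS⟩ := Algebra.FiniteType.out (R := R) (A := A)
  let F : Submodule R A := Submodule.span R (insert 1 S : Finset A)
  have hFG : F.FG := ⟨_, rfl⟩
  have h1 : (1 : A) ∈ F := Submodule.subset_span (by simp)
  have hmono : ∀ m n, m ≤ n → F ^ m ≤ F ^ n := fun m n h =>
    pow_le_pow_right₀ (Submodule.one_le.mpr h1) h
  have hF : ∀ a, ∃ n, a ∈ F ^ n := by
    intro a
    have ha : a ∈ Algebra.adjoin R (S : Set A) := hS ▸ Algebra.mem_top
    induction ha using Algebra.adjoin_induction with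
    | mem x hx => exact ⟨1, by rw [pow_one]; exact Submodule.subset_span (by simp [Finset.mem_coe.mp hx])⟩
    | algebraMap r => exact ⟨0, by rw [pow_zero]; exact Submodule.algebraMap_mem r⟩
    | add x y _ _ hx hy =>
      obtain ⟨m, hm⟩ := hx
      obtain ⟨n, hn⟩ := hy
      exact ⟨max m n, add_mem (hmono _ _ (le_max_left _ _) hm) (hmono _ _ (le_max_right _ _) hn)⟩
    | mul x y _ _ hx hy =>
      obtain ⟨m, hm⟩ := hx
      obtain ⟨n, hn⟩ := hy
      exact ⟨m + n, by rw [pow_add]; exact Submodule.mul_mem_mul hm hn⟩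
  obtain ⟨Φ, hΦ, hΦ2⟩ := affine_chart F h1 hF
  let z : CommRingCat.of R ⟶ CommRingCat.of (gr F 0) := CommRingCat.ofHom (algebraMap R (gr F 0))
  have := gr_fg F hFG
  have : IsClosedImmersion (Spec.map z) :=
    IsClosedImmersion.spec_of_surjective z (zero_surj F)
  let e : CommRingCat.of (Ch F 1 h1) ⟶ .of A := CommRingCat.ofHom Φ
  have he : IsIso e := by
    rw [ConcreteCategory.isIso_iff_bijective]; exact hΦ
  refine ⟨Proj (gr F), Proj.toSpecZero (gr F) ≫ Spec.map z, Spec.map e ≫ Proj.awayι (gr F) (tt F 1 h1) (tt_mem F 1 h1) one_pos,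
    inferInstance, inferInstance, ?_⟩
  rw [Category.assoc, Proj.awayι_toSpecZero_assoc, ← Spec.map_comp, ← Spec.map_comp]
  congr 1
  apply CommRingCat.hom_ext
  exact hΦ2

/-- `X` has an open immersion into a proper scheme. -/
def Cpt {k : CommRingCat.{u}} {X : Scheme.{u}} (s : X ⟶ Spec k) : Prop :=
  ∃ (P : Scheme.{u}) (p : P ⟶ Spec k) (i : X ⟶ P), IsProper p ∧ IsOpenImmersion i ∧ i ≫ p = s

lemma Cpt.iso {k : CommRingCat.{u}} {X Y : Scheme.{u}} {s : X ⟶ Spec k} (h : Cpt s) (f : Y ⟶ X)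
    [IsOpenImmersion f] : Cpt (f ≫ s) := by
  obtain ⟨P, p, i, h1, h2, rfl⟩ := h
  exact ⟨P, p, f ≫ i, h1, inferInstance, Category.assoc _ _ _⟩

lemma Cpt.affine {k : CommRingCat.{u}} {X : Scheme.{u}} (s : X ⟶ Spec k) [IsAffine X]
    [LocallyOfFiniteType s] : Cpt s := by
  suffices Cpt (X.isoSpec.inv ≫ s) by
    have := this.iso X.isoSpec.hom
    rwa [Iso.hom_inv_id_assoc] at this
  generalize h : X.isoSpec.inv ≫ s = s'
  have : LocallyOfFiniteType s' := by rw [← h]; infer_instance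
  obtain ⟨φ, rfl⟩ := Spec.map_surjective s'
  have hφ : φ.hom.FiniteType := by
    rwa [HasRingHomProperty.Spec_iff (P := @LocallyOfFiniteType)] at this
  algebraize [φ.hom]
  obtain ⟨P, p, i, h1, h2, h3⟩ := affine_comp (R := k) (A := Γ(X, ⊤))
  exact ⟨P, p, i, h1, h2, h3⟩

end Nag
end

section
open Limits

namespace Nag
open Scheme.IdealSheafData (comap_comp comap_id)

lemma IsBlowup.restrict {T X T' X' : Scheme.{u}} {b : T ⟶ X} {K : X.IdealSheafData}
    (hb : IsBlowup b K) {b' : T' ⟶ X'} {j : T' ⟶ T} {i : X' ⟶ X} [IsOpenImmersion i]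
    (h : IsPullback b' j i b) : IsBlowup b' (K.comap i) := by
  have : IsOpenImmersion j := MorphismProperty.of_isPullback h inferInstance
  refine ⟨?_, ?_, ?_⟩
  · rw [← comap_comp, h.w, comap_comp]
    exact hb.inv.comap j
  · intro S l l' hJ hl
    refine h.hom_ext hl (hb.uniq S _ _ ?_ ?_)
    · rwa [← comap_comp, Category.assoc, h.w, ← Category.assoc] at hJ
    · rw [Category.assoc, Category.assoc, ← h.w, reassoc_of% hl]
  · intro S s hJ
    rw [← comap_comp] at hJ
    obtain ⟨l, hl⟩ := hb.lift S _ hJ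
    exact ⟨h.lift s l hl.symm, h.lift_fst _ _ _⟩

lemma IsBlowup.isIso {T T' X : Scheme.{u}} {b : T ⟶ X} {b' : T' ⟶ X} {K : X.IdealSheafData}
    (hb : IsBlowup b K) (hb' : IsBlowup b' K) (l : T ⟶ T') (hl : l ≫ b' = b) : IsIso l := by
  obtain ⟨l', hl'⟩ := hb.lift _ _ hb'.inv
  refine ⟨l', hb.uniq _ _ _ ?_ ?_, hb'.uniq _ _ _ ?_ ?_⟩
  · rw [Category.assoc, hl', hl]; exact hb.inv
  · rw [Category.assoc, hl', hl, Category.id_comp]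
  · rw [Category.assoc, hl, hl']; exact hb'.inv
  · rw [Category.assoc, hl, hl', Category.id_comp]

lemma IsBlowup.isPullback {T X T' X' : Scheme.{u}} {b : T ⟶ X} {K : X.IdealSheafData}
    (hb : IsBlowup b K) {b' : T' ⟶ X'} {i : X' ⟶ X} [IsOpenImmersion i]
    (hb' : IsBlowup b' (K.comap i)) (m : T' ⟶ T) (hm : m ≫ b = b' ≫ i) : IsPullback b' m i b := by
  have h2 := hb.restrict (IsPullback.of_hasPullback i b)
  have := hb'.isIso h2 (pullback.lift b' m hm.symm) (pullback.lift_fst _ _ _)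
  exact IsPullback.of_iso_pullback ⟨hm.symm⟩ (asIso (pullback.lift b' m hm.symm))
    (pullback.lift_fst _ _ _) (pullback.lift_snd _ _ _)

lemma IsBlowup.of_iso {T X X' : Scheme.{u}} {b : T ⟶ X} {K : X.IdealSheafData}
    (hb : IsBlowup b K) (e : X ≅ X') : IsBlowup (b ≫ e.hom) (K.comap e.inv) := by
  apply hb.restrict (j := 𝟙 T)
  exact IsPullback.of_vert_isIso ⟨by simp⟩

lemma isBlowup_local {T X : Scheme.{u}} {b : T ⟶ X} {K : X.IdealSheafData}
    (H : ∀ x : X, ∃ (X' : Scheme.{u}) (i : X' ⟶ X) (_ : IsOpenImmersion i) (T' : Scheme.{u})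
      (b' : T' ⟶ X') (j : T' ⟶ T), x ∈ Set.range i ∧ IsPullback b' j i b ∧ IsBlowup b' (K.comap i)) :
    IsBlowup b K := by
  refine IsBlowup.mk' (Inv.of_local fun t => ?_) ?_ ?_
  · obtain ⟨X', i, hi, T', b', j, hx, h, hb⟩ := H (b t)
    have : IsOpenImmersion j := MorphismProperty.of_isPullback h inferInstance
    obtain ⟨x', hx'⟩ := hx
    obtain ⟨t', -, ht'⟩ := Scheme.exists_preimage_of_isPullback h x' t hx'
    refine ⟨T', j, this, t', ht', ?_⟩
    rw [← comap_comp, ← h.w, comap_comp]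
    exact hb.inv
  · intro S l l' hJ hl
    refine hom_ext_local _ _ fun t => ?_
    obtain ⟨X', i, hi, T', b', j, ⟨x', hx'⟩, h, hb⟩ := H ((l ≫ b) t)
    obtain ⟨s', hs', -⟩ := Scheme.Pullback.exists_preimage_pullback t x' hx'.symm
    refine ⟨_, pullback.fst (l ≫ b) i, inferInstance, ⟨s', hs'⟩, ?_⟩
    have c1 : pullback.snd (l ≫ b) i ≫ i = (pullback.fst (l ≫ b) i ≫ l) ≫ b := by
      rw [← pullback.condition, Category.assoc]
    have c2 : pullback.snd (l ≫ b) i ≫ i = (pullback.fst (l ≫ b) i ≫ l') ≫ b := by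
      rw [c1, Category.assoc, Category.assoc, hl]
    rw [← h.lift_snd _ _ c1, ← h.lift_snd _ _ c2]
    congr 1
    apply hb.uniq
    · rw [← comap_comp, Category.assoc, h.w, ← Category.assoc, h.lift_snd, Category.assoc, comap_comp]
      exact hJ.comap _
    · rw [h.lift_fst, h.lift_fst]
  · intro S s hJ t
    obtain ⟨X', i, hi, T', b', j, ⟨x', hx'⟩, h, hb⟩ := H (s t)
    obtain ⟨s', hs', -⟩ := Scheme.Pullback.exists_preimage_pullback t x' hx'.symm
    obtain ⟨l, hl⟩ := hb.lift _ (pullback.snd s i) (by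
      rw [← comap_comp, ← pullback.condition, comap_comp]; exact hJ.comap _)
    refine ⟨_, pullback.fst s i, inferInstance, ⟨s', hs'⟩, l ≫ j, ?_⟩
    rw [Category.assoc, ← h.w, reassoc_of% hl, pullback.condition]

lemma proper_inv_comp {A B C : Scheme.{u}} (e : A ≅ B) (f : A ⟶ C) (h : IsProper f) :
    IsProper (e.inv ≫ f) := inferInstance

lemma exists_blowup_cover {X : Scheme.{u}} (K : X.IdealSheafData) (𝒰 : X.OpenCover)
    [Category.{u} 𝒰.I₀] [𝒰.LocallyDirected] [Small.{u} 𝒰.I₀] [Quiver.IsThin 𝒰.I₀]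
    (H : ∀ j, ∃ (T : Scheme.{u}) (b : T ⟶ 𝒰.X j), IsProper b ∧ IsBlowup b (K.comap (𝒰.f j))) :
    ∃ (T : Scheme.{u}) (b : T ⟶ X), IsProper b ∧ IsBlowup b K := by
  choose B b hp hb using H
  have hinv : ∀ {i j} (hij : i ⟶ j), Inv ((K.comap (𝒰.f j)).comap (b i ≫ 𝒰.trans hij)) := by
    intro i j hij
    rw [← comap_comp, Category.assoc, 𝒰.trans_map, comap_comp]
    exact (hb i).inv
  have hex := fun {i j} (hij : i ⟶ j) => (hb j).lift _ _ (hinv hij)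
  choose m hm using @hex
  have hpb : ∀ {i j} (hij : i ⟶ j), IsPullback (m hij) (b i) (b j) (𝒰.trans hij) := by
    intro i j hij
    have : IsOpenImmersion (𝒰.trans hij) := 𝒰.property_trans hij
    exact ((hb j).isPullback (by rw [← comap_comp, 𝒰.trans_map]; exact hb i) (m hij) (hm hij)).flip
  let d : 𝒰.RelativeGluingData :=
    { functor :=
        { obj := B
          map := fun hij => m hij
          map_id := fun i => by
            apply (hb i).uniq
            · rw [hm]; exact hinv _
            · rw [hm, 𝒰.trans_id, Category.id_comp, Category.comp_id]
          map_comp := fun {i j k} hij hjk => by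
            apply (hb k).uniq
            · rw [hm]; exact hinv _
            · rw [hm, Category.assoc, hm, reassoc_of% hm, 𝒰.trans_comp] }
      natTrans :=
        { app := fun i => b i
          naturality := fun i j hij => hm hij }
      equifibered := fun i j hij => by
        exact hpb hij }
  refine ⟨d.glued, d.toBase, ?_, ?_⟩
  · rw [IsZariskiLocalAtTarget.iff_of_openCover (P := @IsProper) 𝒰]
    intro i
    have h := d.isPullback_natTrans_ι_toBase i
    have e : pullback.snd d.toBase (𝒰.f i) = h.flip.isoPullback.inv ≫ b i :=
      (h.flip.isoPullback_inv_snd).symm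
    change IsProper (pullback.snd d.toBase (𝒰.f i))
    rw [e]
    exact proper_inv_comp _ _ (hp i)
  · refine isBlowup_local fun x => ?_
    obtain ⟨i, y, hy⟩ := 𝒰.exists_eq x
    exact ⟨_, 𝒰.f i, inferInstance, B i, b i, _, ⟨y, hy⟩,
      d.isPullback_natTrans_ι_toBase i, hb i⟩

lemma exists_blowup_affine {X : Scheme.{u}} [IsAffine X] [IsNoetherianRing Γ(X, ⊤)]
    (K : X.IdealSheafData) : ∃ (T : Scheme.{u}) (b : T ⟶ X), IsProper b ∧ IsBlowup b K := by
  have h := idS_surj _ (K.comap X.isoSpec.inv)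
  set F := (((K.comap X.isoSpec.inv).ideal ⟨⊤, isAffineOpen_top _⟩).comap
    (Scheme.ΓSpecIso Γ(X, ⊤)).inv.hom) with hF
  have hb := projB_isBlowup F
  have hp := projB_proper F (IsNoetherian.noetherian _)
  have hb' := hb.of_iso X.isoSpec.symm
  rw [← h, ← comap_comp] at hb'
  simp only [Iso.symm_inv, Iso.hom_inv_id, comap_id] at hb'
  exact ⟨_, _, inferInstance, hb'⟩

lemma exists_blowup {X : Scheme.{u}} [IsLocallyNoetherian X]
    (K : X.IdealSheafData) : ∃ (T : Scheme.{u}) (b : T ⟶ X), IsProper b ∧ IsBlowup b K := by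
  refine exists_blowup_cover K X.directedAffineCover fun V => ?_
  have hV : IsAffineOpen V.1 := V.2
  have : IsAffine (X.directedAffineCover.X V) := hV
  have h1 : IsLocallyNoetherian (X.directedAffineCover.X V) :=
    inferInstanceAs (IsLocallyNoetherian V.1.toScheme)
  have : IsNoetherianRing Γ(X.directedAffineCover.X V, ⊤) :=
    h1.component_noetherian ⟨⊤, isAffineOpen_top _⟩
  exact exists_blowup_affine _

end Nag
end

section
open Limits

namespace Nag
open Scheme.IdealSheafData (comap_comp comap_id)

lemma comap_map_open {X Y : Scheme.{u}} (i : X ⟶ Y) [IsOpenImmersion i] [QuasiCompact i]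
    (I : X.IdealSheafData) : (I.map i).comap i = I := by
  ext1
  ext1 O
  have h : i ⁻¹ᵁ i ''ᵁ O.1 = O.1 := i.preimage_image_eq O.1
  have ha : IsAffineOpen (i ⁻¹ᵁ i ''ᵁ O.1) := by rw [h]; exact O.2
  rw [Scheme.IdealSheafData.ideal_comap_of_isOpenImmersion,
    Scheme.IdealSheafData.ideal_map (H := ha)]
  have h2 := I.map_ideal' (U := ⟨i ⁻¹ᵁ i ''ᵁ O.1, ha⟩) (V := O) (eqToHom h).op
  rw [Ideal.comap_comap, ← CommRingCat.hom_comp]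
  have h3 : (i.appIso O.1).inv ≫ i.app (i ''ᵁ O.1) = X.presheaf.map (eqToHom h).op := by
    rw [i.appIso_inv_app]
  rw [h3]
  refine (congrArg _ h2.symm).trans (Ideal.comap_map_of_bijective _ ?_)
  exact ConcreteCategory.bijective_of_isIso (X.presheaf.map (eqToHom h).op)

/-- denominators -/
lemma alg_denom {B C : Type u} [CommRing B] [CommRing C] (φ : B →+* C) (g : B)
    (τ : C →+* Localization.Away g) 
    (h2 : (IsLocalization.Away.lift (S := Localization.Away g) (g := (algebraMap C (Localization.Away (φ g))).comp φ) g
      (IsLocalization.Away.algebraMap_isUnit (φ g))).comp τ = algebraMap _ _) (c : C) :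
    ∃ n : ℕ, ∀ N, n ≤ N → ∃ b, φ g ^ N * c = φ b := by
  obtain ⟨n, b, h3⟩ := IsLocalization.Away.surj g (τ c)
  have h4 := congrArg (IsLocalization.Away.lift (S := Localization.Away g) (g := (algebraMap C (Localization.Away (φ g))).comp φ) g
      (IsLocalization.Away.algebraMap_isUnit (φ g))) h3
  rw [map_mul, map_pow, IsLocalization.Away.lift_eq, IsLocalization.Away.lift_eq, ← RingHom.comp_apply _ τ,
    h2] at h4
  simp only [RingHom.comp_apply] at h4
  rw [← map_pow, ← map_mul] at h4
  obtain ⟨m, h5⟩ := IsLocalization.Away.exists_of_eq (φ g) h4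
  refine ⟨m + n, fun N hN => ⟨g ^ (N - (m + n)) * (g ^ m * b), ?_⟩⟩
  have : φ g ^ N = φ g ^ (N - (m + n)) * (φ g ^ m * φ g ^ n) := by
    rw [← pow_add, ← pow_add]; congr 1; omega
  rw [this, map_mul, map_mul, map_pow, map_pow, ← h5]
  ring

lemma alg_extend {B C A : Type u} [CommRing B] [CommRing C] [CommRing A] (φ : B →+* C) (g : B)
    (τ : C →+* Localization.Away g) (h1 : τ.comp φ = algebraMap _ _) (s : Set C) (n : ℕ)
    (F : Ideal B) (hs : ∀ c : C, c ∈ Subring.closure (Set.range φ ∪ s))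
    (hF : ∀ c ∈ s, ∃ b ∈ F, φ g ^ n * c = φ b) (ψ : B →+* A) (hg : ψ g ∈ nonZeroDivisors A)
    (hF2 : F.map ψ ≤ Ideal.span {ψ g ^ n}) : ∃ χ : C →+* A, χ.comp φ = ψ := by
  let ι := algebraMap A (Localization.Away (ψ g))
  have hι : Function.Injective ι := IsLocalization.injective _ (Submonoid.powers_le.mpr hg)
  let κ : C →+* Localization.Away (ψ g) :=
    (IsLocalization.Away.lift (S := Localization.Away g) (g := ι.comp ψ) g
      (IsLocalization.Away.algebraMap_isUnit (ψ g))).comp τ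
  have hκ : ∀ b, κ (φ b) = ι (ψ b) := by
    intro b
    have := congrArg (fun f => f b) h1
    simp only [RingHom.comp_apply] at this
    simp only [κ, RingHom.comp_apply, this, IsLocalization.Away.lift_eq]
  have hr : ∀ c, κ c ∈ ι.range := by
    intro c
    induction hs c using Subring.closure_induction with
    | mem x hx =>
      obtain ⟨b, rfl⟩ | hx := hx
      · exact ⟨ψ b, (hκ b).symm⟩
      obtain ⟨b, hb, e⟩ := hF x hx
      obtain ⟨a, ha⟩ := Ideal.mem_span_singleton'.mp (hF2 (Ideal.mem_map_of_mem ψ hb))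
      refine ⟨a, ?_⟩
      have e2 := congrArg κ e
      rw [map_mul, map_pow, hκ, hκ, ← ha, map_mul, map_pow, mul_comm] at e2
      exact ((IsLocalization.Away.algebraMap_isUnit (S := Localization.Away (ψ g)) (ψ g)).pow n).mul_left_injective e2.symm
    | zero => rw [map_zero]; exact zero_mem _
    | one => rw [map_one]; exact one_mem _
    | neg x _ hx => rw [map_neg]; exact neg_mem hx
    | add x y _ _ hx hy => rw [map_add]; exact add_mem hx hy
    | mul x y _ _ hx hy => rw [map_mul]; exact mul_mem hx hy
  let e := RingEquiv.ofBijective ι.rangeRestrict ⟨fun a b h => hι (congrArg Subtype.val h), ι.rangeRestrict_surjective⟩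
  have he : ∀ x, ι (e.symm x) = x.1 := fun x => congrArg Subtype.val (e.apply_symm_apply x)
  refine ⟨e.symm.toRingHom.comp (κ.codRestrict ι.range hr), ?_⟩
  ext b
  apply hι
  exact (he _).trans (hκ b)

end Nag
end

section
open Limits

namespace Nag
open Scheme.IdealSheafData (comap_comp comap_id)

def LocalGood {W X : Scheme.{u}} (p : W ⟶ X) (K : X.IdealSheafData) (w : W) : Prop :=
  ∀ (S T : Scheme.{u}) (b : T ⟶ X) (m : S ⟶ T) (q : S ⟶ W) (s : S), m ≫ b = q ≫ p →
    Inv (K.comap b) → Inv (K.comap (m ≫ b)) → q s = w →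
    ∃ (T' : Scheme.{u}) (i : T' ⟶ T) (_ : IsOpenImmersion i), m s ∈ Set.range i ∧
      ∃ l : T' ⟶ W, l ≫ p = i ≫ b

lemma LocalGood.mul {W X : Scheme.{u}} {p : W ⟶ X} {K : X.IdealSheafData} {w : W}
    (h : LocalGood p K w) (L : X.IdealSheafData) : LocalGood p (K * L) w := by
  intro S T b m q s e h1 h2 e2
  rw [comap_mul] at h1 h2
  exact h S T b m q s e h1.of_mul h2.of_mul e2

lemma nzd_away {A : Type u} [CommRing A] (e x : A) (hx : x ∈ nonZeroDivisors A) :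
    algebraMap A (Localization.Away e) x ∈ nonZeroDivisors (Localization.Away e) :=
  IsLocalization.map_nonZeroDivisors_le (Submonoid.powers e) (Localization.Away e) ⟨x, hx, rfl⟩

lemma span_mul_unit {A : Type u} [CommRing A] (x e : A) (he : IsUnit e) :
    Ideal.span {x} = Ideal.span {x * e} :=
  (Ideal.span_singleton_mul_right_unit he x).symm

lemma lg_chart {W X : Scheme.{u}} {p : W ⟶ X} {B C : CommRingCat.{u}} (φ : B ⟶ C)
    (a : Spec B ⟶ X) [IsOpenImmersion a] (c : Spec C ⟶ W) [IsOpenImmersion c]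
    (h : c ≫ p = Spec.map φ ≫ a) (F : Ideal B) (K : X.IdealSheafData)
    (hK : K.comap a = idS B F) (G : Set B) (n : ℕ) (hG : ∀ g ∈ G, g ^ (n + 1) ∈ F)
    (hFC : F.map φ.hom = Ideal.span ((fun g => φ.hom g ^ (n + 1)) '' G))
    (hext : ∀ g ∈ G, ∀ (A : CommRingCat.{u}) (ψ : B ⟶ A), ψ.hom g ∈ nonZeroDivisors A →
      F.map ψ.hom ≤ Ideal.span {ψ.hom g ^ (n + 1)} → ∃ χ : C ⟶ A, φ ≫ χ = ψ)
    (w : W) (hw : w ∈ Set.range c) : LocalGood p K w := by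
  intro S T b m q s e h1 h2 hs
  obtain ⟨y, rfl⟩ := hw
  have hbt : b (m s) = a (Spec.map φ y) := by
    have e1 := congrArg (fun f => f s) e
    have e2 := congrArg (fun f => f y) h
    simp only [Scheme.Hom.comp_apply] at e1 e2
    rw [e1, hs, e2]
  obtain ⟨t, ht, -⟩ := Scheme.Pullback.exists_preimage_pullback (f := b) (g := a) _ _ hbt
  obtain ⟨A, ψ, i, hi, ⟨x, hx⟩, -, hi2, f, hf, hf1, hf2⟩ := spec_chart F (pullback.snd b a) (by
    rw [← hK, ← comap_comp, ← pullback.condition, comap_comp]; exact h1.comap _) ⊤ t trivial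
  set i' := i ≫ pullback.fst b a with hi'
  have hi'b : i' ≫ b = Spec.map ψ ≫ a := by
    rw [hi', Category.assoc, pullback.condition, reassoc_of% hi2]
  have hxt : i' x = m s := by rw [hi', Scheme.Hom.comp_apply, hx, ht]
  obtain ⟨s', hs', -⟩ := Scheme.Pullback.exists_preimage_pullback (f := m) (g := i') s x hxt.symm
  have hJ : Inv ((idS B F).comap (pullback.snd m i' ≫ Spec.map ψ)) := by
    rw [← hK, ← comap_comp, Category.assoc, ← hi'b, ← pullback.condition_assoc, comap_comp]
    exact h2.comap _
  obtain ⟨A', φ', i2, hi2', ⟨x', hx'⟩, hr, e2, f', hf', hf1', hf2'⟩ := spec_chart F _ hJ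
    ((pullback.fst m i' ≫ q) ⁻¹ᵁ c.opensRange) s' (by
      show (pullback.fst m i' ≫ q) s' ∈ Set.range c
      rw [Scheme.Hom.comp_apply, hs', hs]; exact ⟨y, rfl⟩)
  obtain ⟨θ, hθ⟩ := Spec.map_surjective (i2 ≫ pullback.snd m i')
  have hθ' : ψ ≫ θ = φ' := by
    apply Spec.map_injective
    rw [Spec.map_comp, hθ, Category.assoc, e2]
  have hrange : Set.range (i2 ≫ pullback.fst m i' ≫ q) ⊆ Set.range c := by
    rintro _ ⟨z, rfl⟩
    have := hr ⟨z, rfl⟩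
    rw [Scheme.Hom.comp_apply]
    exact this
  obtain ⟨χ, hχ⟩ := Spec.map_surjective (IsOpenImmersion.lift c _ hrange)
  have hχ' : φ ≫ χ = φ' := by
    apply Spec.map_injective
    rw [← cancel_mono a, Spec.map_comp, Category.assoc, ← h, hχ, IsOpenImmersion.lift_fac_assoc,
      Category.assoc, Category.assoc, ← e, pullback.condition_assoc, hi'b, ← e2,
      Category.assoc, Category.assoc]
  have eF : F.map φ'.hom = Ideal.span {θ.hom (ψ.hom f)} := by
    rw [← hθ', CommRingCat.hom_comp, ← Ideal.map_map, hf2, Ideal.map_span, Set.image_singleton]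
  have hnz : θ.hom (ψ.hom f) ∈ nonZeroDivisors A' := by
    obtain ⟨r, hr⟩ := Ideal.mem_span_singleton'.mp (eF ▸ Ideal.mem_map_of_mem φ'.hom hf')
    rw [← hr] at hf1'
    exact (mul_mem_nonZeroDivisors.mp hf1').2
  have eF2 : F.map φ'.hom = Ideal.span ((fun g => φ'.hom g ^ (n + 1)) '' G) := by
    rw [← hχ', CommRingCat.hom_comp, ← Ideal.map_map, hFC, Ideal.map_span, Set.image_image]
    congr 2
    ext g
    simp
  obtain ⟨_, ⟨g, hg, rfl⟩, d, hd, e3⟩ := alg_refine x'.asIdeal x'.2.ne_top _ hnz _ (eF2.symm.trans eF)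
  obtain ⟨r, hr2⟩ := Ideal.mem_span_singleton'.mp (hf2 ▸ Ideal.mem_map_of_mem ψ.hom (hG g hg))
  rw [map_pow] at hr2
  have hrd : θ.hom r = d := by
    have : θ.hom (ψ.hom f) * θ.hom r = θ.hom (ψ.hom f) * d := by
      rw [← e3, ← map_mul, mul_comm, hr2, ← hθ']
      simp
    exact (mul_cancel_left_mem_nonZeroDivisors hnz).mp this
  let L : A ⟶ CommRingCat.of (Localization.Away r) := CommRingCat.ofHom (algebraMap _ _)
  have hL : IsOpenImmersion (Spec.map L) := inferInstanceAs (IsOpenImmersion (Spec.map (CommRingCat.ofHom (algebraMap A (Localization.Away r)))))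
  have hu : IsUnit (L.hom r) := IsLocalization.Away.algebraMap_isUnit r
  have hLg : L.hom (ψ.hom g) ^ (n + 1) = L.hom (ψ.hom f) * L.hom r := by
    rw [← map_pow, ← hr2, map_mul, mul_comm]
  obtain ⟨χ0, hχ0⟩ := hext g hg _ (ψ ≫ L) (by
    have h5 : L.hom (ψ.hom g) ^ (n + 1) ∈ nonZeroDivisors (Localization.Away r) := by
      rw [hLg]
      exact mul_mem (nzd_away r _ hf1) hu.mem_nonZeroDivisors
    rw [pow_succ] at h5
    exact (mul_mem_nonZeroDivisors.mp h5).2) (by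
    rw [CommRingCat.hom_comp, ← Ideal.map_map, hf2, Ideal.map_span, Set.image_singleton,
      RingHom.comp_apply, hLg]
    exact (span_mul_unit _ _ hu).le)
  refine ⟨_, Spec.map L ≫ i', inferInstance, ?_, Spec.map χ0 ≫ c, ?_⟩
  · have h6 : i' (Spec.map θ x') = m s := by
      rw [← Scheme.Hom.comp_apply, hθ, Category.assoc, ← pullback.condition, Scheme.Hom.comp_apply,
        Scheme.Hom.comp_apply, hx', hs']
    rw [← h6]
    have h7 : Spec.map θ x' ∈ Set.range (Spec.map L) := by
      have := PrimeSpectrum.localization_away_comap_range (Localization.Away r) r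
      refine this.symm.subset ?_
      show r ∉ (Ideal.comap θ.hom x'.asIdeal)
      rw [Ideal.mem_comap, hrd]; exact hd
    obtain ⟨z, hz⟩ := h7
    exact ⟨z, by rw [Scheme.Hom.comp_apply, hz]⟩
  · rw [Category.assoc, Category.assoc, h, hi'b, ← Spec.map_comp_assoc, hχ0, Spec.map_comp_assoc]

end Nag
end

section
open Limits

namespace Nag
open Scheme.IdealSheafData (comap_comp comap_id)

lemma mono_over {S W X : Scheme.{u}} (p : W ⟶ X) (X0 : X.Opens)
    [IsOpenImmersion ((p ⁻¹ᵁ X0).ι ≫ p)] (l l' : S ⟶ W) (h : l ≫ p = l' ≫ p)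
    (hr : Set.range (l ≫ p) ⊆ X0) : l = l' := by
  have h1 : Set.range l ⊆ Set.range (p ⁻¹ᵁ X0).ι := by
    rw [Scheme.Opens.range_ι]
    rintro _ ⟨z, rfl⟩
    exact hr ⟨z, rfl⟩
  have h2 : Set.range l' ⊆ Set.range (p ⁻¹ᵁ X0).ι := by
    rw [Scheme.Opens.range_ι]
    rintro _ ⟨z, rfl⟩
    rw [h] at hr
    exact hr ⟨z, rfl⟩
  rw [← IsOpenImmersion.lift_fac (p ⁻¹ᵁ X0).ι l h1, ← IsOpenImmersion.lift_fac (p ⁻¹ᵁ X0).ι l' h2]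
  congr 1
  rw [← cancel_mono ((p ⁻¹ᵁ X0).ι ≫ p), IsOpenImmersion.lift_fac_assoc,
    IsOpenImmersion.lift_fac_assoc, h]

lemma finite_basic {B : Type u} [CommRing B] [IsNoetherianRing B] (U : Set (PrimeSpectrum B))
    (hU : IsOpen U) : ∃ G : Finset B, U = ⋃ g ∈ G, (PrimeSpectrum.basicOpen g : Set (PrimeSpectrum B)) := by
  obtain ⟨s, hs, e⟩ := (TopologicalSpace.Opens.IsBasis.isCompact_open_iff_eq_finite_iUnion
    (PrimeSpectrum.basicOpen (R := B)) PrimeSpectrum.isBasis_basic_opens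
    (fun i => PrimeSpectrum.isCompact_basicOpen i) U).mp
    ⟨TopologicalSpace.NoetherianSpace.isCompact _, hU⟩
  exact ⟨hs.toFinset, by simpa using e⟩

lemma support_idS (B : CommRingCat.{u}) (F : Ideal B) (y : Spec B) (hy : y ∈ (idS B F).support) :
    F ≤ y.asIdeal := by
  intro f hf
  rw [idS, ← SetLike.mem_coe, Scheme.IdealSheafData.coe_support_ofIdealTop, Spec_zeroLocus] at hy
  apply hy
  exact Ideal.mem_map_of_mem (Scheme.ΓSpecIso B).inv.hom hf

lemma lg_exists {W X : Scheme.{u}} (p : W ⟶ X) [LocallyOfFiniteType p] [IsLocallyNoetherian X]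
    (X0 : X.Opens) [hp : IsOpenImmersion ((p ⁻¹ᵁ X0).ι ≫ p)] (w : W) :
    ∃ K : X.IdealSheafData, (∀ x ∈ X0, x ∉ K.support) ∧
      ∃ O : W.Opens, w ∈ O ∧ ∀ w' ∈ O, LocalGood p K w' := by
  classical
  obtain ⟨V, O, hwO, -, hOV⟩ := exists_affine_pair p ⊤ w trivial
  have hV : IsAffineOpen V.1 := V.2
  have hO : IsAffineOpen O.1 := O.2
  have : IsNoetherianRing Γ(X, V.1) := IsLocallyNoetherian.component_noetherian V
  let B := Γ(X, V.1)
  let C := Γ(W, O.1)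
  let φ : B ⟶ C := p.appLE V.1 O.1 hOV
  let a : Spec B ⟶ X := hV.fromSpec
  let c : Spec C ⟶ W := hO.fromSpec
  have hac : c ≫ p = Spec.map φ ≫ a := (IsAffineOpen.SpecMap_appLE_fromSpec p hV hO hOV).symm
  obtain ⟨s, hs⟩ := p.finiteType_appLE hV hO hOV
  have hs' : ∀ x : C, x ∈ Subring.closure (Set.range φ.hom ∪ (s : Set C)) := by
    intro x
    let _ := φ.hom.toAlgebra
    have : x ∈ Algebra.adjoin B (s : Set C) := by
      rw [hs]; trivial
    rwa [← Subalgebra.mem_toSubring, Algebra.adjoin_eq_ring_closure] at this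
  let W1 : (Spec C).Opens := c ⁻¹ᵁ p ⁻¹ᵁ X0
  let u := W1.ι ≫ c ≫ p
  have hW1 : Set.range (W1.ι ≫ c) ⊆ Set.range (p ⁻¹ᵁ X0).ι := by
    rw [Scheme.Opens.range_ι]
    rintro _ ⟨z, rfl⟩
    exact z.2
  have hu : IsOpenImmersion u := by
    have h1 : IsOpenImmersion (IsOpenImmersion.lift (p ⁻¹ᵁ X0).ι _ hW1) := by
      have : IsOpenImmersion (IsOpenImmersion.lift (p ⁻¹ᵁ X0).ι _ hW1 ≫ (p ⁻¹ᵁ X0).ι) := by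
        rw [IsOpenImmersion.lift_fac]; infer_instance
      exact IsOpenImmersion.of_comp _ (p ⁻¹ᵁ X0).ι
    have h2 : u = IsOpenImmersion.lift (p ⁻¹ᵁ X0).ι _ hW1 ≫ (p ⁻¹ᵁ X0).ι ≫ p := by
      rw [IsOpenImmersion.lift_fac_assoc, Category.assoc]
    rw [h2]; infer_instance
  obtain ⟨G, hG⟩ := finite_basic (a ⁻¹' Set.range u) (u.isOpenEmbedding.isOpen_range.preimage a.continuous)
  have hτ : ∀ g : B, g ∈ G → ∃ τ : C →+* Localization.Away g, τ.comp φ.hom = algebraMap _ _ ∧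
     (IsLocalization.Away.lift (S := Localization.Away g) (g := (algebraMap C (Localization.Away (φ.hom g))).comp φ.hom) g
      (IsLocalization.Away.algebraMap_isUnit (φ.hom g))).comp τ = algebraMap _ _ := by
    intro g hg
    let L : B ⟶ CommRingCat.of (Localization.Away g) := CommRingCat.ofHom (algebraMap _ _)
    have hr : Set.range (Spec.map L ≫ a) ⊆ Set.range u := by
      rintro _ ⟨z, rfl⟩
      have h1 : Spec.map L z ∈ (PrimeSpectrum.basicOpen g : Set (PrimeSpectrum B)) := by
        rw [← PrimeSpectrum.localization_away_comap_range (Localization.Away g) g]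
        exact ⟨z, rfl⟩
      exact hG.symm.subset (Set.mem_biUnion hg h1)
    obtain ⟨τ, hτ⟩ := Spec.map_surjective (IsOpenImmersion.lift u _ hr ≫ W1.ι)
    have h2 : Spec.map τ ≫ c ≫ p = Spec.map L ≫ a := by
      rw [hτ, Category.assoc]
      exact IsOpenImmersion.lift_fac _ _ _
    have h3 : φ ≫ τ = L := by
      apply Spec.map_injective
      rw [← cancel_mono a, ← h2, Spec.map_comp, Category.assoc, ← hac]
    refine ⟨τ.hom, ?_, ?_⟩
    · rw [← CommRingCat.hom_comp, h3]; rfl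
    · let μ : CommRingCat.of (Localization.Away g) ⟶ CommRingCat.of (Localization.Away (φ.hom g)) :=
        CommRingCat.ofHom (IsLocalization.Away.lift (S := Localization.Away g) (g := (algebraMap C (Localization.Away (φ.hom g))).comp φ.hom) g
      (IsLocalization.Away.algebraMap_isUnit (φ.hom g)))
      let M : C ⟶ CommRingCat.of (Localization.Away (φ.hom g)) := CommRingCat.ofHom (algebraMap _ _)
      have h4 : L ≫ μ = φ ≫ M := by
        ext x
        exact IsLocalization.Away.lift_eq (S := Localization.Away g) (g := (algebraMap C (Localization.Away (φ.hom g))).comp φ.hom) g (IsLocalization.Away.algebraMap_isUnit (φ.hom g)) _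
      suffices τ ≫ μ = M from congrArg CommRingCat.Hom.hom this
      apply Spec.map_injective
      rw [← cancel_mono c]
      have h5 : (Spec.map (τ ≫ μ) ≫ c) ≫ p = Spec.map μ ≫ Spec.map L ≫ a := by
        rw [Spec.map_comp, Category.assoc, Category.assoc, h2]
      refine mono_over p X0 _ _ ?_ ?_
      · rw [h5, Category.assoc, hac, ← Spec.map_comp_assoc, ← Spec.map_comp_assoc, h4]
      · rw [h5]
        rintro _ ⟨z, rfl⟩
        obtain ⟨v, hv⟩ := hr ⟨Spec.map μ z, rfl⟩
        rw [Scheme.Hom.comp_apply, ← hv]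
        exact v.2
  choose τ hτ1 hτ2 using hτ
  have hn : ∀ g ∈ G, ∀ x ∈ s, ∃ n : ℕ, ∀ N, n ≤ N → ∃ b, φ.hom g ^ N * x = φ.hom b :=
    fun g hg x _ => alg_denom φ.hom g (τ g hg) (hτ2 g hg) x
  choose! nn hnn using hn
  let n := ∑ g ∈ G, ∑ x ∈ s, nn g x
  have hn : ∀ g ∈ G, ∀ x ∈ s, ∃ b, φ.hom g ^ (n + 1) * x = φ.hom b := fun g hg x hx => by
    refine hnn g hg x hx _ ?_
    have h1 := Finset.single_le_sum (f := fun x => nn g x) (fun _ _ => Nat.zero_le _) hx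
    have h2 := Finset.single_le_sum (f := fun g => ∑ x ∈ s, nn g x) (fun _ _ => Nat.zero_le _) hg
    omega
  let H : Ideal B := Ideal.span ((fun g => g ^ (n + 1)) '' (G : Set B))
  let F : Ideal B := (H.map φ.hom).comap φ.hom
  have hHF : H ≤ F := Ideal.le_comap_map
  have hFC : F.map φ.hom = H.map φ.hom := Ideal.map_comap_map _ _
  have hqc : QuasiCompact a := inferInstance
  refine ⟨(idS B F).map a, ?_, O.1, hwO, ?_⟩
  · intro x hx hxs
    rw [Scheme.IdealSheafData.support_map] at hxs
    obtain ⟨_, hx1, y, hy, rfl⟩ := mem_closure_iff.mp hxs X0 X0.2 hx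
    have hy' := support_idS _ _ _ hy
    obtain ⟨_, ⟨_, ⟨f, rfl⟩, rfl⟩, hf1, hf2⟩ := PrimeSpectrum.isBasis_basic_opens.exists_subset_of_mem_open
      (show y ∈ (SetLike.coe (a ⁻¹ᵁ X0 : (Spec B).Opens) : Set (PrimeSpectrum B)) from hx1) (a ⁻¹ᵁ X0).2
    have hrad : φ.hom f ∈ (H.map φ.hom).radical := by
      rw [Ideal.radical_eq_sInf, Submodule.mem_sInf]
      rintro q ⟨hq1, hq2⟩
      by_contra hfq
      let z : Spec C := ⟨q, hq2⟩
      have hz1 : Spec.map φ z ∈ a ⁻¹ᵁ X0 := hf2 hfq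
      have hz2 : z ∈ W1 := by
        show (c ≫ p) z ∈ X0
        rw [hac]; exact hz1
      have hz3 : Spec.map φ z ∈ a ⁻¹' Set.range u := by
        refine ⟨⟨z, hz2⟩, ?_⟩
        show (c ≫ p) z = (Spec.map φ ≫ a) z
        rw [hac]
      obtain ⟨g, hg, hz4⟩ := Set.mem_iUnion₂.mp (hG.subset hz3)
      apply hz4
      show φ.hom g ∈ q
      have h6 : φ.hom (g ^ (n + 1)) ∈ q := hq1 (Ideal.mem_map_of_mem _ (Ideal.subset_span ⟨g, hg, rfl⟩))
      rw [map_pow] at h6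
      exact hq2.mem_of_pow_mem _ h6
    obtain ⟨N, hN⟩ := hrad
    rw [← map_pow] at hN
    exact hf1 (y.2.mem_of_pow_mem _ (hy' hN))
  · intro w' hw'
    refine lg_chart φ a c hac F _ (comap_map_open a _) (G : Set B) n
      (fun g hg => hHF (Ideal.subset_span ⟨g, hg, rfl⟩)) ?_ ?_ w' ?_
    · rw [hFC, Ideal.map_span, Set.image_image]
      simp
    · intro g hg A ψ hψ hF
      obtain ⟨χ, hχ⟩ := alg_extend φ.hom g (τ g hg) (hτ1 g hg) (s : Set C) (n + 1) F hs' (by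
        intro x hx
        obtain ⟨b, hb⟩ := hn g hg x hx
        refine ⟨b, ?_, hb⟩
        show φ.hom b ∈ H.map φ.hom
        rw [← hb, ← map_pow]
        exact Ideal.mul_mem_right _ _ (Ideal.mem_map_of_mem _ (Ideal.subset_span ⟨g, hg, rfl⟩))) ψ.hom hψ hF
      exact ⟨CommRingCat.ofHom χ, CommRingCat.hom_ext hχ⟩
    · show w' ∈ Set.range hO.fromSpec
      rw [hO.range_fromSpec]; exact hw'

end Nag
end

section
open Limits

namespace Nag
open Scheme.IdealSheafData (comap_comp comap_id)

lemma lg_global {W X : Scheme.{u}} (p : W ⟶ X) [LocallyOfFiniteType p] [IsLocallyNoetherian X]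
    [CompactSpace W] (X0 : X.Opens) [hp : IsOpenImmersion ((p ⁻¹ᵁ X0).ι ≫ p)] :
    ∃ K : X.IdealSheafData, (K.support : Set X) = (X0 : Set X)ᶜ ∧ ∀ w, LocalGood p K w := by
  have h1 : ∃ K : X.IdealSheafData, (∀ x ∈ X0, x ∉ K.support) ∧ ∀ w ∈ (Set.univ : Set W), LocalGood p K w := by
    refine isCompact_univ.induction_on (p := fun Z => ∃ K : X.IdealSheafData, (∀ x ∈ X0, x ∉ K.support) ∧
      ∀ w ∈ Z, LocalGood p K w) ?_ ?_ ?_ ?_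
    · refine ⟨⊤, fun x _ h => ?_, fun w hw => hw.elim⟩
      exact h
    · rintro s t hst ⟨K, hK, h⟩
      exact ⟨K, hK, fun w hw => h w (hst hw)⟩
    · rintro s t ⟨K, hK, h⟩ ⟨K', hK', h'⟩
      refine ⟨K * K', fun x hx hx' => ?_, fun w hw => ?_⟩
      · rw [Scheme.IdealSheafData.support_mul] at hx'
        exact hx'.elim (hK x hx) (hK' x hx)
      · rcases hw with hw | hw
        · exact (h w hw).mul _
        · rw [mul_comm]; exact (h' w hw).mul _
    · intro w _
      obtain ⟨K, hK, O, hO, h⟩ := lg_exists p X0 w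
      exact ⟨O, mem_nhdsWithin_of_mem_nhds (O.2.mem_nhds hO), K, hK, h⟩
  obtain ⟨K, hK, h⟩ := h1
  let Z : TopologicalSpace.Closeds X := ⟨(X0 : Set X)ᶜ, X0.2.isClosed_compl⟩
  refine ⟨K * Scheme.IdealSheafData.vanishingIdeal Z, ?_, fun w => (h w trivial).mul _⟩
  rw [Scheme.IdealSheafData.support_mul, TopologicalSpace.Closeds.coe_sup, Scheme.IdealSheafData.coe_support_vanishingIdeal]
  apply Set.Subset.antisymm
  · rintro x (hx | hx)
    · exact fun hx0 => hK x hx0 hx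
    · exact hx
  · exact fun x hx => Or.inr hx

lemma uniq_over {S W X : Scheme.{u}} (p : W ⟶ X) [IsSeparated p] (X0 : X.Opens)
    [IsOpenImmersion ((p ⁻¹ᵁ X0).ι ≫ p)] (K : X.IdealSheafData)
    (hK : (K.support : Set X) = (X0 : Set X)ᶜ) (l l' : S ⟶ W) (h : l ≫ p = l' ≫ p)
    (hI : Inv (K.comap (l ≫ p))) : l = l' := by
  have hd : IsSchemeTheoreticallyDominant ((l ≫ p) ⁻¹ᵁ X0).ι := by
    refine hI.dominant _ ?_
    rw [Scheme.IdealSheafData.support_comap, Scheme.Opens.range_ι]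
    intro x hx
    by_contra hx2
    apply hx
    show (l ≫ p) x ∈ (K.support : Set X)
    rw [hK]
    exact hx2
  refine ext_of_dominant p h ((l ≫ p) ⁻¹ᵁ X0).ι ?_
  refine mono_over p X0 _ _ ?_ ?_
  · rw [Category.assoc, Category.assoc, h]
  · rw [Category.assoc]
    rintro _ ⟨z, rfl⟩
    exact z.2

/-- Lemma F -/
lemma lemF {W X : Scheme.{u}} (p : W ⟶ X) [LocallyOfFiniteType p] [IsSeparated p]
    [IsLocallyNoetherian X]
    [CompactSpace W] (X0 : X.Opens) [hp : IsOpenImmersion ((p ⁻¹ᵁ X0).ι ≫ p)] :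
    ∃ K : X.IdealSheafData, (K.support : Set X) = (X0 : Set X)ᶜ ∧
      ∀ (S T : Scheme.{u}) (b : T ⟶ X) (bS : S ⟶ W) (m : S ⟶ T), IsBlowup b K →
        IsBlowup bS (K.comap p) → m ≫ b = bS ≫ p → IsOpenImmersion m := by
  obtain ⟨K, hK, hg⟩ := lg_global p X0
  refine ⟨K, hK, fun S T b bS m hb hbS hm => ?_⟩
  have hIS : Inv (K.comap (bS ≫ p)) := by rw [comap_comp]; exact hbS.inv
  have H : ∀ s : S, ∃ (T' : Scheme.{u}) (i : T' ⟶ T) (_ : IsOpenImmersion i), m s ∈ Set.range i ∧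
      ∃ l : T' ⟶ W, l ≫ p = i ≫ b := fun s =>
    hg (bS s) S T b m bS s hm hb.inv (by rw [hm]; exact hIS) rfl
  choose T' i hi hr l hl using H
  let D : T.Opens := ⨆ s, (i s).opensRange
  obtain ⟨q, hq⟩ : ∃ q, q ≫ p = D.ι ≫ b := by
    refine glue_local _ _ ?_ ?_
    · rintro ⟨t, ht⟩
      obtain ⟨s, hs⟩ := TopologicalSpace.Opens.mem_iSup.mp ht
      have hr2 : Set.range (i s) ⊆ Set.range D.ι := by
        rw [Scheme.Opens.range_ι]
        rintro _ ⟨z, rfl⟩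
        exact TopologicalSpace.Opens.mem_iSup.mpr ⟨s, z, rfl⟩
      have hop : IsOpenImmersion (IsOpenImmersion.lift D.ι (i s) hr2) := by
        have : IsOpenImmersion (IsOpenImmersion.lift D.ι (i s) hr2 ≫ D.ι) := by
          rw [IsOpenImmersion.lift_fac]; infer_instance
        exact IsOpenImmersion.of_comp _ D.ι
      refine ⟨_, IsOpenImmersion.lift D.ι (i s) hr2, hop, ?_, l s, ?_⟩
      · obtain ⟨z, hz⟩ := hs
        refine ⟨z, D.ι.isOpenEmbedding.injective ?_⟩
        rw [← Scheme.Hom.comp_apply, IsOpenImmersion.lift_fac, hz]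
        rfl
      · rw [IsOpenImmersion.lift_fac_assoc, hl]
    · intro S' j _ l1 l2 h1 h2
      refine uniq_over p X0 K hK _ _ (h1.trans h2.symm) ?_
      rw [h1, comap_comp, comap_comp]
      exact (hb.inv.comap _).comap _
  obtain ⟨σ, hσ⟩ := hbS.lift _ q (by
    rw [← comap_comp, hq, comap_comp]; exact hb.inv.comap _)
  have hmD : Set.range m ⊆ Set.range D.ι := by
    rw [Scheme.Opens.range_ι]
    rintro _ ⟨s, rfl⟩
    exact TopologicalSpace.Opens.mem_iSup.mpr ⟨s, hr s⟩
  let m' := IsOpenImmersion.lift D.ι m hmD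
  have hm' : m' ≫ D.ι = m := IsOpenImmersion.lift_fac _ _ _
  have e1 : σ ≫ m = D.ι := by
    have e0 : (σ ≫ m) ≫ b = D.ι ≫ b := by rw [Category.assoc, hm, reassoc_of% hσ, hq]
    refine hb.uniq _ _ _ ?_ e0
    rw [e0, comap_comp]; exact hb.inv.comap _
  have e2 : m' ≫ q = bS := by
    have e0 : (m' ≫ q) ≫ p = bS ≫ p := by rw [Category.assoc, hq, reassoc_of% hm', hm]
    refine uniq_over p X0 K hK _ _ e0 ?_
    rw [e0]; exact hIS
  have hiso : IsIso m' := by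
    refine ⟨σ, ?_, ?_⟩
    · refine hbS.uniq _ _ _ ?_ ?_
      · rw [Category.assoc, hσ, e2]; exact hbS.inv
      · rw [Category.assoc, hσ, e2, Category.id_comp]
    · rw [← cancel_mono D.ι, Category.assoc, hm', e1, Category.id_comp]
  rw [← hm']
  infer_instance

end Nag
end

section
open Limits
namespace Nag

lemma glue2 {Q B1 B2 : Scheme.{u}} (g1 : Q ⟶ B1) (g2 : Q ⟶ B2) [IsOpenImmersion g1]
    [IsOpenImmersion g2] : ∃ (Z : Scheme.{u}) (i1 : B1 ⟶ Z) (i2 : B2 ⟶ Z),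
      IsOpenImmersion i1 ∧ IsOpenImmersion i2 ∧ g1 ≫ i1 = g2 ≫ i2 ∧
      (∀ z : Z, z ∈ Set.range i1 ∨ z ∈ Set.range i2) ∧
      (∀ (x : B1) (y : B2), i1 x = i2 y → ∃ q, g1 q = x ∧ g2 q = y) ∧
      (∀ (T : Scheme.{u}) (a : B1 ⟶ T) (b : B2 ⟶ T), g1 ≫ a = g2 ≫ b →
        ∃ c : Z ⟶ T, i1 ≫ c = a ∧ i2 ≫ c = b) := by
  refine ⟨pushout g1 g2, pushout.inl g1 g2, pushout.inr g1 g2, ?_, ?_, pushout.condition, ?_, ?_,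
    fun T a b h => ⟨pushout.desc a b h, pushout.inl_desc _ _ _, pushout.inr_desc _ _ _⟩⟩
  · exact inferInstanceAs (IsOpenImmersion (colimit.ι (span g1 g2) WalkingSpan.left))
  · exact inferInstanceAs (IsOpenImmersion (colimit.ι (span g1 g2) WalkingSpan.right))
  · intro z
    obtain ⟨i, x, hx⟩ := Scheme.IsLocallyDirected.ι_jointly_surjective (span g1 g2) z
    rcases i with _ | _ | _
    · left
      have := colimit.w (span g1 g2) WalkingSpan.Hom.fst
      rw [← this] at hx
      exact ⟨_, by rw [← hx]; rfl⟩
    · left; exact ⟨x, hx⟩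
    · right; exact ⟨x, hx⟩
  · intro x y h
    obtain ⟨k, fi, fj, q, h1, h2⟩ := (Scheme.IsLocallyDirected.ι_eq_ι_iff (span g1 g2)
      (i := WalkingSpan.left) (j := WalkingSpan.right)).mp h
    rcases k with _ | _ | _
    · refine ⟨q, ?_, ?_⟩
      · change WidePushoutShape.Hom _ _ at fi
        cases fi; exact h1
      · change WidePushoutShape.Hom _ _ at fj
        cases fj; exact h2
    · change WidePushoutShape.Hom _ _ at fj
      cases fj
    · change WidePushoutShape.Hom _ _ at fi
      cases fi

variable {S : Scheme.{u}}

lemma val_lift {Y : Scheme.{u}} (y : Y ⟶ S) [IsProper y] {R K : Type u} [CommRing R] [IsDomain R]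
    [ValuationRing R] [Field K] [Algebra R K] [IsFractionRing R K] (a : Spec (.of K) ⟶ Y)
    (s : Spec (.of R) ⟶ S) (h : a ≫ y = Spec.map (CommRingCat.ofHom (algebraMap R K)) ≫ s) :
    ∃ l : Spec (.of R) ⟶ Y, Spec.map (CommRingCat.ofHom (algebraMap R K)) ≫ l = a ∧ l ≫ y = s := by
  have : ValuativeCriterion y := by
    have h := IsProper.eq_valuativeCriterion.{u}
    have h2 : IsProper y := inferInstance
    rw [h] at h2
    exact h2.1.1.1
  obtain ⟨⟨l, h1, h2⟩⟩ := (this.existence ⟨R, K, a, s, ⟨h⟩⟩).exists_lift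
  exact ⟨l, h1, h2⟩

lemma val_uniq {Y : Scheme.{u}} (y : Y ⟶ S) [IsSeparated y] {R K : Type u} [CommRing R] [IsDomain R]
    [ValuationRing R] [Field K] [Algebra R K] [IsFractionRing R K] (l l' : Spec (.of R) ⟶ Y)
    (h : l ≫ y = l' ≫ y) (h2 : Spec.map (CommRingCat.ofHom (algebraMap R K)) ≫ l =
      Spec.map (CommRingCat.ofHom (algebraMap R K)) ≫ l') : l = l' := by
  have := IsSeparated.valuativeCriterion y ⟨R, K,
    Spec.map (CommRingCat.ofHom (algebraMap R K)) ≫ l, l ≫ y, ⟨by simp⟩⟩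
  have := this.elim ⟨l, rfl, rfl⟩ ⟨l', h2.symm, h.symm⟩
  exact congrArg CommSq.LiftStruct.l this

/-- the closed point -/
noncomputable def cp (R : Type u) [CommRing R] [IsLocalRing R] : (Spec (.of R) : Scheme.{u}) :=
  IsLocalRing.closedPoint R

lemma val_fac {Y V : Scheme.{u}} (i : V ⟶ Y) [IsOpenImmersion i] {R : Type u} [CommRing R]
    [IsLocalRing R] (l : Spec (.of R) ⟶ Y)
    (h : l (cp R) ∈ Set.range i) : ∃ m, m ≫ i = l := by
  have : l ⁻¹ᵁ i.opensRange = ⊤ := (IsLocalRing.closedPoint_mem_iff (R := R) _).mp h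
  refine ⟨IsOpenImmersion.lift i l ?_, IsOpenImmersion.lift_fac _ _ _⟩
  rintro _ ⟨x, rfl⟩
  have : x ∈ l ⁻¹ᵁ i.opensRange := by rw [this]; trivial
  exact this

/-- data for gluing -/
structure GD {P Y1 Y2 Z : Scheme.{u}} {O1 O2 : P.Opens} (p : P ⟶ S) (y1 : Y1 ⟶ S) (y2 : Y2 ⟶ S)
    (j1 : O1.toScheme ⟶ Y1) (j2 : O2.toScheme ⟶ Y2) {B1 : Y1.Opens} {B2 : Y2.Opens}
    (i1 : B1.toScheme ⟶ Z) (i2 : B2.toScheme ⟶ Z) (z : Z ⟶ S) : Prop where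
  pp : IsProper p
  py1 : IsProper y1
  py2 : IsProper y2
  oj1 : IsOpenImmersion j1
  oj2 : IsOpenImmersion j2
  oi1 : IsOpenImmersion i1
  oi2 : IsOpenImmersion i2
  hj1 : j1 ≫ y1 = O1.ι ≫ p
  hj2 : j2 ≫ y2 = O2.ι ≫ p
  hO : ∀ x : P, x ∈ O1 ∨ x ∈ O2
  hB1 : ∀ x : Y1, x ∈ B1 ↔ ∀ o : O1, j1 o = x → o.1 ∈ O2
  hB2 : ∀ x : Y2, x ∈ B2 ↔ ∀ o : O2, j2 o = x → o.1 ∈ O1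
  hi1 : i1 ≫ z = B1.ι ≫ y1
  hi2 : i2 ≫ z = B2.ι ≫ y2
  cov : ∀ t : Z, t ∈ Set.range i1 ∨ t ∈ Set.range i2
  ag : ∀ (T : Scheme.{u}) (a : T ⟶ B1.toScheme) (b : T ⟶ B2.toScheme) (s1 : T ⟶ O1.toScheme)
    (s2 : T ⟶ O2.toScheme), s1 ≫ O1.ι = s2 ≫ O2.ι → s1 ≫ j1 = a ≫ B1.ι → s2 ≫ j2 = b ≫ B2.ι →
    a ≫ i1 = b ≫ i2
  ov : ∀ (T : Scheme.{u}) (a : T ⟶ B1.toScheme) (b : T ⟶ B2.toScheme), a ≫ i1 = b ≫ i2 →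
    ∃ (s1 : T ⟶ O1.toScheme) (s2 : T ⟶ O2.toScheme), s1 ≫ O1.ι = s2 ≫ O2.ι ∧
      s1 ≫ j1 = a ≫ B1.ι ∧ s2 ≫ j2 = b ≫ B2.ι

variable {P Y1 Y2 Z : Scheme.{u}} {O1 O2 : P.Opens} {p : P ⟶ S} {y1 : Y1 ⟶ S} {y2 : Y2 ⟶ S}
    {j1 : O1.toScheme ⟶ Y1} {j2 : O2.toScheme ⟶ Y2} {B1 : Y1.Opens} {B2 : Y2.Opens}
    {i1 : B1.toScheme ⟶ Z} {i2 : B2.toScheme ⟶ Z} {z : Z ⟶ S}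

lemma GD.symm (D : GD p y1 y2 j1 j2 i1 i2 z) : GD p y2 y1 j2 j1 i2 i1 z where
  pp := D.pp
  py1 := D.py2
  py2 := D.py1
  oj1 := D.oj2
  oj2 := D.oj1
  oi1 := D.oi2
  oi2 := D.oi1
  hj1 := D.hj2
  hj2 := D.hj1
  hO := fun x => (D.hO x).symm
  hB1 := D.hB2
  hB2 := D.hB1
  hi1 := D.hi2
  hi2 := D.hi1
  cov := fun x => (D.cov x).symm
  ag := fun T a b s1 s2 h1 h2 h3 => (D.ag T b a s2 s1 h1.symm h3 h2).symm
  ov := fun T a b h => by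
    obtain ⟨s1, s2, h1, h2, h3⟩ := D.ov T b a h.symm
    exact ⟨s2, s1, h1.symm, h3, h2⟩

lemma GD.exist (D : GD p y1 y2 j1 j2 i1 i2 z) {R K : Type u} [CommRing R] [IsDomain R]
    [ValuationRing R] [Field K] [Algebra R K] [IsFractionRing R K]
    (a : Spec (.of K) ⟶ B1.toScheme)
    (s : Spec (.of R) ⟶ S)
    (h : a ≫ B1.ι ≫ y1 = Spec.map (CommRingCat.ofHom (algebraMap R K)) ≫ s) :
    ∃ l : Spec (.of R) ⟶ Z, Spec.map (CommRingCat.ofHom (algebraMap R K)) ≫ l = a ≫ i1 ∧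
      l ≫ z = s := by
  obtain ⟨pp, py1, py2, oj1, oj2, oi1, oi2, hj1, hj2, hO, hB1, hB2, hi1, hi2, cov, ag, ov⟩ := D
  set φ := Spec.map (CommRingCat.ofHom (algebraMap R K)) with hφ
  obtain ⟨l1, hl1, hl1s⟩ := val_lift y1 (a ≫ B1.ι) s (by rw [Category.assoc, h])
  rw [← hφ] at hl1
  by_cases hc : l1 (cp R) ∈ B1
  · obtain ⟨m, hm⟩ := val_fac B1.ι l1 (by rw [Scheme.Opens.range_ι]; exact hc)
    refine ⟨m ≫ i1, ?_, ?_⟩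
    · have : φ ≫ m = a := by rw [← cancel_mono B1.ι, Category.assoc, hm, hl1]
      rw [reassoc_of% this]
    · rw [Category.assoc, hi1, reassoc_of% hm, hl1s]
  · have hc' := hc
    rw [hB1] at hc'
    push Not at hc'
    obtain ⟨o, ho, ho2⟩ := hc'
    obtain ⟨μ, hμ⟩ := val_fac j1 l1 ⟨o, ho⟩
    have hμo : μ (cp R) = o := by
      apply j1.isOpenEmbedding.injective
      rw [← Scheme.Hom.comp_apply, hμ, ho]
    have hr : Set.range (φ ≫ μ ≫ O1.ι) ⊆ Set.range O2.ι := by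
      rw [Scheme.Opens.range_ι]
      rintro _ ⟨t, rfl⟩
      have h1 : (a ≫ B1.ι) t ∈ B1 := by
        rw [Scheme.Hom.comp_apply]; exact (a t).2
      have h2 := (hB1 _).mp h1 ((φ ≫ μ) t) (by
        rw [← Scheme.Hom.comp_apply, Category.assoc, hμ, hl1])
      exact h2
    obtain ⟨ν, hν⟩ : ∃ ν, ν ≫ O2.ι = φ ≫ μ ≫ O1.ι := ⟨_, IsOpenImmersion.lift_fac _ _ hr⟩
    obtain ⟨l2, hl2, hl2s⟩ := val_lift y2 (ν ≫ j2) s (by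
      rw [Category.assoc, hj2, reassoc_of% hν, ← hj1, reassoc_of% hμ, hl1s])
    rw [← hφ] at hl2
    by_cases hc2 : l2 (cp R) ∈ B2
    · obtain ⟨m, hm⟩ := val_fac B2.ι l2 (by rw [Scheme.Opens.range_ι]; exact hc2)
      refine ⟨m ≫ i2, ?_, ?_⟩
      · rw [← Category.assoc]
        exact (ag _ a (φ ≫ m) (φ ≫ μ) ν (by rw [Category.assoc, hν])
          (by rw [Category.assoc, hμ, hl1]) (by rw [Category.assoc, hm, hl2])).symm
      · rw [Category.assoc, hi2, reassoc_of% hm, hl2s]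
    · exfalso
      rw [hB2] at hc2
      push Not at hc2
      obtain ⟨o', ho', -⟩ := hc2
      obtain ⟨μ', hμ'⟩ := val_fac j2 l2 ⟨o', ho'⟩
      have e1 : φ ≫ μ' = ν := by rw [← cancel_mono j2, Category.assoc, hμ', hl2]
      have e2 : μ' ≫ O2.ι = μ ≫ O1.ι := by
        refine val_uniq p (R := R) (K := K) _ _ ?_ ?_
        · rw [Category.assoc, Category.assoc, ← hj1, ← hj2, reassoc_of% hμ, reassoc_of% hμ',
            hl1s, hl2s]
        · rw [← hφ, reassoc_of% e1, hν]
      have e3 : (μ' ≫ O2.ι) (cp R) ∈ O2 := by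
        rw [Scheme.Hom.comp_apply]; exact (μ' _).2
      rw [e2, Scheme.Hom.comp_apply, hμo] at e3
      exact ho2 e3

lemma GD.uniq (D : GD p y1 y2 j1 j2 i1 i2 z) {R K : Type u} [CommRing R] [IsDomain R]
    [ValuationRing R] [Field K] [Algebra R K] [IsFractionRing R K]
    (l : Spec (.of R) ⟶ B1.toScheme) (l' : Spec (.of R) ⟶ B2.toScheme)
    (h : l ≫ i1 ≫ z = l' ≫ i2 ≫ z)
    (h2 : Spec.map (CommRingCat.ofHom (algebraMap R K)) ≫ l ≫ i1 =
      Spec.map (CommRingCat.ofHom (algebraMap R K)) ≫ l' ≫ i2) : l ≫ i1 = l' ≫ i2 := by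
  obtain ⟨pp, py1, py2, oj1, oj2, oi1, oi2, hj1, hj2, hO, hB1, hB2, hi1, hi2, cov, ag, ov⟩ := D
  set φ := Spec.map (CommRingCat.ofHom (algebraMap R K)) with hφ
  obtain ⟨s1, s2, hs, hs1, hs2⟩ := ov _ (φ ≫ l) (φ ≫ l') (by simpa using h2)
  obtain ⟨μ, hμ, hμs⟩ := val_lift p (s1 ≫ O1.ι) (l ≫ i1 ≫ z) (by
    rw [Category.assoc, ← hj1, reassoc_of% hs1, hi1])
  rw [← hφ] at hμ
  have c1 : μ (cp R) ∈ O1 → ∃ μ1, μ1 ≫ O1.ι = μ ∧ μ1 ≫ j1 = l ≫ B1.ι := by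
    intro hm
    obtain ⟨μ1, hμ1⟩ := val_fac O1.ι μ (by rw [Scheme.Opens.range_ι]; exact hm)
    refine ⟨μ1, hμ1, val_uniq y1 (R := R) (K := K) _ _ ?_ ?_⟩
    · rw [Category.assoc, hj1, reassoc_of% hμ1, hμs, hi1, Category.assoc]
    · have : φ ≫ μ1 = s1 := by rw [← cancel_mono O1.ι, Category.assoc, hμ1, hμ]
      rw [← hφ, reassoc_of% this, hs1, Category.assoc]
  have c2 : μ (cp R) ∈ O2 → ∃ μ1, μ1 ≫ O2.ι = μ ∧ μ1 ≫ j2 = l' ≫ B2.ι := by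
    intro hm
    obtain ⟨μ1, hμ1⟩ := val_fac O2.ι μ (by rw [Scheme.Opens.range_ι]; exact hm)
    refine ⟨μ1, hμ1, val_uniq y2 (R := R) (K := K) _ _ ?_ ?_⟩
    · rw [Category.assoc, hj2, reassoc_of% hμ1, hμs, h, hi2, Category.assoc]
    · have : φ ≫ μ1 = s2 := by rw [← cancel_mono O2.ι, Category.assoc, hμ1, hμ, hs]
      rw [← hφ, reassoc_of% this, hs2, Category.assoc]
  have key : μ (cp R) ∈ O1 ∧ μ (cp R) ∈ O2 := by
    rcases hO (μ (cp R)) with hm | hm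
    · refine ⟨hm, ?_⟩
      obtain ⟨μ1, h1, h2⟩ := c1 hm
      have := (hB1 ((l ≫ B1.ι) (cp R))).mp (by
        rw [Scheme.Hom.comp_apply]; exact (l _).2) (μ1 (cp R))
        (by rw [← h2, Scheme.Hom.comp_apply])
      rw [← h1]; exact this
    · refine ⟨?_, hm⟩
      obtain ⟨μ1, h1, h2⟩ := c2 hm
      have := (hB2 ((l' ≫ B2.ι) (cp R))).mp (by
        rw [Scheme.Hom.comp_apply]; exact (l' _).2) (μ1 (cp R))
        (by rw [← h2, Scheme.Hom.comp_apply])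
      rw [← h1]; exact this
  obtain ⟨μ1, h1, h1'⟩ := c1 key.1
  obtain ⟨μ2, h2, h2'⟩ := c2 key.2
  exact ag _ l l' μ1 μ2 (h1.trans h2.symm) h1' h2'

lemma spec_field_fac {Y V : Scheme.{u}} (i : V ⟶ Y) [IsOpenImmersion i] {K : Type u} [Field K]
    (l : Spec (.of K) ⟶ Y) (h : l (cp K) ∈ Set.range i) :
    ∃ m, m ≫ i = l := val_fac i l h

lemma GD.uniq_same (D : GD p y1 y2 j1 j2 i1 i2 z) {R K : Type u} [CommRing R] [IsDomain R]
    [ValuationRing R] [Field K] [Algebra R K] [IsFractionRing R K]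
    (l : Spec (.of R) ⟶ B1.toScheme) (l' : Spec (.of R) ⟶ B1.toScheme)
    (h : l ≫ i1 ≫ z = l' ≫ i1 ≫ z)
    (h2 : Spec.map (CommRingCat.ofHom (algebraMap R K)) ≫ l ≫ i1 =
      Spec.map (CommRingCat.ofHom (algebraMap R K)) ≫ l' ≫ i1) : l ≫ i1 = l' ≫ i1 := by
  have := D.py1
  have := D.oi1
  have : l = l' := by
    refine val_uniq (B1.ι ≫ y1) (R := R) (K := K) l l' ?_ ?_
    · rw [← D.hi1]; exact h
    · rw [← cancel_mono i1]; simpa using h2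
  rw [this]

lemma GD.proper (D : GD p y1 y2 j1 j2 i1 i2 z) [IsLocallyNoetherian S] [CompactSpace S] :
    IsProper z := by
  obtain ⟨pp, py1, py2, oj1, oj2, oi1, oi2, hj1, hj2, hO, hB1, hB2, hi1, hi2, cov, ag, ov⟩ := id D
  have hn1 : IsLocallyNoetherian Y1 := LocallyOfFiniteType.isLocallyNoetherian y1
  have hn2 : IsLocallyNoetherian Y2 := LocallyOfFiniteType.isLocallyNoetherian y2
  have : CompactSpace Y1 := QuasiCompact.compactSpace_of_compactSpace y1
  have : CompactSpace Y2 := QuasiCompact.compactSpace_of_compactSpace y2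
  have : IsNoetherian Y1 := {}
  have : IsNoetherian Y2 := {}
  have hl : LocallyOfFiniteType z := by
    let 𝒰 : Z.OpenCover := Z.openCoverOfIsOpenCover
      (fun b : Bool => if b then i1.opensRange else i2.opensRange) (by
        rw [TopologicalSpace.IsOpenCover, eq_top_iff]
        intro t _
        rw [TopologicalSpace.Opens.mem_iSup]
        rcases cov t with h | h
        · exact ⟨true, h⟩
        · exact ⟨false, h⟩)
    have : IsZariskiLocalAtSource @LocallyOfFiniteType.{u} :=
      HasRingHomProperty.instIsZariskiLocalAtSource (Q := RingHom.FiniteType)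
    rw [IsZariskiLocalAtSource.iff_of_openCover (P := @LocallyOfFiniteType.{u}) 𝒰]
    rintro (_ | _)
    · change LocallyOfFiniteType (i2.opensRange.ι ≫ z)
      have : (i2.isoOpensRange).inv ≫ i2 = i2.opensRange.ι := by simp
      rw [← this, Category.assoc, hi2]
      infer_instance
    · change LocallyOfFiniteType (i1.opensRange.ι ≫ z)
      have : (i1.isoOpensRange).inv ≫ i1 = i1.opensRange.ι := by simp
      rw [← this, Category.assoc, hi1]
      infer_instance
  have hZn : IsLocallyNoetherian Z := LocallyOfFiniteType.isLocallyNoetherian z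
  have : CompactSpace B1 := isCompact_iff_compactSpace.mp
    (TopologicalSpace.NoetherianSpace.isCompact (B1 : Set Y1))
  have : CompactSpace B2 := isCompact_iff_compactSpace.mp
    (TopologicalSpace.NoetherianSpace.isCompact (B2 : Set Y2))
  have : CompactSpace Z := by
    constructor
    have : (Set.univ : Set Z) = Set.range i1 ∪ Set.range i2 := by
      ext t; simpa using cov t
    rw [this]
    exact (isCompact_range i1.continuous).union (isCompact_range i2.continuous)
  have : IsNoetherian Z := {}
  have : QuasiCompact z := inferInstance
  have : QuasiSeparated z := inferInstance
  refine IsProper.of_valuativeCriterion z (ValuativeCriterion.iff.mpr ⟨?_, ?_⟩)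
  · rintro ⟨R, K, a, s, ⟨h⟩⟩
    suffices ∃ l : Spec (.of R) ⟶ Z, Spec.map (CommRingCat.ofHom (algebraMap R K)) ≫ l = a ∧
      l ≫ z = s by
      obtain ⟨l, h1, h2⟩ := this
      exact ⟨⟨⟨l, h1, h2⟩⟩⟩
    rcases cov (a (cp K)) with hc | hc
    · obtain ⟨m, rfl⟩ := spec_field_fac i1 a hc
      exact D.exist m s (by rw [← h, Category.assoc, hi1])
    · obtain ⟨m, rfl⟩ := spec_field_fac i2 a hc
      exact D.symm.exist m s (by rw [← h, Category.assoc, hi2])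
  · rintro ⟨R, K, a, s, ⟨h⟩⟩
    refine ⟨?_⟩
    rintro ⟨l, h1, h2⟩ ⟨l', h1', h2'⟩
    dsimp at l l' h1 h2 h1' h2'
    have : l = l' := by
      rcases cov (l (cp R)) with hc | hc <;>
      rcases cov (l' (cp R)) with hc' | hc' <;>
      · obtain ⟨m, rfl⟩ := val_fac _ l hc
        obtain ⟨m', rfl⟩ := val_fac _ l' hc'
        simp only [Category.assoc] at h2 h2'
        first
        | exact D.uniq_same m m' (h2.trans h2'.symm) (h1.trans h1'.symm)
        | exact D.uniq m m' (h2.trans h2'.symm) (h1.trans h1'.symm)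
        | exact D.symm.uniq m m' (h2.trans h2'.symm) (h1.trans h1'.symm)
        | exact D.symm.uniq_same m m' (h2.trans h2'.symm) (h1.trans h1'.symm)
    subst this
    rfl

end Nag
end

section
open Limits
namespace Nag

variable {S P Y1 Y2 : Scheme.{u}}

lemma closed_img (p : P ⟶ S) [IsProper p] (y : Y1 ⟶ S) [IsSeparated y] (O : P.Opens)
    (j : O.toScheme ⟶ Y1) (hj : j ≫ y = O.ι ≫ p) (N : Set P) (hN : IsClosed N)
    (hNO : N ⊆ O) : IsClosed (j '' {o : O | o.1 ∈ N}) := by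
  let I := Scheme.IdealSheafData.vanishingIdeal (⟨N, hN⟩ : TopologicalSpace.Closeds P)
  have hI : Set.range I.subschemeι = N := by
    rw [Scheme.IdealSheafData.range_subschemeι, Scheme.IdealSheafData.coe_support_vanishingIdeal]
    rfl
  have hr : Set.range I.subschemeι ⊆ Set.range O.ι := by
    rw [Scheme.Opens.range_ι, hI]; exact hNO
  let m := IsOpenImmersion.lift O.ι I.subschemeι hr
  have hm : m ≫ O.ι = I.subschemeι := IsOpenImmersion.lift_fac _ _ _
  have e : (m ≫ j) ≫ y = I.subschemeι ≫ p := by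
    rw [Category.assoc, hj, reassoc_of% hm]
  have : IsProper ((m ≫ j) ≫ y) := by rw [e]; infer_instance
  have : IsProper (m ≫ j) := IsProper.of_comp _ y
  have hc : IsClosed (Set.range (m ≫ j)) := (m ≫ j).isClosedMap.isClosed_range
  convert hc
  ext x
  constructor
  · rintro ⟨o, ho, rfl⟩
    have ho' : o.1 ∈ N := ho
    rw [← hI] at ho'
    obtain ⟨t, ht⟩ := ho'
    refine ⟨t, ?_⟩
    rw [Scheme.Hom.comp_apply]
    congr 1
    apply O.ι.isOpenEmbedding.injective
    rw [← Scheme.Hom.comp_apply, hm, ht]; rfl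
  · rintro ⟨t, rfl⟩
    rw [Scheme.Hom.comp_apply]
    refine ⟨m t, ?_, rfl⟩
    have : O.ι (m t) ∈ N := by
      rw [← Scheme.Hom.comp_apply, hm, ← hI]; exact ⟨t, rfl⟩
    exact this

lemma exists_GD (p : P ⟶ S) [IsProper p] (y1 : Y1 ⟶ S) [IsProper y1] (y2 : Y2 ⟶ S) [IsProper y2]
    {O1 O2 : P.Opens} (hO : ∀ x : P, x ∈ O1 ∨ x ∈ O2) (j1 : O1.toScheme ⟶ Y1)
    (j2 : O2.toScheme ⟶ Y2)
    [IsOpenImmersion j1] [IsOpenImmersion j2] (hj1 : j1 ≫ y1 = O1.ι ≫ p)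
    (hj2 : j2 ≫ y2 = O2.ι ≫ p) : ∃ (Z : Scheme.{u}) (z : Z ⟶ S) (B1 : Y1.Opens) (B2 : Y2.Opens)
      (i1 : B1.toScheme ⟶ Z) (i2 : B2.toScheme ⟶ Z), GD p y1 y2 j1 j2 i1 i2 z := by
  let B1 : Y1.Opens := ⟨(j1 '' {o : O1 | o.1 ∈ (O2 : Set P)ᶜ})ᶜ,
    (closed_img p y1 O1 j1 hj1 (O2 : Set P)ᶜ O2.isOpen.isClosed_compl
      (fun x hx => (hO x).resolve_right hx)).isOpen_compl⟩
  let B2 : Y2.Opens := ⟨(j2 '' {o : O2 | o.1 ∈ (O1 : Set P)ᶜ})ᶜ,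
    (closed_img p y2 O2 j2 hj2 (O1 : Set P)ᶜ O1.isOpen.isClosed_compl
      (fun x hx => (hO x).resolve_left hx)).isOpen_compl⟩
  have hB1 : ∀ x : Y1, x ∈ B1 ↔ ∀ o : O1, j1 o = x → o.1 ∈ O2 := by
    intro x
    change ¬ (∃ _, _ ∧ _) ↔ _
    push Not
    refine forall_congr' fun o => ⟨fun h e => ?_, fun h h2 e => h2 (h e)⟩
    by_contra hc
    exact h hc e
  have hB2 : ∀ x : Y2, x ∈ B2 ↔ ∀ o : O2, j2 o = x → o.1 ∈ O1 := by
    intro x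
    change ¬ (∃ _, _ ∧ _) ↔ _
    push Not
    refine forall_congr' fun o => ⟨fun h e => ?_, fun h h2 e => h2 (h e)⟩
    by_contra hc
    exact h hc e
  let Q : Scheme.{u} := (O1 ⊓ O2).toScheme
  let q1 : Q ⟶ O1.toScheme := P.homOfLE inf_le_left
  let q2 : Q ⟶ O2.toScheme := P.homOfLE inf_le_right
  have hq1 : q1 ≫ O1.ι = (O1 ⊓ O2).ι := by simp [q1]
  have hq2 : q2 ≫ O2.ι = (O1 ⊓ O2).ι := by simp [q2]
  have oq1 : IsOpenImmersion q1 := by dsimp only [q1]; infer_instance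
  have oq2 : IsOpenImmersion q2 := by dsimp only [q2]; infer_instance
  have hr1 : Set.range (q1 ≫ j1) ⊆ Set.range B1.ι := by
    rw [Scheme.Opens.range_ι]
    rintro _ ⟨q, rfl⟩
    refine (hB1 _).mpr ?_
    intro o ho
    rw [Scheme.Hom.comp_apply] at ho
    rw [j1.isOpenEmbedding.injective ho]
    have : O1.ι (q1 q) = q.1 := by rw [← Scheme.Hom.comp_apply, hq1]; rfl
    change O1.ι (q1 q) ∈ O2
    rw [this]; exact q.2.2
  have hr2 : Set.range (q2 ≫ j2) ⊆ Set.range B2.ι := by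
    rw [Scheme.Opens.range_ι]
    rintro _ ⟨q, rfl⟩
    refine (hB2 _).mpr ?_
    intro o ho
    rw [Scheme.Hom.comp_apply] at ho
    rw [j2.isOpenEmbedding.injective ho]
    have : O2.ι (q2 q) = q.1 := by rw [← Scheme.Hom.comp_apply, hq2]; rfl
    change O2.ι (q2 q) ∈ O1
    rw [this]; exact q.2.1
  let g1 : Q ⟶ B1.toScheme := IsOpenImmersion.lift B1.ι (q1 ≫ j1) hr1
  let g2 : Q ⟶ B2.toScheme := IsOpenImmersion.lift B2.ι (q2 ≫ j2) hr2
  have hg1 : g1 ≫ B1.ι = q1 ≫ j1 := IsOpenImmersion.lift_fac _ _ _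
  have hg2 : g2 ≫ B2.ι = q2 ≫ j2 := IsOpenImmersion.lift_fac _ _ _
  have og1 : IsOpenImmersion g1 := by
    have : IsOpenImmersion (g1 ≫ B1.ι) := by rw [hg1]; infer_instance
    exact IsOpenImmersion.of_comp _ B1.ι
  have og2 : IsOpenImmersion g2 := by
    have : IsOpenImmersion (g2 ≫ B2.ι) := by rw [hg2]; infer_instance
    exact IsOpenImmersion.of_comp _ B2.ι
  obtain ⟨Z, i1, i2, oi1, oi2, hg, cov, ov, desc⟩ := glue2 g1 g2
  obtain ⟨z, hz1, hz2⟩ := desc S (B1.ι ≫ y1) (B2.ι ≫ y2) (by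
    rw [reassoc_of% hg1, reassoc_of% hg2, hj1, hj2, reassoc_of% hq1, reassoc_of% hq2])
  refine ⟨Z, z, B1, B2, i1, i2, ⟨inferInstance, inferInstance, inferInstance, inferInstance,
    inferInstance, oi1, oi2, hj1, hj2, hO, hB1, hB2, hz1, hz2, cov, ?_, ?_⟩⟩
  · intro T a b s1 s2 h h1 h2
    have hr : Set.range (s1 ≫ O1.ι) ⊆ Set.range (O1 ⊓ O2).ι := by
      rw [Scheme.Opens.range_ι]
      rintro _ ⟨t, rfl⟩
      refine ⟨?_, ?_⟩
      · rw [Scheme.Hom.comp_apply]; exact (s1 t).2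
      · rw [h, Scheme.Hom.comp_apply]; exact (s2 t).2
    obtain ⟨σ, hσ⟩ : ∃ σ : T ⟶ Q, σ ≫ (O1 ⊓ O2).ι = s1 ≫ O1.ι :=
      ⟨_, IsOpenImmersion.lift_fac _ _ hr⟩
    have e1 : σ ≫ q1 = s1 := by rw [← cancel_mono O1.ι, Category.assoc, hq1, hσ]
    have e2 : σ ≫ q2 = s2 := by rw [← cancel_mono O2.ι, Category.assoc, hq2, hσ, h]
    have f1 : a = σ ≫ g1 := by
      rw [← cancel_mono B1.ι, Category.assoc, hg1, reassoc_of% e1, h1]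
    have f2 : b = σ ≫ g2 := by
      rw [← cancel_mono B2.ι, Category.assoc, hg2, reassoc_of% e2, h2]
    rw [f1, f2, Category.assoc, Category.assoc, hg]
  · intro T a b h
    have hr : Set.range a ⊆ Set.range g1 := by
      rintro _ ⟨t, rfl⟩
      obtain ⟨q, hq, -⟩ := ov (a t) (b t) (by
        rw [← Scheme.Hom.comp_apply, ← Scheme.Hom.comp_apply, h])
      exact ⟨q, hq⟩
    obtain ⟨σ, hσ⟩ : ∃ σ : T ⟶ Q, σ ≫ g1 = a := ⟨_, IsOpenImmersion.lift_fac _ _ hr⟩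
    have hb : σ ≫ g2 = b := by
      rw [← cancel_mono i2, Category.assoc, ← hg, reassoc_of% hσ, h]
    refine ⟨σ ≫ q1, σ ≫ q2, ?_, ?_, ?_⟩
    · rw [Category.assoc, Category.assoc, hq1, hq2]
    · rw [Category.assoc, ← hg1, reassoc_of% hσ]
    · rw [Category.assoc, ← hg2, reassoc_of% hb]

end Nag
end

section
open Limits
namespace Nag

lemma glue_hom2 {X Z : Scheme.{u}} (U1 U2 : X.Opens) (hU : U1 ⊔ U2 = ⊤) (f1 : U1.toScheme ⟶ Z)
    (f2 : U2.toScheme ⟶ Z)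
    (h : X.homOfLE (inf_le_left : U1 ⊓ U2 ≤ U1) ≫ f1 = X.homOfLE (inf_le_right) ≫ f2) :
    ∃ f : X ⟶ Z, U1.ι ≫ f = f1 ∧ U2.ι ≫ f = f2 := by
  have key : ∀ {T : Scheme.{u}} (a : T ⟶ U1.toScheme) (b : T ⟶ U2.toScheme),
      a ≫ U1.ι = b ≫ U2.ι → a ≫ f1 = b ≫ f2 := by
    intro T a b hab
    have hr : Set.range (a ≫ U1.ι) ⊆ Set.range (U1 ⊓ U2).ι := by
      rw [Scheme.Opens.range_ι]
      rintro _ ⟨t, rfl⟩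
      refine ⟨?_, ?_⟩
      · rw [Scheme.Hom.comp_apply]; exact (a t).2
      · rw [hab, Scheme.Hom.comp_apply]; exact (b t).2
    obtain ⟨σ, hσ⟩ : ∃ σ : T ⟶ (U1 ⊓ U2).toScheme, σ ≫ (U1 ⊓ U2).ι = a ≫ U1.ι :=
      ⟨_, IsOpenImmersion.lift_fac _ _ hr⟩
    have e1 : σ ≫ X.homOfLE inf_le_left = a := by
      rw [← cancel_mono U1.ι, Category.assoc, Scheme.homOfLE_ι, hσ]
    have e2 : σ ≫ X.homOfLE inf_le_right = b := by
      rw [← cancel_mono U2.ι, Category.assoc, Scheme.homOfLE_ι, hσ, hab]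
    rw [← e1, ← e2, Category.assoc, h, Category.assoc]
  have hV : TopologicalSpace.IsOpenCover (fun b : Bool => cond b U1 U2) := by
    rw [TopologicalSpace.IsOpenCover, iSup_bool_eq]; exact hU
  let 𝒰 : X.OpenCover := X.openCoverOfIsOpenCover _ hV
  let F : ∀ b : 𝒰.I₀, 𝒰.X b ⟶ Z := fun b => match b with
    | true => f1
    | false => f2
  have hF : ∀ x y, pullback.fst (𝒰.f x) (𝒰.f y) ≫ F x = pullback.snd (𝒰.f x) (𝒰.f y) ≫ F y := by
    rintro (_ | _) (_ | _)
    · have : pullback.fst (𝒰.f false) (𝒰.f false) = pullback.snd (𝒰.f false) (𝒰.f false) := by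
        have : Mono (𝒰.f false) := inferInstanceAs (Mono U2.ι)
        rw [← cancel_mono (𝒰.f false)]; exact pullback.condition
      rw [this]
    · exact (key _ _ pullback.condition.symm).symm
    · exact key _ _ pullback.condition
    · have : pullback.fst (𝒰.f true) (𝒰.f true) = pullback.snd (𝒰.f true) (𝒰.f true) := by
        have : Mono (𝒰.f true) := inferInstanceAs (Mono U1.ι)
        rw [← cancel_mono (𝒰.f true)]; exact pullback.condition
      rw [this]
  exact ⟨Scheme.Cover.glueMorphisms 𝒰 F hF, Scheme.Cover.ι_glueMorphisms 𝒰 F hF true,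
    Scheme.Cover.ι_glueMorphisms 𝒰 F hF false⟩

variable {S P Y1 Y2 : Scheme.{u}}

lemma surgery [IsLocallyNoetherian S] [CompactSpace S]
    (p : P ⟶ S) [IsProper p] (y1 : Y1 ⟶ S) [IsProper y1] (y2 : Y2 ⟶ S) [IsProper y2]
    {O1 O2 : P.Opens} (hO : ∀ x : P, x ∈ O1 ∨ x ∈ O2) (j1 : O1.toScheme ⟶ Y1)
    (j2 : O2.toScheme ⟶ Y2)
    [IsOpenImmersion j1] [IsOpenImmersion j2] (hj1 : j1 ≫ y1 = O1.ι ≫ p)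
    (hj2 : j2 ≫ y2 = O2.ι ≫ p)
    {X : Scheme.{u}} (s : X ⟶ S) (U1 U2 : X.Opens) (hU : U1 ⊔ U2 = ⊤)
    (e1 : U1.toScheme ⟶ Y1) (e2 : U2.toScheme ⟶ Y2) [IsOpenImmersion e1] [IsOpenImmersion e2]
    (he1 : e1 ≫ y1 = U1.ι ≫ s) (he2 : e2 ≫ y2 = U2.ι ≫ s)
    (c1 : (U1 ⊓ U2).toScheme ⟶ O1.toScheme) (c2 : (U1 ⊓ U2).toScheme ⟶ O2.toScheme)
    (hc : c1 ≫ O1.ι = c2 ≫ O2.ι)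
    (hc1 : c1 ≫ j1 = X.homOfLE inf_le_left ≫ e1)
    (hc2 : c2 ≫ j2 = X.homOfLE inf_le_right ≫ e2)
    (h1 : ∀ (x : U1.toScheme) (o : O1.toScheme), e1 x = j1 o → x.1 ∈ U2)
    (h2 : ∀ (x : U2.toScheme) (o : O2.toScheme), e2 x = j2 o → x.1 ∈ U1) :
    ∃ (Z : Scheme.{u}) (z : Z ⟶ S) (i : X ⟶ Z), IsProper z ∧ IsOpenImmersion i ∧ i ≫ z = s := by
  obtain ⟨Z, z, B1, B2, i1, i2, D⟩ := exists_GD p y1 y2 hO j1 j2 hj1 hj2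
  have oi1 := D.oi1
  have oi2 := D.oi2
  have hr1 : Set.range e1 ⊆ Set.range B1.ι := by
    rw [Scheme.Opens.range_ι]
    rintro _ ⟨x, rfl⟩
    refine (D.hB1 _).mpr fun o ho => ?_
    have hx : x.1 ∈ U2 := h1 x o ho.symm
    obtain ⟨w, hw0⟩ : ∃ w : (U1 ⊓ U2).toScheme, (U1 ⊓ U2).ι w = x.1 := ⟨⟨x.1, x.2, hx⟩, rfl⟩
    have hw : X.homOfLE (inf_le_left : U1 ⊓ U2 ≤ U1) w = x := by
      apply U1.ι.isOpenEmbedding.injective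
      rw [← Scheme.Hom.comp_apply, Scheme.homOfLE_ι, hw0]; rfl
    have : c1 w = o := by
      apply j1.isOpenEmbedding.injective
      rw [← Scheme.Hom.comp_apply, hc1, Scheme.Hom.comp_apply, hw, ho]
    rw [← this]
    change O1.ι (c1 w) ∈ O2
    rw [← Scheme.Hom.comp_apply, hc, Scheme.Hom.comp_apply]
    exact (c2 w).2
  have hr2 : Set.range e2 ⊆ Set.range B2.ι := by
    rw [Scheme.Opens.range_ι]
    rintro _ ⟨x, rfl⟩
    refine (D.hB2 _).mpr fun o ho => ?_
    have hx : x.1 ∈ U1 := h2 x o ho.symm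
    obtain ⟨w, hw0⟩ : ∃ w : (U1 ⊓ U2).toScheme, (U1 ⊓ U2).ι w = x.1 := ⟨⟨x.1, hx, x.2⟩, rfl⟩
    have hw : X.homOfLE (inf_le_right : U1 ⊓ U2 ≤ U2) w = x := by
      apply U2.ι.isOpenEmbedding.injective
      rw [← Scheme.Hom.comp_apply, Scheme.homOfLE_ι, hw0]; rfl
    have : c2 w = o := by
      apply j2.isOpenEmbedding.injective
      rw [← Scheme.Hom.comp_apply, hc2, Scheme.Hom.comp_apply, hw, ho]
    rw [← this]
    change O2.ι (c2 w) ∈ O1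
    rw [← Scheme.Hom.comp_apply, ← hc, Scheme.Hom.comp_apply]
    exact (c1 w).2
  obtain ⟨d1, hd1⟩ : ∃ d1, d1 ≫ B1.ι = e1 := ⟨_, IsOpenImmersion.lift_fac _ _ hr1⟩
  obtain ⟨d2, hd2⟩ : ∃ d2, d2 ≫ B2.ι = e2 := ⟨_, IsOpenImmersion.lift_fac _ _ hr2⟩
  have od1 : IsOpenImmersion d1 := by
    have : IsOpenImmersion (d1 ≫ B1.ι) := by rw [hd1]; infer_instance
    exact IsOpenImmersion.of_comp _ B1.ι
  have od2 : IsOpenImmersion d2 := by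
    have : IsOpenImmersion (d2 ≫ B2.ι) := by rw [hd2]; infer_instance
    exact IsOpenImmersion.of_comp _ B2.ι
  obtain ⟨f, hf1, hf2⟩ := glue_hom2 U1 U2 hU (d1 ≫ i1) (d2 ≫ i2) (by
    rw [← Category.assoc, ← Category.assoc]
    exact D.ag _ _ _ c1 c2 hc (by rw [hc1, Category.assoc, hd1])
      (by rw [hc2, Category.assoc, hd2]))
  have hcov : ∀ x : X, x ∈ U1 ∨ x ∈ U2 := fun x => by
    have : x ∈ U1 ⊔ U2 := by rw [hU]; trivial
    exact this
  have hV : TopologicalSpace.IsOpenCover (fun b : Bool => cond b U1 U2) := by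
    rw [TopologicalSpace.IsOpenCover, iSup_bool_eq]; exact hU
  let 𝒰 : X.OpenCover := X.openCoverOfIsOpenCover _ hV
  have inj1 : ∀ x y : X, x ∈ U1 → y ∈ U1 → f x = f y → x = y := by
    intro x y hx hy h
    obtain ⟨x, rfl⟩ : ∃ x' : U1.toScheme, U1.ι x' = x := ⟨⟨x, hx⟩, rfl⟩
    obtain ⟨y, rfl⟩ : ∃ y' : U1.toScheme, U1.ι y' = y := ⟨⟨y, hy⟩, rfl⟩
    rw [← Scheme.Hom.comp_apply, ← Scheme.Hom.comp_apply, hf1] at h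
    rw [(d1 ≫ i1).isOpenEmbedding.injective h]
  have inj2 : ∀ x y : X, x ∈ U2 → y ∈ U2 → f x = f y → x = y := by
    intro x y hx hy h
    obtain ⟨x, rfl⟩ : ∃ x' : U2.toScheme, U2.ι x' = x := ⟨⟨x, hx⟩, rfl⟩
    obtain ⟨y, rfl⟩ : ∃ y' : U2.toScheme, U2.ι y' = y := ⟨⟨y, hy⟩, rfl⟩
    rw [← Scheme.Hom.comp_apply, ← Scheme.Hom.comp_apply, hf2] at h
    rw [(d2 ≫ i2).isOpenEmbedding.injective h]
  have inj12 : ∀ x y : X, x ∈ U1 → y ∈ U2 → f x = f y → x = y := by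
    intro x y hx hy h
    refine inj2 x y ?_ hy h
    obtain ⟨x, rfl⟩ : ∃ x' : U1.toScheme, U1.ι x' = x := ⟨⟨x, hx⟩, rfl⟩
    obtain ⟨y, rfl⟩ : ∃ y' : U2.toScheme, U2.ι y' = y := ⟨⟨y, hy⟩, rfl⟩
    rw [← Scheme.Hom.comp_apply, ← Scheme.Hom.comp_apply, hf1, hf2] at h
    have h' : i1 (d1 x) = i2 (d2 y) := by
      rw [← Scheme.Hom.comp_apply, ← Scheme.Hom.comp_apply, h]
    obtain ⟨t, ht1, ht2⟩ := Scheme.Pullback.exists_preimage_pullback _ _ h'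
    obtain ⟨s1, s2, -, hs1, -⟩ := D.ov _ (pullback.fst i1 i2) (pullback.snd i1 i2)
      pullback.condition
    refine h1 x (s1 t) ?_
    rw [← Scheme.Hom.comp_apply, hs1, Scheme.Hom.comp_apply, ht1, ← Scheme.Hom.comp_apply, hd1]
  refine ⟨Z, z, f, D.proper, ?_, ?_⟩
  · refine IsOpenImmersion.of_openCover_source f 𝒰 ?_ ?_
    · intro x y h
      rcases hcov x with hx | hx <;> rcases hcov y with hy | hy
      · exact inj1 x y hx hy h
      · exact inj12 x y hx hy h
      · exact (inj12 y x hy hx h.symm).symm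
      · exact inj2 x y hx hy h
    · rintro (_ | _)
      · change IsOpenImmersion (U2.ι ≫ f)
        rw [hf2]; infer_instance
      · change IsOpenImmersion (U1.ι ≫ f)
        rw [hf1]; infer_instance
  · apply Scheme.Cover.hom_ext 𝒰
    rintro (_ | _)
    · change U2.ι ≫ f ≫ z = U2.ι ≫ s
      rw [reassoc_of% hf2, D.hi2, reassoc_of% hd2, he2]
    · change U1.ι ≫ f ≫ z = U1.ι ≫ s
      rw [reassoc_of% hf1, D.hi1, reassoc_of% hd1, he1]

end Nag
end

section
open Limits
namespace Nag
open Scheme.IdealSheafData (comap_comp comap_id)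

lemma comap_eq_top {V Y : Scheme.{u}} (K : Y.IdealSheafData) (e : V ⟶ Y)
    (h : ∀ v, e v ∉ (K.support : Set Y)) : K.comap e = ⊤ := by
  rw [← Scheme.IdealSheafData.support_eq_bot_iff]
  ext v
  rw [Scheme.IdealSheafData.support_comap]
  exact ⟨fun hv => (h v hv).elim, fun hv => hv.elim⟩

lemma isBlowup_id (Y : Scheme.{u}) : IsBlowup (𝟙 Y) (⊤ : Y.IdealSheafData) where
  inv := by rw [comap_id]; exact inv_top
  uniq := fun S l l' _ h => by simpa using h
  lift := fun S s _ => ⟨s, Category.comp_id s⟩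

lemma lift_open {T V Y : Scheme.{u}} {b : T ⟶ Y} {K : Y.IdealSheafData} (hb : IsBlowup b K)
    (e : V ⟶ Y) [IsOpenImmersion e] (h : K.comap e = ⊤) :
    ∃ e' : V ⟶ T, e' ≫ b = e ∧ IsOpenImmersion e' ∧ ∀ t v, b t = e v → e' v = t := by
  obtain ⟨m, hm⟩ := hb.lift _ e (by rw [h]; exact inv_top)
  have hid : IsBlowup (𝟙 V) (K.comap e) := by rw [h]; exact isBlowup_id V
  have hp := IsBlowup.isPullback hb hid m (by rw [hm, Category.id_comp])
  refine ⟨m, hm, ?_, ?_⟩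
  · exact MorphismProperty.of_isPullback (P := @IsOpenImmersion) hp ‹_›
  · intro t v htv
    obtain ⟨x, hx1, hx2⟩ := Scheme.exists_preimage_of_isPullback hp v t htv.symm
    have : x = v := hx1
    rw [← this, hx2]

variable {S : Scheme.{u}}

/-- state of the two-piece compactification -/
structure St {V1 V2 U : Scheme.{u}} (t1 : V1 ⟶ S) (t2 : V2 ⟶ S) (v1 : U ⟶ V1) (v2 : U ⟶ V2) where
  P : Scheme.{u}
  Y1 : Scheme.{u}
  Y2 : Scheme.{u}
  p : P ⟶ S
  y1 : Y1 ⟶ S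
  y2 : Y2 ⟶ S
  O1 : P.Opens
  O2 : P.Opens
  r1 : O1.toScheme ⟶ Y1
  r2 : O2.toScheme ⟶ Y2
  e1 : V1 ⟶ Y1
  e2 : V2 ⟶ Y2
  c1 : U ⟶ O1.toScheme
  c2 : U ⟶ O2.toScheme
  pp : IsProper p
  py1 : IsProper y1
  py2 : IsProper y2
  oe1 : IsOpenImmersion e1
  oe2 : IsOpenImmersion e2
  oc1 : IsOpenImmersion c1
  oc2 : IsOpenImmersion c2
  hr1 : r1 ≫ y1 = O1.ι ≫ p
  hr2 : r2 ≫ y2 = O2.ι ≫ p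
  he1 : e1 ≫ y1 = t1
  he2 : e2 ≫ y2 = t2
  hO : ∀ x : P, x ∈ O1 ∨ x ∈ O2
  hc : c1 ≫ O1.ι = c2 ≫ O2.ι
  hc1 : c1 ≫ r1 = v1 ≫ e1
  hc2 : c2 ≫ r2 = v2 ≫ e2
  h1 : ∀ (x : V1) (o : O1.toScheme), e1 x = r1 o → ∃ w, c1 w = o
  h2 : ∀ (x : V2) (o : O2.toScheme), e2 x = r2 o → ∃ w, c2 w = o

variable {V1 V2 U : Scheme.{u}} {t1 : V1 ⟶ S} {t2 : V2 ⟶ S} {v1 : U ⟶ V1} {v2 : U ⟶ V2}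

/-- symmetry -/
noncomputable def St.symm (D : St t1 t2 v1 v2) : St t2 t1 v2 v1 where
  P := D.P
  Y1 := D.Y2
  Y2 := D.Y1
  p := D.p
  y1 := D.y2
  y2 := D.y1
  O1 := D.O2
  O2 := D.O1
  r1 := D.r2
  r2 := D.r1
  e1 := D.e2
  e2 := D.e1
  c1 := D.c2
  c2 := D.c1
  pp := D.pp
  py1 := D.py2
  py2 := D.py1
  oe1 := D.oe2
  oe2 := D.oe1
  oc1 := D.oc2
  oc2 := D.oc1
  hr1 := D.hr2
  hr2 := D.hr1
  he1 := D.he2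
  he2 := D.he1
  hO := fun x => (D.hO x).symm
  hc := D.hc.symm
  hc1 := D.hc2
  hc2 := D.hc1
  h1 := D.h2
  h2 := D.h1

lemma side2 {P P' Y2 : Scheme.{u}} [IsLocallyNoetherian Y2] [IsLocallyNoetherian P]
    {O2 : P.Opens} {r2 : O2.toScheme ⟶ Y2}
    {e2 : V2 ⟶ Y2} {c2 : U ⟶ O2.toScheme} (oe2 : IsOpenImmersion e2)
    (hc2 : c2 ≫ r2 = v2 ≫ e2) (h2 : ∀ (x : V2) (o : O2.toScheme), e2 x = r2 o → ∃ w, c2 w = o)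
    (K : P.IdealSheafData) (hK : K.comap (c2 ≫ O2.ι) = ⊤) {β : P' ⟶ P} (hβ : IsBlowup β K)
    (c2' : U ⟶ (β ⁻¹ᵁ O2).toScheme) (hc2' : c2' ≫ (β ∣_ O2) = c2) :
    ∃ (Y2' : Scheme.{u}) (b : Y2' ⟶ Y2) (e2' : V2 ⟶ Y2') (r2' : (β ⁻¹ᵁ O2).toScheme ⟶ Y2'),
      IsProper b ∧ IsOpenImmersion e2' ∧ e2' ≫ b = e2 ∧ r2' ≫ b = (β ∣_ O2) ≫ r2 ∧
      c2' ≫ r2' = v2 ≫ e2' ∧ (IsOpenImmersion r2 → IsOpenImmersion r2') := by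
  by_cases hop : IsOpenImmersion r2
  · let K' : Y2.IdealSheafData := (K.comap O2.ι).map r2
    have hK' : K'.comap r2 = K.comap O2.ι := comap_map_open r2 _
    obtain ⟨Y2', b, pb, hb⟩ := exists_blowup K'
    have hn : ∀ v, e2 v ∉ (K'.support : Set Y2) := by
      intro v hv
      have hsub : (K'.support : Set Y2) ⊆ (Set.range e2)ᶜ := by
        have h0 : (K'.support : Set Y2) = closure (r2 '' (K.comap O2.ι).support) := by
          rw [Scheme.IdealSheafData.support_map]; rfl
        rw [h0]
        refine closure_minimal ?_ e2.isOpenEmbedding.isOpen_range.isClosed_compl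
        rintro _ ⟨o, ho, rfl⟩ ⟨x, hx⟩
        obtain ⟨w, rfl⟩ := h2 x o hx
        have h3 : w ∈ ((K.comap O2.ι).comap c2).support := by
          rw [Scheme.IdealSheafData.support_comap]; exact ho
        rw [← comap_comp, hK, Scheme.IdealSheafData.support_top] at h3
        exact h3.elim
      exact hsub hv ⟨v, rfl⟩
    have hKe := comap_eq_top K' e2 hn
    obtain ⟨e2', he, oe, -⟩ := lift_open hb e2 hKe
    have hbl : IsBlowup (β ∣_ O2) (K'.comap r2) := by
      rw [hK']; exact hβ.restrict (isPullback_morphismRestrict β O2)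
    obtain ⟨r2', hr⟩ := hb.lift _ ((β ∣_ O2) ≫ r2) (by rw [comap_comp]; exact hbl.inv)
    refine ⟨Y2', b, e2', r2', pb, oe, he, hr, ?_, fun _ => ?_⟩
    · have e0 : (c2' ≫ r2') ≫ b = (v2 ≫ e2') ≫ b := by
        rw [Category.assoc, Category.assoc, hr, reassoc_of% hc2', he, hc2]
      refine hb.uniq _ _ _ ?_ e0
      have : K'.comap ((c2' ≫ r2') ≫ b) = ⊤ := by
        rw [e0, Category.assoc, he, comap_comp, hKe, Scheme.IdealSheafData.comap_top]
      rw [this]; exact inv_top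
    · have hp := IsBlowup.isPullback hb hbl r2' hr
      exact MorphismProperty.of_isPullback (P := @IsOpenImmersion) hp hop
  · refine ⟨Y2, 𝟙 _, e2, (β ∣_ O2) ≫ r2, inferInstance, oe2, Category.comp_id _,
      Category.comp_id _, ?_, fun h => (hop h).elim⟩
    rw [reassoc_of% hc2', hc2]

end Nag
end

section
open Limits
namespace Nag
open Scheme.IdealSheafData (comap_comp comap_id)
variable {S : Scheme.{u}}
variable {V1 V2 U : Scheme.{u}} {t1 : V1 ⟶ S} {t2 : V2 ⟶ S} {v1 : U ⟶ V1} {v2 : U ⟶ V2}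

lemma open_over {W Y : Scheme.{u}} (r : W ⟶ Y) (e : V1 ⟶ Y) [IsOpenImmersion e]
    [IsOpenImmersion v1]
    (c : U ⟶ W) [IsOpenImmersion c] (hc : c ≫ r = v1 ≫ e)
    (h : ∀ (x : V1) (o : W), e x = r o → ∃ w, c w = o) :
    IsOpenImmersion ((r ⁻¹ᵁ e.opensRange).ι ≫ r) := by
  have hr : Set.range (r ⁻¹ᵁ e.opensRange).ι ⊆ Set.range c := by
    rw [Scheme.Opens.range_ι]
    rintro o ⟨x, hx⟩
    exact h x o hx
  obtain ⟨l, hl⟩ : ∃ l, l ≫ c = (r ⁻¹ᵁ e.opensRange).ι := ⟨_, IsOpenImmersion.lift_fac _ _ hr⟩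
  have : IsOpenImmersion l := by
    have : IsOpenImmersion (l ≫ c) := by rw [hl]; infer_instance
    exact IsOpenImmersion.of_comp _ c
  rw [← hl, Category.assoc, hc]
  infer_instance

lemma c_lift {P P' : Scheme.{u}} {O : P.Opens} (β : P' ⟶ P) (c : U ⟶ O.toScheme) (c0 : U ⟶ P')
    [IsOpenImmersion c0]
    (h : c0 ≫ β = c ≫ O.ι) : ∃ c' : U ⟶ (β ⁻¹ᵁ O).toScheme, c' ≫ (β ⁻¹ᵁ O).ι = c0 ∧
      IsOpenImmersion c' ∧ c' ≫ (β ∣_ O) = c := by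
  have hr : Set.range c0 ⊆ Set.range (β ⁻¹ᵁ O).ι := by
    rw [Scheme.Opens.range_ι]
    rintro _ ⟨x, rfl⟩
    change β (c0 x) ∈ O
    rw [← Scheme.Hom.comp_apply, h, Scheme.Hom.comp_apply]
    exact (c x).2
  obtain ⟨l, hl⟩ : ∃ l, l ≫ (β ⁻¹ᵁ O).ι = c0 := ⟨_, IsOpenImmersion.lift_fac _ _ hr⟩
  refine ⟨l, hl, ?_, ?_⟩
  · have : IsOpenImmersion (l ≫ (β ⁻¹ᵁ O).ι) := by rw [hl]; infer_instance
    exact IsOpenImmersion.of_comp _ (β ⁻¹ᵁ O).ι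
  · rw [← cancel_mono O.ι, Category.assoc, morphismRestrict_ι, reassoc_of% hl, h]

lemma cond_lift {P P' Y Y' : Scheme.{u}} {O : P.Opens} (β : P' ⟶ P) {r : O.toScheme ⟶ Y}
    {e : V1 ⟶ Y} {b : Y' ⟶ Y} {r' : (β ⁻¹ᵁ O).toScheme ⟶ Y'} {e' : V1 ⟶ Y'}
    (hr : r' ≫ b = (β ∣_ O) ≫ r) (he : e' ≫ b = e) {c : U ⟶ O.toScheme}
    {c' : U ⟶ (β ⁻¹ᵁ O).toScheme} {c0 : U ⟶ P'} (hc' : c' ≫ (β ⁻¹ᵁ O).ι = c0)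
    (h0 : ∀ t v, β t = (c ≫ O.ι) v → c0 v = t)
    (h : ∀ (x : V1) (o : O.toScheme), e x = r o → ∃ w, c w = o)
    (x : V1) (o : (β ⁻¹ᵁ O).toScheme) (hx : e' x = r' o) : ∃ w, c' w = o := by
  obtain ⟨w, hw⟩ := h x ((β ∣_ O) o) (by
    rw [← he, Scheme.Hom.comp_apply, hx, ← Scheme.Hom.comp_apply, hr, Scheme.Hom.comp_apply])
  refine ⟨w, (β ⁻¹ᵁ O).ι.isOpenEmbedding.injective ?_⟩
  rw [← Scheme.Hom.comp_apply, hc']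
  apply h0
  rw [Scheme.Hom.comp_apply, hw, ← Scheme.Hom.comp_apply, ← Scheme.Hom.comp_apply,
    morphismRestrict_ι]

lemma St.step [IsLocallyNoetherian S] [CompactSpace S] [IsOpenImmersion v1]
    (D : St t1 t2 v1 v2) : ∃ D' : St t1 t2 v1 v2,
      IsOpenImmersion D'.r1 ∧ (IsOpenImmersion D.r2 → IsOpenImmersion D'.r2) := by
  obtain ⟨P, Y1, Y2, p, y1, y2, O1, O2, r1, r2, e1, e2, c1, c2, pp, py1, py2, oe1, oe2, oc1, oc2,
    hr1, hr2, he1, he2, hO, hc, hc1, hc2, h1, h2⟩ := D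
  dsimp only
  have hn1 : IsLocallyNoetherian Y1 := LocallyOfFiniteType.isLocallyNoetherian y1
  have hn2 : IsLocallyNoetherian Y2 := LocallyOfFiniteType.isLocallyNoetherian y2
  have hnP : IsLocallyNoetherian P := LocallyOfFiniteType.isLocallyNoetherian p
  have : CompactSpace P := QuasiCompact.compactSpace_of_compactSpace p
  have : IsNoetherian P := {}
  have : CompactSpace O1 := isCompact_iff_compactSpace.mp
    (TopologicalSpace.NoetherianSpace.isCompact (O1 : Set P))
  have : LocallyOfFiniteType (r1 ≫ y1) := by rw [hr1]; infer_instance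
  have : LocallyOfFiniteType r1 := locallyOfFiniteType_of_comp r1 y1
  have : IsSeparated (r1 ≫ y1) := by rw [hr1]; infer_instance
  have : IsSeparated r1 := IsSeparated.of_comp r1 y1
  have := open_over r1 e1 c1 hc1 h1
  obtain ⟨K1, hK1, hF⟩ := lemF r1 e1.opensRange
  let K : P.IdealSheafData := (K1.comap r1).map O1.ι
  have hK : K.comap O1.ι = K1.comap r1 := comap_map_open O1.ι _
  obtain ⟨P', β, pβ, hβ⟩ := exists_blowup K
  obtain ⟨Y1', b, pb, hb⟩ := exists_blowup K1
  have hbl : IsBlowup (β ∣_ O1) (K1.comap r1) := by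
    rw [← hK]; exact hβ.restrict (isPullback_morphismRestrict β O1)
  obtain ⟨r1', hr1'⟩ := hb.lift _ ((β ∣_ O1) ≫ r1) (by rw [comap_comp]; exact hbl.inv)
  have or1 : IsOpenImmersion r1' := hF _ _ b _ r1' hb hbl hr1'
  have hKe : K1.comap e1 = ⊤ := comap_eq_top K1 e1 (by
    intro v hv
    rw [hK1] at hv
    exact hv ⟨v, rfl⟩)
  obtain ⟨e1', he1', oe1', -⟩ := lift_open hb e1 hKe
  have hKc : K.comap (c1 ≫ O1.ι) = ⊤ := by
    rw [comap_comp, hK, ← comap_comp, hc1, comap_comp, hKe, Scheme.IdealSheafData.comap_top]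
  obtain ⟨c0, hc0, oc0, hc0'⟩ := lift_open hβ (c1 ≫ O1.ι) hKc
  obtain ⟨c1', hc1a, oc1', hc1b⟩ := c_lift β c1 c0 hc0
  obtain ⟨c2', hc2a, oc2', hc2b⟩ := c_lift β c2 c0 (by rw [hc0, hc])
  obtain ⟨Y2', b2, e2', r2', pb2, oe2', he2', hr2', hc2', oo⟩ := side2 oe2 hc2 h2 K
    (by rw [← hc]; exact hKc) hβ c2' hc2b
  have hcc : c1' ≫ r1' = v1 ≫ e1' := by
    have e0 : (c1' ≫ r1') ≫ b = (v1 ≫ e1') ≫ b := by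
      rw [Category.assoc, Category.assoc, hr1', reassoc_of% hc1b, he1', hc1]
    refine hb.uniq _ _ _ ?_ e0
    have : K1.comap ((c1' ≫ r1') ≫ b) = ⊤ := by
      rw [e0, Category.assoc, he1', comap_comp, hKe, Scheme.IdealSheafData.comap_top]
    rw [this]; exact inv_top
  refine ⟨⟨P', Y1', Y2', β ≫ p, b ≫ y1, b2 ≫ y2, β ⁻¹ᵁ O1, β ⁻¹ᵁ O2, r1', r2', e1', e2', c1', c2',
    inferInstance, inferInstance, inferInstance, oe1', oe2', oc1', oc2', ?_, ?_, ?_, ?_, ?_, ?_,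
    hcc, hc2', ?_, ?_⟩, or1, oo⟩
  · rw [reassoc_of% hr1', hr1, morphismRestrict_ι_assoc]
  · rw [reassoc_of% hr2', hr2, morphismRestrict_ι_assoc]
  · rw [reassoc_of% he1', he1]
  · rw [reassoc_of% he2', he2]
  · exact fun x => hO (β x)
  · rw [hc1a, hc2a]
  · exact cond_lift β hr1' he1' hc1a hc0' h1
  · exact cond_lift β hr2' he2' hc2a (by rw [← hc]; exact hc0') h2

lemma St.final [IsLocallyNoetherian S] [CompactSpace S] [IsOpenImmersion v1] [IsOpenImmersion v2]
    (D : St t1 t2 v1 v2) : ∃ D' : St t1 t2 v1 v2, IsOpenImmersion D'.r1 ∧ IsOpenImmersion D'.r2 := by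
  obtain ⟨D1, h1, -⟩ := D.symm.step
  obtain ⟨D2, h2, h3⟩ := D1.symm.step
  exact ⟨D2, h2, h3 h1⟩

lemma St.cpt [IsLocallyNoetherian S] [CompactSpace S] {X : Scheme.{u}} (s : X ⟶ S)
    (U1 U2 : X.Opens) (hU : U1 ⊔ U2 = ⊤)
    (D : St (U1.ι ≫ s) (U2.ι ≫ s) (X.homOfLE (inf_le_left : U1 ⊓ U2 ≤ U1))
      (X.homOfLE (inf_le_right : U1 ⊓ U2 ≤ U2))) :
    ∃ (Z : Scheme.{u}) (z : Z ⟶ S) (i : X ⟶ Z), IsProper z ∧ IsOpenImmersion i ∧ i ≫ z = s := by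
  obtain ⟨⟨P, Y1, Y2, p, y1, y2, O1, O2, r1, r2, e1, e2, c1, c2, pp, py1, py2, oe1, oe2, oc1, oc2,
    hr1, hr2, he1, he2, hO, hc, hc1, hc2, h1, h2⟩, o1, o2⟩ := D.final
  dsimp only at o1 o2
  refine surgery p y1 y2 hO r1 r2 hr1 hr2 s U1 U2 hU e1 e2 he1 he2 c1 c2 hc hc1 hc2 ?_ ?_
  · intro x o h
    obtain ⟨w, rfl⟩ := h1 x o h
    rw [← Scheme.Hom.comp_apply, hc1, Scheme.Hom.comp_apply] at h
    have := e1.isOpenEmbedding.injective h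
    rw [this]
    change U1.ι _ ∈ U2
    rw [← Scheme.Hom.comp_apply, Scheme.homOfLE_ι]
    exact w.2.2
  · intro x o h
    obtain ⟨w, rfl⟩ := h2 x o h
    rw [← Scheme.Hom.comp_apply, hc2, Scheme.Hom.comp_apply] at h
    have := e2.isOpenEmbedding.injective h
    rw [this]
    change U2.ι _ ∈ U1
    rw [← Scheme.Hom.comp_apply, Scheme.homOfLE_ι]
    exact w.2.1

end Nag
end

section
open Limits
namespace Nag
open Scheme.IdealSheafData (comap_comp comap_id)

lemma split_opens {P : Scheme.{u}} (K1 K2 : P.IdealSheafData) (h : Inv (K1 ⊔ K2)) :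
    ∃ O1 O2 : P.Opens, (∀ x, x ∈ O1 ∨ x ∈ O2) ∧
      (∀ x ∈ O1, x ∈ K1.support → x ∈ K2.support) ∧
      (∀ x ∈ O2, x ∈ K2.support → x ∈ K1.support) ∧
      (∀ x, x ∉ K1.support → x ∈ O1) ∧ (∀ x, x ∉ K2.support → x ∈ O2) := by
  have hs : ∀ x, x ∈ (K1 ⊔ K2).support ↔ x ∈ K1.support ∧ x ∈ K2.support := by
    intro x
    rw [Scheme.IdealSheafData.support_sup]
    exact Iff.rfl
  have key : ∀ (K : P.IdealSheafData) (O : P.affineOpens) (g y z : Γ(P, O.1)),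
      (K1 ⊔ K2).ideal O = Ideal.span {g} → z ∈ K.ideal O → z = g * y →
      ∀ x ∈ P.basicOpen y, x ∈ K.support → x ∈ (K1 ⊔ K2).support := by
    intro K O g y z hg hz hzy x hx hxK
    have hxO : x ∈ O.1 := P.basicOpen_le y hx
    rw [Scheme.IdealSheafData.mem_support_iff_of_mem hxO] at hxK ⊢
    rw [hg]
    rw [Scheme.mem_zeroLocus_iff] at hxK ⊢
    have h1 := hxK z hz
    rw [hzy, Scheme.basicOpen_mul] at h1
    have h2 : x ∉ P.basicOpen g := fun h => h1 ⟨h, hx⟩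
    intro f hf
    obtain ⟨a, rfl⟩ := Ideal.mem_span_singleton'.mp hf
    rw [Scheme.basicOpen_mul]
    exact fun h => h2 h.2
  refine ⟨sSup {V | ∀ x ∈ V, x ∈ K1.support → x ∈ K2.support},
    sSup {V | ∀ x ∈ V, x ∈ K2.support → x ∈ K1.support}, ?_, ?_, ?_, ?_, ?_⟩
  · intro t
    obtain ⟨O, ht, g, hg, hO⟩ := h t
    have hgm : g ∈ (K1 ⊔ K2).ideal O := by rw [hO]; exact Ideal.mem_span_singleton_self g
    have hO' := hO
    rw [Scheme.IdealSheafData.ideal_sup] at hgm hO'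
    obtain ⟨x1, hx1, x2, hx2, hx⟩ := Submodule.mem_sup.mp hgm
    obtain ⟨y1, hy1⟩ := Ideal.mem_span_singleton.mp
      (hO' ▸ Ideal.mem_sup_left hx1 : x1 ∈ Ideal.span {g})
    obtain ⟨y2, hy2⟩ := Ideal.mem_span_singleton.mp
      (hO' ▸ Ideal.mem_sup_right hx2 : x2 ∈ Ideal.span {g})
    have hy : y1 + y2 = 1 := by
      rw [mem_nonZeroDivisors_iff_right] at hg
      have := hg (y1 + y2 - 1) (by rw [hy1, hy2] at hx; linear_combination hx)
      linear_combination this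
    have hc : t ∈ P.basicOpen y1 ∨ t ∈ P.basicOpen y2 := by
      have hu : IsUnit (P.presheaf.germ O.1 t ht y1 + P.presheaf.germ O.1 t ht y2) := by
        rw [← map_add, hy, map_one]; exact isUnit_one
      rcases IsLocalRing.isUnit_or_isUnit_of_isUnit_add hu with h | h
      · exact Or.inl ((P.mem_basicOpen _ t ht).mpr h)
      · exact Or.inr ((P.mem_basicOpen _ t ht).mpr h)
    rcases hc with hc | hc
    · left
      refine TopologicalSpace.Opens.mem_sSup.mpr ⟨P.basicOpen y1, ?_, hc⟩
      exact fun x hx hx' => ((hs x).mp (key K1 O g y1 x1 hO hx1 hy1 x hx hx')).2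
    · right
      refine TopologicalSpace.Opens.mem_sSup.mpr ⟨P.basicOpen y2, ?_, hc⟩
      exact fun x hx hx' => ((hs x).mp (key K2 O g y2 x2 hO hx2 hy2 x hx hx')).1
  · intro x hx
    obtain ⟨V, hV, hxV⟩ := TopologicalSpace.Opens.mem_sSup.mp hx
    exact hV x hxV
  · intro x hx
    obtain ⟨V, hV, hxV⟩ := TopologicalSpace.Opens.mem_sSup.mp hx
    exact hV x hxV
  · intro x hx
    exact TopologicalSpace.Opens.mem_sSup.mpr
      ⟨K1.support.compl, fun y hy hy' => (hy hy').elim, hx⟩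
  · intro x hx
    exact TopologicalSpace.Opens.mem_sSup.mpr
      ⟨K2.support.compl, fun y hy hy' => (hy hy').elim, hx⟩

end Nag
end

section
open Limits
namespace Nag
open Scheme.IdealSheafData (comap_comp comap_id)

lemma surj_of_closed {U V P : Scheme.{u}} (w : U ⟶ V) (j : V ⟶ P) [IsOpenImmersion j]
    (hd : DenseRange (w ≫ j)) (hc : IsClosed (Set.range w)) : Function.Surjective w := by
  intro t
  by_contra ht
  have ho : IsOpen (j '' (Set.range w)ᶜ) := j.isOpenEmbedding.isOpenMap _ hc.isOpen_compl
  obtain ⟨x, hx⟩ := hd.exists_mem_open ho ⟨j t, t, ht, rfl⟩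
  obtain ⟨v, hv, hv'⟩ := hx
  rw [Scheme.Hom.comp_apply] at hv'
  exact hv ⟨x, (j.isOpenEmbedding.injective hv').symm⟩

variable {S V1 V2 U : Scheme.{u}} {t1 : V1 ⟶ S} {t2 : V2 ⟶ S} {v1 : U ⟶ V1} {v2 : U ⟶ V2}

lemma closed_claim (hv : v1 ≫ t1 = v2 ≫ t2) [IsClosedImmersion (pullback.lift v1 v2 hv)]
    {Y1 Y2 P : Scheme.{u}} {y1 : Y1 ⟶ S} {y2 : Y2 ⟶ S} (e1 : V1 ⟶ Y1) (e2 : V2 ⟶ Y2)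
    [IsOpenImmersion e1] [IsOpenImmersion e2] (he1 : e1 ≫ y1 = t1) (he2 : e2 ≫ y2 = t2)
    (p : P ⟶ S) [IsSeparated p] (q1 : P ⟶ Y1) (q2 : P ⟶ Y2) (hq1 : q1 ≫ y1 = p) (hq2 : q2 ≫ y2 = p)
    (w : U ⟶ P) (hd : DenseRange w) (hw1 : w ≫ q1 = v1 ≫ e1) (hw2 : w ≫ q2 = v2 ≫ e2)
    (t : P) (h1 : t ∈ q1 ⁻¹ᵁ e1.opensRange) (h2 : t ∈ q2 ⁻¹ᵁ e2.opensRange) : ∃ x, w x = t := by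
  let V : P.Opens := q1 ⁻¹ᵁ e1.opensRange ⊓ q2 ⁻¹ᵁ e2.opensRange
  have hr1 : Set.range (V.ι ≫ q1) ⊆ Set.range e1 := by
    rintro _ ⟨x, rfl⟩
    exact x.2.1
  have hr2 : Set.range (V.ι ≫ q2) ⊆ Set.range e2 := by
    rintro _ ⟨x, rfl⟩
    exact x.2.2
  let l1 := IsOpenImmersion.lift e1 (V.ι ≫ q1) hr1
  let l2 := IsOpenImmersion.lift e2 (V.ι ≫ q2) hr2
  have hl1 : l1 ≫ e1 = V.ι ≫ q1 := IsOpenImmersion.lift_fac _ _ _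
  have hl2 : l2 ≫ e2 = V.ι ≫ q2 := IsOpenImmersion.lift_fac _ _ _
  have hl1' : l1 ≫ t1 = V.ι ≫ p := by rw [← he1, reassoc_of% hl1, hq1]
  have hl2' : l2 ≫ t2 = V.ι ≫ p := by rw [← he2, reassoc_of% hl2, hq2]
  let l : V.toScheme ⟶ pullback t1 t2 := pullback.lift l1 l2 (hl1'.trans hl2'.symm)
  have hwr : Set.range w ⊆ Set.range V.ι := by
    rw [Scheme.Opens.range_ι]
    rintro _ ⟨x, rfl⟩
    refine ⟨?_, ?_⟩
    · refine ⟨v1 x, ?_⟩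
      rw [← Scheme.Hom.comp_apply, ← hw1]; rfl
    · refine ⟨v2 x, ?_⟩
      rw [← Scheme.Hom.comp_apply, ← hw2]; rfl
  let w' := IsOpenImmersion.lift V.ι w hwr
  have hw' : w' ≫ V.ι = w := IsOpenImmersion.lift_fac _ _ _
  have hfac : w' ≫ l = pullback.lift v1 v2 hv := by
    apply pullback.hom_ext
    · rw [Category.assoc, pullback.lift_fst, pullback.lift_fst, ← cancel_mono e1, Category.assoc,
        hl1, reassoc_of% hw', hw1]
    · rw [Category.assoc, pullback.lift_snd, pullback.lift_snd, ← cancel_mono e2, Category.assoc,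
        hl2, reassoc_of% hw', hw2]
  have : IsSeparated (l ≫ (pullback.fst t1 t2 ≫ t1)) := by
    rw [pullback.lift_fst_assoc, hl1']; infer_instance
  have : IsSeparated l := IsSeparated.of_comp l (pullback.fst t1 t2 ≫ t1)
  have : IsClosedImmersion (w' ≫ l) := by rw [hfac]; infer_instance
  have : IsClosedImmersion w' := IsClosedImmersion.of_comp w' l
  obtain ⟨x, hx⟩ := surj_of_closed w' V.ι (by rw [hw']; exact hd)
    w'.isClosedEmbedding.isClosed_range ⟨t, h1, h2⟩
  refine ⟨x, ?_⟩
  rw [← hw', Scheme.Hom.comp_apply, hx]; rfl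

lemma exists_image (hv : v1 ≫ t1 = v2 ≫ t2) [IsOpenImmersion v1] [CompactSpace S]
    [IsLocallyNoetherian S]
    {Y1 Y2 : Scheme.{u}} {y1 : Y1 ⟶ S} {y2 : Y2 ⟶ S} [IsProper y1] [IsProper y2]
    (e1 : V1 ⟶ Y1) (e2 : V2 ⟶ Y2)
    [IsOpenImmersion e1] [IsOpenImmersion e2] (he1 : e1 ≫ y1 = t1) (he2 : e2 ≫ y2 = t2) :
    ∃ (P : Scheme.{u}) (p : P ⟶ S) (q1 : P ⟶ Y1) (q2 : P ⟶ Y2) (w : U ⟶ P),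
      IsProper p ∧ q1 ≫ y1 = p ∧ q2 ≫ y2 = p ∧ IsOpenImmersion w ∧ DenseRange w ∧
      w ≫ q1 = v1 ≫ e1 ∧ w ≫ q2 = v2 ≫ e2 := by
  let g : U ⟶ pullback y1 y2 := pullback.lift (v1 ≫ e1) (v2 ≫ e2) (by
    rw [Category.assoc, Category.assoc, he1, he2, hv])
  have h1 : g ≫ pullback.fst y1 y2 = v1 ≫ e1 := pullback.lift_fst _ _ _
  have h2 : g ≫ pullback.snd y1 y2 = v2 ≫ e2 := pullback.lift_snd _ _ _
  have : IsImmersion (g ≫ pullback.fst y1 y2) := by rw [h1]; infer_instance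
  have : IsImmersion g := IsImmersion.of_comp g (pullback.fst y1 y2)
  have : IsLocallyNoetherian Y1 := LocallyOfFiniteType.isLocallyNoetherian y1
  have : CompactSpace Y1 := QuasiCompact.compactSpace_of_compactSpace y1
  have : IsNoetherian Y1 := {}
  have : TopologicalSpace.NoetherianSpace U := 
    (v1 ≫ e1).isOpenEmbedding.isInducing.noetherianSpace
  have : QuasiCompact g := quasiCompact_of_noetherianSpace_source g
  refine ⟨g.image, g.imageι ≫ pullback.fst y1 y2 ≫ y1, g.imageι ≫ pullback.fst y1 y2,
    g.imageι ≫ pullback.snd y1 y2, g.toImage, inferInstance, by simp, ?_, inferInstance,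
    g.toImage.denseRange, ?_, ?_⟩
  · rw [Category.assoc, pullback.condition]
  · rw [g.toImage_imageι_assoc, h1]
  · rw [g.toImage_imageι_assoc, h2]

lemma St.init (hv : v1 ≫ t1 = v2 ≫ t2) [IsClosedImmersion (pullback.lift v1 v2 hv)]
    [IsOpenImmersion v1] [CompactSpace S] [IsLocallyNoetherian S]
    {Y1 Y2 : Scheme.{u}} {y1 : Y1 ⟶ S} {y2 : Y2 ⟶ S} [IsProper y1] [IsProper y2]
    (e1 : V1 ⟶ Y1) (e2 : V2 ⟶ Y2)
    [IsOpenImmersion e1] [IsOpenImmersion e2] (he1 : e1 ≫ y1 = t1) (he2 : e2 ≫ y2 = t2) :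
    Nonempty (St t1 t2 v1 v2) := by
  obtain ⟨P, p, q1, q2, w, hp, hq1, hq2, hw, hd, hw1, hw2⟩ := exists_image hv e1 e2 he1 he2
  have hcl := closed_claim hv e1 e2 he1 he2 p q1 q2 hq1 hq2 w hd hw1 hw2
  have hwo1 : ∀ x, w x ∈ q1 ⁻¹ᵁ e1.opensRange := fun x => ⟨v1 x, by
    rw [← Scheme.Hom.comp_apply, ← hw1]; rfl⟩
  have hwo2 : ∀ x, w x ∈ q2 ⁻¹ᵁ e2.opensRange := fun x => ⟨v2 x, by
    rw [← Scheme.Hom.comp_apply, ← hw2]; rfl⟩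
  let E1 : TopologicalSpace.Closeds P :=
    ⟨closure {t | t ∈ q1 ⁻¹ᵁ e1.opensRange ∧ t ∉ Set.range w}, isClosed_closure⟩
  let E2 : TopologicalSpace.Closeds P :=
    ⟨closure {t | t ∈ q2 ⁻¹ᵁ e2.opensRange ∧ t ∉ Set.range w}, isClosed_closure⟩
  have hE1 : ∀ t, t ∈ E1 → t ∉ q2 ⁻¹ᵁ e2.opensRange := by
    intro t ht ht'
    obtain ⟨z, hz, hz1, hz2⟩ := mem_closure_iff.mp ht _ (q2 ⁻¹ᵁ e2.opensRange).isOpen ht'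
    exact hz2 (hcl z hz1 hz)
  have hE2 : ∀ t, t ∈ E2 → t ∉ q1 ⁻¹ᵁ e1.opensRange := by
    intro t ht ht'
    obtain ⟨z, hz, hz1, hz2⟩ := mem_closure_iff.mp ht _ (q1 ⁻¹ᵁ e1.opensRange).isOpen ht'
    exact hz2 (hcl z hz hz1)
  let K1 := Scheme.IdealSheafData.vanishingIdeal E1
  let K2 := Scheme.IdealSheafData.vanishingIdeal E2
  have hK1 : ∀ t, t ∈ K1.support ↔ t ∈ E1 := fun t => by
    rw [← SetLike.mem_coe, Scheme.IdealSheafData.coe_support_vanishingIdeal]; rfl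
  have hK2 : ∀ t, t ∈ K2.support ↔ t ∈ E2 := fun t => by
    rw [← SetLike.mem_coe, Scheme.IdealSheafData.coe_support_vanishingIdeal]; rfl
  have : IsLocallyNoetherian P := LocallyOfFiniteType.isLocallyNoetherian p
  obtain ⟨T, b, hb, hB⟩ := exists_blowup (K1 ⊔ K2)
  have hA1 : ∀ t, t ∈ (K1.comap b).support ↔ b t ∈ E1 := fun t => by
    rw [Scheme.IdealSheafData.support_comap, ← hK1]; rfl
  have hA2 : ∀ t, t ∈ (K2.comap b).support ↔ b t ∈ E2 := fun t => by
    rw [Scheme.IdealSheafData.support_comap, ← hK2]; rfl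
  obtain ⟨O1, O2, hO, hO1, hO2, hO1', hO2'⟩ := split_opens (K1.comap b) (K2.comap b) (by
    rw [← Scheme.IdealSheafData.comap_sup]; exact hB.inv)
  obtain ⟨c, hc, hco, hct⟩ := lift_open hB w (comap_eq_top _ _ (fun v hv => by
    rw [Scheme.IdealSheafData.support_sup] at hv
    exact hE1 _ ((hK1 _).mp hv.1) (hwo2 v)))
  have hcb : ∀ v, b (c v) = w v := fun v => by rw [← Scheme.Hom.comp_apply, hc]
  have hr1 : Set.range c ⊆ Set.range O1.ι := by
    rw [Scheme.Opens.range_ι]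
    rintro _ ⟨v, rfl⟩
    refine hO1' _ fun h => hE1 _ ((hA1 _).mp h) ?_
    rw [hcb]; exact hwo2 v
  have hr2 : Set.range c ⊆ Set.range O2.ι := by
    rw [Scheme.Opens.range_ι]
    rintro _ ⟨v, rfl⟩
    refine hO2' _ fun h => hE2 _ ((hA2 _).mp h) ?_
    rw [hcb]; exact hwo1 v
  let c1 := IsOpenImmersion.lift O1.ι c hr1
  let c2 := IsOpenImmersion.lift O2.ι c hr2
  have hc1 : c1 ≫ O1.ι = c := IsOpenImmersion.lift_fac _ _ _
  have hc2 : c2 ≫ O2.ι = c := IsOpenImmersion.lift_fac _ _ _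
  have : IsOpenImmersion (c1 ≫ O1.ι) := by rw [hc1]; exact hco
  have oc1 : IsOpenImmersion c1 := IsOpenImmersion.of_comp _ O1.ι
  have : IsOpenImmersion (c2 ≫ O2.ι) := by rw [hc2]; exact hco
  have oc2 : IsOpenImmersion c2 := IsOpenImmersion.of_comp _ O2.ι
  refine ⟨⟨T, Y1, Y2, b ≫ p, y1, y2, O1, O2, O1.ι ≫ b ≫ q1, O2.ι ≫ b ≫ q2, e1, e2, c1, c2,
    inferInstance, inferInstance, inferInstance, inferInstance, inferInstance, oc1, oc2,
    by simp [hq1], by simp [hq2], he1, he2, hO, hc1.trans hc2.symm,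
    by rw [reassoc_of% hc1, reassoc_of% hc, hw1], by rw [reassoc_of% hc2, reassoc_of% hc, hw2],
    ?_, ?_⟩⟩
  · intro x o hx
    have ho1 : b (O1.ι o) ∈ q1 ⁻¹ᵁ e1.opensRange := ⟨x, hx⟩
    have ho : b (O1.ι o) ∈ Set.range w := by
      by_contra hn
      have h1 : b (O1.ι o) ∈ E1 := subset_closure ⟨ho1, hn⟩
      exact hE2 _ ((hA2 _).mp (hO1 _ o.2 ((hA1 _).mpr h1))) ho1
    obtain ⟨v, hv⟩ := ho
    refine ⟨v, O1.ι.isOpenEmbedding.injective ?_⟩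
    rw [← Scheme.Hom.comp_apply, hc1]
    exact hct _ _ hv.symm
  · intro x o hx
    have ho1 : b (O2.ι o) ∈ q2 ⁻¹ᵁ e2.opensRange := ⟨x, hx⟩
    have ho : b (O2.ι o) ∈ Set.range w := by
      by_contra hn
      have h1 : b (O2.ι o) ∈ E2 := subset_closure ⟨ho1, hn⟩
      exact hE1 _ ((hA1 _).mp (hO2 _ o.2 ((hA2 _).mpr h1))) ho1
    obtain ⟨v, hv⟩ := ho
    refine ⟨v, O2.ι.isOpenEmbedding.injective ?_⟩
    rw [← Scheme.Hom.comp_apply, hc2]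
    exact hct _ _ hv.symm

end Nag
end

section
open Limits
namespace Nag

lemma two_piece {k : CommRingCat.{u}} [IsNoetherianRing k] {X : Scheme.{u}} (s : X ⟶ Spec k)
    [IsSeparated s] (U1 U2 : X.Opens) (hU : U1 ⊔ U2 = ⊤) (h1 : Cpt (U1.ι ≫ s))
    (h2 : Cpt (U2.ι ≫ s)) : Cpt s := by
  obtain ⟨Y1, y1, e1, py1, oe1, he1⟩ := h1
  obtain ⟨Y2, y2, e2, py2, oe2, he2⟩ := h2
  have hv : X.homOfLE (inf_le_left : U1 ⊓ U2 ≤ U1) ≫ U1.ι ≫ s =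
      X.homOfLE (inf_le_right : U1 ⊓ U2 ≤ U2) ≫ U2.ι ≫ s := by simp
  have : IsClosedImmersion (pullback.lift _ _ hv) := by
    have : pullback.lift _ _ hv = (isPullback_opens_inf U1 U2).isoPullback.hom ≫
        pullback.mapDesc U1.ι U2.ι s := by
      apply pullback.hom_ext
      · rw [pullback.lift_fst, Category.assoc, pullback.mapDesc, pullback.map, pullback.lift_fst,
          Category.comp_id, IsPullback.isoPullback_hom_fst]
      · rw [pullback.lift_snd, Category.assoc, pullback.mapDesc, pullback.map, pullback.lift_snd,
          Category.comp_id, IsPullback.isoPullback_hom_snd]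
    rw [this]; infer_instance
  obtain ⟨D⟩ := St.init hv e1 e2 he1 he2
  exact St.cpt s U1 U2 hU D

lemma Cpt.all {k : CommRingCat.{u}} [IsNoetherianRing k] {X : Scheme.{u}} (s : X ⟶ Spec k)
    [IsSeparated s] [LocallyOfFiniteType s] [QuasiCompact s] : Cpt s := by
  have : CompactSpace X := QuasiCompact.compactSpace_of_compactSpace s
  suffices h : ∀ V : X.Opens, IsCompact (V : Set X) → Cpt (V.ι ≫ s) by
    have := (h ⊤ isCompact_univ).iso (X.topIso.inv)
    have ht : X.topIso.inv ≫ (⊤ : X.Opens).ι = 𝟙 X := X.topIso.inv_hom_id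
    rwa [reassoc_of% ht] at this
  intro V hV
  refine compact_open_induction_on (P := fun V => Cpt (V.ι ≫ s)) V hV ?_ ?_
  · have : IsAffine (⊥ : X.Opens).toScheme := isAffineOpen_bot X
    exact Cpt.affine _
  · intro W hW U hWc
    have hU : IsAffine U.1.toScheme := U.2
    have hUc : Cpt (U.1.ι ≫ s) := Cpt.affine _
    have key : ∀ V : X.Opens, Cpt (V.ι ≫ s) →
        Cpt (((W ⊔ U.1).ι ⁻¹ᵁ V).ι ≫ (W ⊔ U.1).ι ≫ s) := by
      intro V h
      have := h.iso ((W ⊔ U.1).ι ∣_ V)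
      rwa [morphismRestrict_ι_assoc] at this
    refine two_piece _ ((W ⊔ U.1).ι ⁻¹ᵁ W) ((W ⊔ U.1).ι ⁻¹ᵁ U.1) ?_ (key W hWc) (key U.1 hUc)
    ext x
    exact ⟨fun _ => trivial, fun _ => x.2⟩

end Nag
end

section
open Limits
namespace Nag

lemma cart {X Y Xc Yc S : Scheme.{u}} (f : Y ⟶ X) (iX : X ⟶ Xc) (iY : Y ⟶ Yc) (fc : Yc ⟶ Xc)
    (s : Xc ⟶ S) [IsSeparated (fc ≫ s)] [IsOpenImmersion iX] [IsOpenImmersion iY]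
    (hd : DenseRange iY) (h : f ≫ iX = iY ≫ fc) [IsProper f] : IsPullback f iY iX fc := by
  have hp := IsPullback.of_hasPullback iX fc
  let l : Y ⟶ pullback iX fc := pullback.lift f iY h
  have hl1 : l ≫ pullback.fst iX fc = f := pullback.lift_fst _ _ _
  have hl2 : l ≫ pullback.snd iX fc = iY := pullback.lift_snd _ _ _
  have : IsSeparated fc := IsSeparated.of_comp fc s
  have : IsProper (l ≫ pullback.fst iX fc) := by rw [hl1]; infer_instance
  have : IsProper l := IsProper.of_comp l (pullback.fst iX fc)
  have : IsOpenImmersion (l ≫ pullback.snd iX fc) := by rw [hl2]; infer_instance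
  have : IsOpenImmersion l := IsOpenImmersion.of_comp l (pullback.snd iX fc)
  have hsurj := surj_of_closed l (pullback.snd iX fc) (by rw [hl2]; exact hd)
    l.isClosedMap.isClosed_range
  have : Surjective l := ⟨hsurj⟩
  have : IsIso l := by
    rw [isIso_iff_isOpenImmersion_and_epi_base]
    refine ⟨inferInstance, ?_⟩
    rw [TopCat.epi_iff_surjective]
    exact hsurj
  exact hp.of_iso' (asIso l) (Iso.refl _) (Iso.refl _) (Iso.refl _) (by simp [hl1]) (by simp [hl2])
    (by simp) (by simp)

lemma exists_dense {k : CommRingCat.{u}} [IsNoetherianRing k] {X P : Scheme.{u}} (s : X ⟶ Spec k)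
    [LocallyOfFiniteType s] [QuasiCompact s] (p : P ⟶ Spec k) [IsProper p] (g : X ⟶ P)
    [IsImmersion g] (hg : g ≫ p = s) :
    ∃ (Q : Scheme.{u}) (q : Q ⟶ P) (i : X ⟶ Q), IsProper (q ≫ p) ∧ IsOpenImmersion i ∧
      DenseRange i ∧ i ≫ q = g := by
  have : IsLocallyNoetherian X := LocallyOfFiniteType.isLocallyNoetherian s
  have : CompactSpace X := QuasiCompact.compactSpace_of_compactSpace s
  have : IsNoetherian X := {}
  have : QuasiCompact g := quasiCompact_of_noetherianSpace_source g
  exact ⟨g.image, g.imageι, g.toImage, inferInstance, inferInstance, g.toImage.denseRange,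
    g.toImage_imageι⟩

end Nag
end

/-- **Compatible Nagata compactifications.**
Let `k` be a field, let `X` and `Y` be separated finite-type `k`-schemes, and let
`f : Y → X` be a morphism of `k`-schemes.  Then there exist proper `k`-schemes `X̄`, `Ȳ`,
open immersions `X → X̄` and `Y → Ȳ` with dense image, and a morphism `f̄ : Ȳ → X̄`
making the evident square commute; moreover `X̄`, `Ȳ`, `f̄` can be chosen such that if
`f` is proper, then `Y = f̄⁻¹(X)`, i.e. the commuting square is Cartesian. -/
theorem exists_compatible_compactification {k : Type u} [Field k]
    (X Y : Scheme.{u})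
    (sX : X ⟶ Spec (CommRingCat.of k)) (sY : Y ⟶ Spec (CommRingCat.of k))
    [IsSeparated sX] [LocallyOfFiniteType sX] [QuasiCompact sX]
    [IsSeparated sY] [LocallyOfFiniteType sY] [QuasiCompact sY]
    (f : Y ⟶ X) (hf : f ≫ sX = sY) :
    ∃ (Xc Yc : Scheme.{u})
      (sXc : Xc ⟶ Spec (CommRingCat.of k)) (sYc : Yc ⟶ Spec (CommRingCat.of k))
      (iX : X ⟶ Xc) (iY : Y ⟶ Yc) (fc : Yc ⟶ Xc),
      IsProper sXc ∧ IsProper sYc ∧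
      IsOpenImmersion iX ∧ IsOpenImmersion iY ∧
      DenseRange iX.base ∧ DenseRange iY.base ∧
      iX ≫ sXc = sX ∧ iY ≫ sYc = sY ∧ fc ≫ sXc = sYc ∧
      f ≫ iX = iY ≫ fc ∧
      (IsProper f → IsPullback f iY iX fc) := by
  have : IsNoetherianRing (CommRingCat.of k) := inferInstanceAs (IsNoetherianRing k)
  obtain ⟨P, p, i, hp, hi, hip⟩ := Nag.Cpt.all sX
  obtain ⟨Q, q, j, hq, hj, hjp⟩ := Nag.Cpt.all sY
  obtain ⟨Xc, a, iX, ha, hiX, hdX, haX⟩ := Nag.exists_dense sX p i hip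
  have hX : iX ≫ a ≫ p = sX := by rw [reassoc_of% haX, hip]
  let g : Y ⟶ Limits.pullback q (a ≫ p) := Limits.pullback.lift j (f ≫ iX) (by
    rw [hjp, Category.assoc, hX, hf])
  have hg1 : g ≫ Limits.pullback.fst _ _ = j := Limits.pullback.lift_fst _ _ _
  have hg2 : g ≫ Limits.pullback.snd _ _ = f ≫ iX := Limits.pullback.lift_snd _ _ _
  have : IsImmersion (g ≫ Limits.pullback.fst _ _) := by rw [hg1]; infer_instance
  have : IsImmersion g := IsImmersion.of_comp g (Limits.pullback.fst _ _)
  obtain ⟨Yc, b, iY, hb, hiY, hdY, hbY⟩ := Nag.exists_dense sY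
    (Limits.pullback.snd q (a ≫ p) ≫ a ≫ p) g (by rw [reassoc_of% hg2, hX, hf])
  have hc : f ≫ iX = iY ≫ b ≫ Limits.pullback.snd q (a ≫ p) := by rw [reassoc_of% hbY, hg2]
  refine ⟨Xc, Yc, a ≫ p, b ≫ Limits.pullback.snd q (a ≫ p) ≫ a ≫ p, iX, iY, b ≫ Limits.pullback.snd q (a ≫ p),
    ha, hb, hiX, hiY, hdX, hdY, hX, ?_, by simp, hc, ?_⟩
  · rw [reassoc_of% hbY, reassoc_of% hg2, hX, hf]
  · intro hfp
    have : IsSeparated ((b ≫ Limits.pullback.snd q (a ≫ p)) ≫ a ≫ p) := by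
      rw [Category.assoc]; exact hb.toIsSeparated
    exact Nag.cart f iX iY _ (a ≫ p) hdY hc
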